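/- arXiv:1812.01436 — 3 statements merged into one kernel-verified Lean document; each statement's English description precedes it below -/
import Mathlib

section
/- A frame of ν arcs F_ν = L₁ ∪ … ∪ L_ν ∪ {O} is tame if and only if there exists a homeomorphism G : ℝ³ ∖ {O} → ℝ³ ∖ {O} such that for every t > 0 and every j ∈ {1, …, ν} the intersection G(ℙ_t) ∩ L_j consists of exactly one point. -/
noncomputable section

open Metric Set Topology

abbrev R3 : Type := EuclideanSpace ℝ (Fin 3)
abbrev R3o : Type := {x : R3 // x ≠ 0}
abbrev S2 : Type := (Metric.sphere (0:R3) 1 : Set R3)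
abbrev Circle1 : Type := AddCircle (1:ℝ)
abbrev S2xS1 : Type := S2 × Circle1

/-- The homothety `A(x) = 2x` on `ℝ³`. -/
def A3 : R3 → R3 := fun x => (2:ℝ) • x

/-- The homothety induced on `ℝ³ ∖ {O}`. -/
def A3o : R3o → R3o := fun x => ⟨A3 x.1, by simp [A3, x.2]⟩

/-- The radial projection of a nonzero vector onto the unit sphere. -/
def unitize (x : R3o) : S2 :=
  ⟨‖x.1‖⁻¹ • x.1, mem_sphere_zero_iff_norm.mpr (by
    rw [norm_smul, norm_inv, norm_norm, inv_mul_cancel₀ (norm_ne_zero_iff.mpr x.2)])⟩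

/-- The homeomorphism `p : ℝ³ ∖ {O} → S² × ℝ`, `p(x) = (x/‖x‖, log₂‖x‖)`. -/
def pMap (x : R3o) : S2 × ℝ := (unitize x, Real.logb 2 ‖x.1‖)

/-- The covering `π : ℝ³ ∖ {O} → S² × S¹`, `π(x) = (x/‖x‖, log₂‖x‖ mod 1)`. -/
def piMap (x : R3o) : S2xS1 := (unitize x, ((Real.logb 2 ‖x.1‖ : ℝ) : Circle1))

/-- A set consists of exactly one point. -/
def IsSingletonSet {α : Type*} (S : Set α) : Prop := ∃ a, S = {a}

/-- An infinite arc from the origin: a one-dimensional topological submanifold of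
`ℝ³ ∖ {O}` on which `x ↦ log₂‖x‖` is onto `ℝ`. -/
def IsInfiniteArc (L : Set R3) : Prop :=
  (0:R3) ∉ L ∧
  Nonempty (ChartedSpace (EuclideanSpace ℝ (Fin 1)) L) ∧
  (fun x : R3 => Real.logb 2 ‖x‖) '' L = Set.univ

/-- A frame of `ν` arcs: pairwise disjoint infinite arcs from `O`, each invariant
under the homothety `A`. -/
def IsArcFrame {ν : ℕ} (L : Fin ν → Set R3) : Prop :=
  (∀ j, IsInfiniteArc (L j)) ∧
  (Pairwise fun i j => Disjoint (L i) (L j)) ∧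
  (∀ j, A3 '' L j = L j)

/-- The open ray from the origin through `s`. -/
def ray (s : R3) : Set R3 := {x | ∃ t : ℝ, 0 < t ∧ x = t • s}

/-- The (set underlying the) frame `F` is tame: it is the image of a standard frame of
`ν` pairwise distinct rays under a homeomorphism of `ℝ³`. -/
def IsTameFrame (ν : ℕ) (F : Set R3) : Prop :=
  ∃ (s : Fin ν → R3) (H : R3 ≃ₜ R3),
    (∀ j, ‖s j‖ = 1) ∧ Function.Injective s ∧
    F = H '' ((⋃ j, ray (s j)) ∪ {0})

/-- `C` is a topologically embedded circle in `S² × S¹` representing a generator of the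
fundamental group. -/
def IsGeneratorCircle (C : Set S2xS1) : Prop :=
  ∃ e : Circle1 → S2xS1, IsEmbedding e ∧ Set.range e = C ∧
    ∃ γ : Path (e 0) (e 0),
      (∀ t : unitInterval, γ t = e ((t : ℝ) : Circle1)) ∧
      Subgroup.zpowers (FundamentalGroup.fromPath (X := TopCat.of S2xS1) ⟦γ⟧) = ⊤

/-- A frame of `ν` circles: pairwise disjoint embedded circles, each a generator of
`π₁(S² × S¹)`. -/
def IsCircleFrame {ν : ℕ} (C : Fin ν → Set S2xS1) : Prop :=
  (∀ j, IsGeneratorCircle (C j)) ∧ (Pairwise fun i j => Disjoint (C i) (C j))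

/-- The standard circle `{q} × S¹`. -/
def stdCircle (q : S2) : Set S2xS1 := {z | z.1 = q}

/-- The circles frame `J` is trivial: it is the image of a standard circles frame under a
homeomorphism of `S² × S¹`. -/
def IsTrivialCircleFrame (ν : ℕ) (J : Set S2xS1) : Prop :=
  ∃ (q : Fin ν → S2) (Φ : S2xS1 ≃ₜ S2xS1),
    Function.Injective q ∧ J = Φ '' (⋃ j, stdCircle (q j))

/-- The lift `π⁻¹(C)` of a subset of `S² × S¹`, viewed as a subset of `ℝ³`. -/
def arcLift (C : Set S2xS1) : Set R3 := Subtype.val '' (piMap ⁻¹' C)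

/-- The frame of arcs `F_J = π⁻¹(J) ∪ {O}` associated with a circles frame `J`. -/
def assocFrameSet (J : Set S2xS1) : Set R3 := arcLift J ∪ {0}

/-- A family of bijections of `X` indexed by `T` whose evaluation map `T × X → X` is
continuous. -/
def JointlyContinuous {T X : Type*} [TopologicalSpace T] [TopologicalSpace X]
    (Φ : T → Equiv.Perm X) : Prop :=
  Continuous fun p : T × X => Φ p.1 p.2

namespace JointlyContinuous

variable {T T' X : Type*} [TopologicalSpace T] [TopologicalSpace T'] [TopologicalSpace X]
  {Φ Ψ : T → Equiv.Perm X}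

lemma one : JointlyContinuous fun _ : T => (1 : Equiv.Perm X) :=
  continuous_snd

lemma mul (hΦ : JointlyContinuous Φ) (hΨ : JointlyContinuous Ψ) :
    JointlyContinuous fun t => Φ t * Ψ t :=
  Continuous.comp hΦ (continuous_fst.prodMk hΨ)

lemma comp (hΦ : JointlyContinuous Φ) {r : T' → T} (hr : Continuous r) :
    JointlyContinuous fun t => Φ (r t) :=
  Continuous.comp hΦ ((hr.comp continuous_fst).prodMk continuous_snd)

lemma inv [CompactSpace X] [T2Space X] [T2Space T] (hΦ : JointlyContinuous Φ) :
    JointlyContinuous fun t => (Φ t)⁻¹ := by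
  let F : T × X ≃ T × X := Equiv.prodShear (Equiv.refl T) Φ
  have hF : Continuous F := continuous_fst.prodMk hΦ
  have hproper : IsProperMap F :=
    isProperMap_of_comp_of_t2 (g := Prod.fst) hF continuous_fst
      (isProperMap_fst_of_compactSpace (X := T) (Y := X))
  exact continuous_snd.comp
    (F.toHomeomorphOfContinuousClosed hF hproper.isClosedMap).symm.continuous

end JointlyContinuous

/-- Translating the origin by a short vector `w`, with the displacement dying off linearly
outside the unit ball, is a bijection. -/
lemma bijective_add_bump_smul {V : Type*} [NormedAddCommGroup V] [NormedSpace ℝ V]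
    [CompleteSpace V] {w : V} (hw : ‖w‖ ≤ 1 / 2) :
    Function.Bijective fun x : V => x + max (1 - ‖x‖) 0 • w := by
  rcases subsingleton_or_nontrivial V with hV | hV
  · exact ⟨fun _ _ _ => Subsingleton.elim _ _, fun y => ⟨y, Subsingleton.elim _ _⟩⟩
  have happ : ApproximatesLinearOn (fun x : V => x + max (1 - ‖x‖) 0 • w)
      ((ContinuousLinearEquiv.refl ℝ V : V ≃L[ℝ] V) : V →L[ℝ] V) univ (1 / 2) := by
    intro x _ y _
    have h1 : |max (1 - ‖x‖) 0 - max (1 - ‖y‖) 0| ≤ ‖x - y‖ := by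
      refine (abs_max_sub_max_le_abs _ _ _).trans ?_
      rw [show (1 - ‖x‖) - (1 - ‖y‖) = -(‖x‖ - ‖y‖) by ring, abs_neg]
      exact abs_norm_sub_norm_le x y
    have h2 : x + max (1 - ‖x‖) 0 • w - (y + max (1 - ‖y‖) 0 • w) - (x - y)
        = (max (1 - ‖x‖) 0 - max (1 - ‖y‖) 0) • w := by
      rw [sub_smul]; abel
    simp only [ContinuousLinearEquiv.coe_refl, ContinuousLinearMap.coe_id', id]
    rw [h2, norm_smul, Real.norm_eq_abs]
    have := mul_le_mul h1 hw (norm_nonneg _) (norm_nonneg _)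
    simpa [mul_comm] using this
  have hc : (1 / 2 : NNReal) <
      ‖((ContinuousLinearEquiv.refl ℝ V).symm : V →L[ℝ] V)‖₊⁻¹ := by
    simp only [ContinuousLinearEquiv.refl_symm, ContinuousLinearEquiv.coe_refl,
      ContinuousLinearMap.nnnorm_id, inv_one]
    rw [← NNReal.coe_lt_coe]; norm_num
  exact (happ.toHomeomorph _ (Or.inr hc)).bijective

/-- Inside an embedded copy of a normed space, the point `φ 0` can be pushed to the nearby
points `φ v` by bijections which depend continuously on `v` and are supported in the copy. -/
lemma exists_jointlyContinuous_push {V X : Type*} [NormedAddCommGroup V] [NormedSpace ℝ V]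
    [FiniteDimensional ℝ V] [TopologicalSpace X] [T2Space X] {φ : V → X}
    (hφ : IsOpenEmbedding φ) :
    ∃ Φ : V → Equiv.Perm X, JointlyContinuous Φ ∧
      (∀ v, ‖v‖ ≤ 1 / 2 → Φ v (φ 0) = φ v) ∧ ∀ v, ∀ x ∉ range φ, Φ v x = x := by
  classical
  have : CompleteSpace V := FiniteDimensional.complete ℝ V
  have : ProperSpace V := FiniteDimensional.proper ℝ V
  let ρ : V → V := fun v => (max 1 (2 * ‖v‖))⁻¹ • v
  have hpos : ∀ v : V, 0 < max 1 (2 * ‖v‖) := fun v => lt_max_of_lt_left one_pos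
  have hρ : ∀ v, ‖ρ v‖ ≤ 1 / 2 := by
    intro v
    simp only [ρ, norm_smul, norm_inv, Real.norm_eq_abs, abs_of_pos (hpos v)]
    rw [inv_mul_le_iff₀ (hpos v)]
    linarith [le_max_right 1 (2 * ‖v‖)]
  have hρc : Continuous ρ := by
    have : Continuous fun v : V => (max 1 (2 * ‖v‖))⁻¹ :=
      (by fun_prop : Continuous fun v : V => max 1 (2 * ‖v‖)).inv₀ fun v => (hpos v).ne'
    exact this.smul continuous_id
  have hρid : ∀ v, ‖v‖ ≤ 1 / 2 → ρ v = v := by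
    intro v hv
    have : max 1 (2 * ‖v‖) = 1 := max_eq_left (by linarith)
    simp [ρ, this]
  let β : V → Equiv.Perm V := fun v =>
    Equiv.ofBijective _ (bijective_add_bump_smul (hρ v))
  have hβ : ∀ v x, β v x = x + max (1 - ‖x‖) 0 • ρ v := fun _ _ => rfl
  let e : V ≃ {x // x ∈ range φ} := Equiv.ofInjective φ hφ.injective
  have hin : ∀ v x, (β v).extendDomain e (φ x) = φ (β v x) := fun v x =>
    Equiv.Perm.extendDomain_apply_image (β v) e x
  have hout : ∀ v, ∀ x ∉ range φ, (β v).extendDomain e x = x := fun v x hx =>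
    Equiv.Perm.extendDomain_apply_not_subtype (β v) e hx
  refine ⟨fun v => (β v).extendDomain e, ?_, fun v hv => ?_, hout⟩
  · refine continuous_iff_continuousAt.2 fun ⟨v, x⟩ => ?_
    by_cases hx : x ∈ range φ
    · obtain ⟨y, rfl⟩ := hx
      have hemb : IsOpenEmbedding (Prod.map (id : V → V) φ) := IsOpenEmbedding.id.prodMap hφ
      refine (hemb.continuousAt_iff (x := (v, y))).1 ?_
      refine Continuous.continuousAt ?_
      have : (fun p : V × X => (β p.1).extendDomain e p.2) ∘ Prod.map id φ =
          fun p : V × V => φ (p.2 + max (1 - ‖p.2‖) 0 • ρ p.1) := by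
        funext p
        exact hin p.1 p.2
      rw [this]
      exact hφ.continuous.comp (by fun_prop)
    · have hK : IsClosed (φ '' closedBall 0 1) :=
        ((isCompact_closedBall (0 : V) 1).image hφ.continuous).isClosed
      have hmem : ∀ᶠ p : V × X in 𝓝 (v, x), p.2 ∉ φ '' closedBall 0 1 :=
        continuous_snd.continuousAt.eventually
          (hK.isOpen_compl.mem_nhds fun h => hx (image_subset_range _ _ h))
      refine continuous_snd.continuousAt.congr ?_
      filter_upwards [hmem] with p hp
      by_cases hr : p.2 ∈ range φ
      · obtain ⟨y, hy⟩ := hr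
        have hy1 : 1 < ‖y‖ := by
          by_contra! h
          exact hp ⟨y, by simpa using h, hy⟩
        have hz : max (1 - ‖y‖) 0 = 0 := max_eq_right (by linarith)
        rw [← hy, hin, hβ, hz, zero_smul, add_zero]
      · exact (hout _ _ hr).symm
  · rw [hin, hβ, hρid v hv]
    simp

/-- Around each point of a topological manifold there are arbitrarily small open embeddings
of the model space. -/
lemma exists_isOpenEmbedding_subset {V M : Type*} [NormedAddCommGroup V] [NormedSpace ℝ V]
    [TopologicalSpace M] [ChartedSpace V M] (x : M) {U : Set M} (hU : U ∈ 𝓝 x) :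
    ∃ φ : V → M, IsOpenEmbedding φ ∧ φ 0 = x ∧ range φ ⊆ U := by
  let c := chartAt V x
  have hx : x ∈ c.source := mem_chart_source V x
  have hnhds : c.target ∩ c.symm ⁻¹' U ∈ 𝓝 (c x) := by
    refine Filter.inter_mem (c.open_target.mem_nhds (c.map_source hx)) ?_
    refine (c.continuousAt_symm (c.map_source hx)).preimage_mem_nhds ?_
    rwa [c.left_inv hx]
  obtain ⟨r, hr, hball⟩ := Metric.mem_nhds_iff.1 hnhds
  have hmaps : ∀ v : V, OpenPartialHomeomorph.univBall (c x) r v ∈ ball (c x) r := fun v => by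
    rw [← OpenPartialHomeomorph.univBall_target (c x) hr]
    exact (OpenPartialHomeomorph.univBall (c x) r).map_source (by simp)
  let e := (OpenPartialHomeomorph.univBall (c x) r).trans c.symm
  have he : e.source = univ := by
    refine eq_univ_of_forall fun v => ?_
    simpa [e] using (hball (hmaps v)).1
  refine ⟨e, e.isOpenEmbedding he, ?_, ?_⟩
  · simp [e, c.left_inv hx]
  · rintro _ ⟨v, rfl⟩
    exact (hball (hmaps v)).2

/-- The projection of the real line onto an interval, in a form valid for real arguments. -/
def clip (a b t : ℝ) : ℝ := max a (min b t)

lemma continuous_clip (a b : ℝ) : Continuous (clip a b) := by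
  unfold clip; fun_prop

lemma clip_mem {a b : ℝ} (hab : a ≤ b) (t : ℝ) : clip a b t ∈ Icc a b :=
  ⟨le_max_left _ _, max_le hab (min_le_left _ _)⟩

lemma clip_of_mem {a b t : ℝ} (ht : t ∈ Icc a b) : clip a b t = t := by
  rw [clip, min_eq_right ht.2, max_eq_right ht.1]

section Strands

variable {X : Type*} [TopologicalSpace X] [T2Space X]

/-- A single moving point of a manifold can be followed for a short time by bijections
supported in a given neighbourhood of its initial position. -/
lemma exists_follow_point (V : Type*) [NormedAddCommGroup V] [NormedSpace ℝ V]
    [FiniteDimensional ℝ V] [ChartedSpace V X]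
    {τ : ℝ → X} (hτ : Continuous τ) (t₀ : ℝ) {U : Set X}
    (hU : U ∈ 𝓝 (τ t₀)) :
    ∃ ε > 0, ∃ Φ : ℝ → Equiv.Perm X, JointlyContinuous Φ ∧
      (∀ t ∈ Icc (t₀ - ε) (t₀ + ε), τ t ∈ U ∧ Φ t (τ t₀) = τ t) ∧
      ∀ t, ∀ x ∉ U, Φ t x = x := by
  obtain ⟨φ, hφ, hφ0, hφU⟩ := exists_isOpenEmbedding_subset (V := V) (τ t₀) hU
  obtain ⟨Ψ, hΨ, hpush, hsupp⟩ := exists_jointlyContinuous_push hφ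
  have hnhds : φ '' ball 0 (1 / 2) ∈ 𝓝 (τ t₀) :=
    (hφ.isOpenMap _ isOpen_ball).mem_nhds ⟨0, by simp, hφ0⟩
  obtain ⟨ε, hε, hball⟩ := Metric.nhds_basis_closedBall.mem_iff.1
    (hτ.continuousAt.preimage_mem_nhds hnhds)
  rw [Real.closedBall_eq_Icc] at hball
  have hle : t₀ - ε ≤ t₀ + ε := by linarith
  have hex : ∀ t, ∃ v, v ∈ ball (0 : V) (1 / 2) ∧ φ v = τ (clip (t₀ - ε) (t₀ + ε) t) :=
    fun t => hball (clip_mem hle t)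
  choose w hw hφw using hex
  have hwc : Continuous w := by
    rw [hφ.isInducing.continuous_iff]
    exact (hτ.comp (continuous_clip _ _)).congr fun t => (hφw t).symm
  refine ⟨ε, hε, fun t => Ψ (w t), hΨ.comp hwc, fun t ht => ?_,
    fun t x hx => hsupp _ _ fun h => hx (hφU h)⟩
  have hφt : φ (w t) = τ t := by rw [hφw, clip_of_mem ht]
  refine ⟨hφt ▸ hφU (mem_range_self _), ?_⟩
  rw [← hφ0, hpush _ (mem_ball_zero_iff.1 (hw t)).le, hφt]

variable {ι : Type*} [Finite ι] {σ : ι → ℝ → X}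

lemma exists_follow_near (V : Type*) [NormedAddCommGroup V] [NormedSpace ℝ V]
    [FiniteDimensional ℝ V] [ChartedSpace V X] (hσ : ∀ j, Continuous (σ j)) (t₀ : ℝ)
    (hinj : Function.Injective fun j => σ j t₀) :
    ∃ ε > 0, ∃ Φ : ℝ → Equiv.Perm X, JointlyContinuous Φ ∧
      ∀ t ∈ Icc (t₀ - ε) (t₀ + ε), ∀ j, Φ t (σ j t₀) = σ j t := by
  classical
  have := Fintype.ofFinite ι
  obtain ⟨U, hU, hdisj⟩ := (finite_range fun j => σ j t₀).t2_separation
  have hnot : ∀ {i j}, i ≠ j → ∀ {x}, x ∈ U (σ i t₀) → x ∉ U (σ j t₀) := fun hij _ hi hj =>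
    (hdisj (mem_range_self _) (mem_range_self _) (hinj.ne hij)).le_bot ⟨hi, hj⟩
  suffices H : ∀ s : Finset ι, ∃ ε > 0, ∃ Φ : ℝ → Equiv.Perm X, JointlyContinuous Φ ∧
      (∀ t ∈ Icc (t₀ - ε) (t₀ + ε), ∀ j ∈ s, σ j t ∈ U (σ j t₀) ∧ Φ t (σ j t₀) = σ j t) ∧
      ∀ t, ∀ x, (∀ j ∈ s, x ∉ U (σ j t₀)) → Φ t x = x by
    obtain ⟨ε, hε, Φ, hΦ, h, -⟩ := H Finset.univ
    exact ⟨ε, hε, Φ, hΦ, fun t ht j => (h t ht j (Finset.mem_univ j)).2⟩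
  intro s
  induction s using Finset.induction_on with
  | empty => exact ⟨1, one_pos, _, JointlyContinuous.one, by simp, by simp⟩
  | insert j s hj ih =>
    obtain ⟨ε, hε, Φ, hΦ, hmove, hfix⟩ := ih
    obtain ⟨δ, hδ, Ψ, hΨ, hmove', hfix'⟩ := exists_follow_point V (hσ j) t₀
      ((hU (σ j t₀)).2.mem_nhds (hU (σ j t₀)).1)
    refine ⟨min ε δ, lt_min hε hδ, _, hΨ.mul hΦ, fun t ht i hi => ?_, fun t x hx => ?_⟩
    · have htε : t ∈ Icc (t₀ - ε) (t₀ + ε) :=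
        Icc_subset_Icc (by linarith [min_le_left ε δ]) (by linarith [min_le_left ε δ]) ht
      have htδ : t ∈ Icc (t₀ - δ) (t₀ + δ) :=
        Icc_subset_Icc (by linarith [min_le_right ε δ]) (by linarith [min_le_right ε δ]) ht
      rcases Finset.mem_insert.1 hi with rfl | hi
      · refine ⟨(hmove' t htδ).1, ?_⟩
        rw [Equiv.Perm.mul_apply, hfix t _ fun k hk => hnot (ne_of_mem_of_not_mem hk hj).symm
          (hU _).1, (hmove' t htδ).2]
      · refine ⟨(hmove t htε i hi).1, ?_⟩
        rw [Equiv.Perm.mul_apply, (hmove t htε i hi).2,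
          hfix' t _ (hnot (ne_of_mem_of_not_mem hi hj) (hmove t htε i hi).1)]
    · rw [Equiv.Perm.mul_apply, hfix t x fun k hk => hx k (Finset.mem_insert_of_mem hk),
        hfix' t x (hx j (Finset.mem_insert_self _ _))]

variable [CompactSpace X]

lemma exists_follow_Icc (V : Type*) [NormedAddCommGroup V] [NormedSpace ℝ V]
    [FiniteDimensional ℝ V] [ChartedSpace V X]
    (hσ : ∀ j, Continuous (σ j))
    (hinj : ∀ t, Function.Injective fun j => σ j t) {a b : ℝ} (hab : a ≤ b) :
    ∃ Φ : ℝ → Equiv.Perm X, JointlyContinuous Φ ∧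
      ∀ t ∈ Icc a b, ∀ j, Φ t (σ j a) = σ j t := by
  choose ε hε Φ hΦ hfollow using fun t₀ => exists_follow_near V hσ t₀ (hinj t₀)
  obtain ⟨τ, hτ0, hτmono, ⟨m, hτm⟩, hτ⟩ := exists_monotone_Icc_subset_open_cover_Icc hab
    (c := fun t₀ : ℝ => Subtype.val ⁻¹' ball t₀ (ε t₀))
    (fun t₀ => isOpen_ball.preimage continuous_subtype_val)
    (fun t _ => mem_iUnion.2 ⟨t, mem_ball_self (hε t)⟩)
  suffices H : ∀ n, ∃ Ψ : ℝ → Equiv.Perm X, JointlyContinuous Ψ ∧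
      ∀ t ∈ Icc a (τ n : ℝ), ∀ j, Ψ t (σ j a) = σ j t by
    simpa [hτm m le_rfl] using H m
  intro n
  induction n with
  | zero =>
    refine ⟨_, JointlyContinuous.one, fun t ht j => ?_⟩
    rw [hτ0, Icc_self, mem_singleton_iff] at ht
    simp [ht]
  | succ n ih =>
    obtain ⟨Ψ, hΨ, hΨf⟩ := ih
    obtain ⟨t₀, ht₀⟩ := hτ n
    set c : ℝ := (τ n).1 with hc
    set d : ℝ := (τ (n + 1)).1 with hd
    have hcd : c ≤ d := hτmono n.le_succ
    have hac : a ≤ c := (τ n).2.1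
    have hloc : ∀ t ∈ Icc c d, ∀ j, Φ t₀ t (σ j t₀) = σ j t := by
      intro t ht
      have hmem : (⟨t, hac.trans ht.1, ht.2.trans (τ (n + 1)).2.2⟩ : Icc a b) ∈
          Icc (τ n) (τ (n + 1)) := ht
      have hball := ball_subset_closedBall (ht₀ hmem)
      rw [Real.closedBall_eq_Icc] at hball
      exact hfollow t₀ t hball
    refine ⟨fun t => Φ t₀ (clip c d t) * (Φ t₀ c)⁻¹ * Ψ (clip a c t),
      (((hΦ t₀).comp (continuous_clip c d)).mul ((hΦ t₀).comp continuous_const).inv).mul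
        (hΨ.comp (continuous_clip a c)), fun t ht j => ?_⟩
    rw [Equiv.Perm.mul_apply, Equiv.Perm.mul_apply, hΨf _ (clip_mem hac t)]
    rcases le_total t c with htc | htc
    · have : clip c d t = c := by
        rw [clip, min_eq_right (htc.trans hcd), max_eq_left htc]
      rw [this, clip_of_mem ⟨ht.1, htc⟩]; simp
    · have : clip a c t = c := by
        rw [clip, min_eq_left htc, max_eq_right hac]
      rw [this, clip_of_mem ⟨htc, ht.2⟩, Equiv.Perm.inv_eq_iff_eq.2 (hloc c ⟨le_rfl, hcd⟩ j).symm,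
        hloc t ⟨htc, ht.2⟩]

/-- Finitely many pairwise distinct moving points of a compact manifold can be followed for
all times by a continuous family of bijections. -/
theorem exists_follow (V : Type*) [NormedAddCommGroup V] [NormedSpace ℝ V]
    [FiniteDimensional ℝ V] [ChartedSpace V X]
    (hσ : ∀ j, Continuous (σ j))
    (hinj : ∀ t, Function.Injective fun j => σ j t) :
    ∃ Φ : ℝ → Equiv.Perm X, JointlyContinuous Φ ∧ ∀ t j, Φ t (σ j 0) = σ j t := by
  have hneg : ∀ k : ℕ, (-k : ℝ) ≤ k := fun k => by linarith [k.cast_nonneg (α := ℝ)]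
  choose C hC hCf using fun k : ℕ => exists_follow_Icc V hσ hinj (hneg k)
  let π : ℕ → ℝ → ℝ := fun k => clip (-k) k
  have hπc : ∀ k, Continuous (π k) := fun k => continuous_clip _ _
  have hπmem : ∀ (k : ℕ) t, π k t ∈ Icc (-k : ℝ) k := fun k => clip_mem (hneg k)
  have hπ : ∀ {k : ℕ} {t : ℝ}, |t| ≤ k → π k t = t := fun h => clip_of_mem (abs_le.1 h)
  let D : ℕ → ℝ → Equiv.Perm X := fun k => Nat.rec (fun _ => 1)
    (fun k D t => C (k + 1) (π (k + 1) t) * (C (k + 1) (π k t))⁻¹ * D t) k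
  have hDsucc : ∀ k t, D (k + 1) t =
      C (k + 1) (π (k + 1) t) * (C (k + 1) (π k t))⁻¹ * D k t := fun _ _ => rfl
  have hD : ∀ k, JointlyContinuous (D k) := by
    intro k
    induction k with
    | zero => exact JointlyContinuous.one
    | succ k ih => exact (((hC _).comp (hπc _)).mul ((hC _).comp (hπc _)).inv).mul ih
  have hDf : ∀ k t j, D k t (σ j 0) = σ j (π k t) := by
    intro k t j
    induction k with
    | zero =>
      have : π 0 t = 0 := by simpa using hπmem 0 t
      rw [this]; rfl
    | succ k ih =>
      have hmem : π k t ∈ Icc (-(k + 1 : ℕ) : ℝ) (k + 1 : ℕ) :=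
        Icc_subset_Icc (by push_cast; linarith) (by push_cast; linarith) (hπmem k t)
      rw [hDsucc, Equiv.Perm.mul_apply, Equiv.Perm.mul_apply, ih,
        Equiv.Perm.inv_eq_iff_eq.2 (hCf _ _ hmem j).symm, hCf _ _ (hπmem _ _)]
  have hstable : ∀ {k m : ℕ} {t : ℝ}, |t| ≤ k → k ≤ m → D m t = D k t := by
    intro k m t ht hkm
    induction m, hkm using Nat.le_induction with
    | base => rfl
    | succ m hkm ih =>
      have htm : |t| ≤ m := ht.trans (by exact_mod_cast hkm)
      rw [hDsucc, hπ htm, hπ (htm.trans (by push_cast; linarith)), mul_inv_cancel, one_mul, ih]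
  refine ⟨fun t => D ⌈|t|⌉₊ t, ?_, fun t j => ?_⟩
  · refine continuous_iff_continuousAt.2 fun ⟨t, x⟩ => ?_
    obtain ⟨N, hN⟩ := exists_nat_gt |t|
    refine (Continuous.continuousAt (hD N)).congr ?_
    have : ∀ᶠ p : ℝ × X in 𝓝 (t, x), |p.1| < N :=
      continuous_fst.abs.continuousAt.eventually (Iio_mem_nhds hN)
    filter_upwards [this] with p hp
    rw [hstable (Nat.le_ceil _) (Nat.ceil_le.2 hp.le)]
  · rw [hDf, hπ (Nat.le_ceil _)]

end Strands

lemma isOpenMap_of_continuous_injective {g : ℝ → ℝ} (hg : Continuous g)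
    (hinj : Function.Injective g) : IsOpenMap g := by
  have key : ∀ f : ℝ → ℝ, Continuous f → StrictMono f → IsOpenMap f := by
    intro f hf hmono
    have hord : (range f).OrdConnected := (isPreconnected_range hf).ordConnected
    refine IsOpenEmbedding.isOpenMap ⟨hmono.isEmbedding_of_ordConnected hord, ?_⟩
    rw [isOpen_iff_mem_nhds]
    rintro _ ⟨x, rfl⟩
    refine Filter.mem_of_superset
      (Icc_mem_nhds (hmono (sub_one_lt x)) (hmono (lt_add_one x))) ?_
    exact hord.out (mem_range_self _) (mem_range_self _)
  rcases hg.strictMono_of_inj hinj with h | h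
  · exact key g hg h
  · have := (Homeomorph.neg ℝ).isOpenMap.comp (key (fun x => -g x) hg.neg h.neg)
    simpa [Function.comp_def] using this

section Curves

variable {M : Type*} [TopologicalSpace M] [ChartedSpace (EuclideanSpace ℝ (Fin 1)) M]

lemma exists_isOpenEmbedding_real (x : M) : ∃ f : ℝ → M, IsOpenEmbedding f ∧ f 0 = x := by
  obtain ⟨φ, hφ, hφ0, -⟩ :=
    exists_isOpenEmbedding_subset (V := EuclideanSpace ℝ (Fin 1)) x Filter.univ_mem
  let e : ℝ ≃L[ℝ] EuclideanSpace ℝ (Fin 1) := ContinuousLinearEquiv.ofFinrankEq (by simp)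
  exact ⟨φ ∘ e, hφ.comp e.toHomeomorph.isOpenEmbedding, by simp [hφ0]⟩

lemma isOpenMap_of_continuous_injective_curve {g : M → ℝ} (hg : Continuous g)
    (hinj : Function.Injective g) : IsOpenMap g := by
  refine IsOpenMap.of_nhds_le fun x => ?_
  obtain ⟨f, hf, rfl⟩ := exists_isOpenEmbedding_real x
  rw [← hf.map_nhds_eq, Filter.map_map]
  exact (isOpenMap_of_continuous_injective (hg.comp hf.continuous)
    (hinj.comp hf.injective)).nhds_le 0

end Curves

lemma continuous_unitize : Continuous unitize := by
  refine Continuous.subtype_mk ?_ _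
  exact (continuous_subtype_val.norm.inv₀ fun x => norm_ne_zero_iff.2 x.2).smul
    continuous_subtype_val

/-- Polar coordinates on `ℝ³ ∖ {O}`, with the radius on the natural logarithmic scale. -/
def polar : R3o ≃ₜ S2 × ℝ where
  toFun x := (unitize x, Real.log ‖x.1‖)
  invFun p := ⟨Real.exp p.2 • p.1.1, smul_ne_zero (Real.exp_ne_zero _)
    (ne_zero_of_mem_unit_sphere p.1)⟩
  left_inv x := by
    have hx : ‖x.1‖ ≠ 0 := norm_ne_zero_iff.2 x.2
    ext1
    simp [unitize, Real.exp_log (norm_pos_iff.2 x.2), smul_smul, hx]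
  right_inv p := by
    have hp : ‖p.1.1‖ = 1 := mem_sphere_zero_iff_norm.1 p.1.2
    refine Prod.ext (Subtype.ext ?_) ?_
    · simp [unitize, norm_smul, hp, smul_smul]
    · simp [norm_smul, hp]
  continuous_toFun := continuous_unitize.prodMk
    (continuous_subtype_val.norm.log fun x => norm_ne_zero_iff.2 x.2)
  continuous_invFun := by
    refine Continuous.subtype_mk ?_ _
    fun_prop

lemma polar_fst (x : R3o) : (polar x).1 = unitize x := rfl

lemma polar_snd (x : R3o) : (polar x).2 = Real.log ‖x.1‖ := rfl

lemma unitize_polar_symm (p : S2 × ℝ) : unitize (polar.symm p) = p.1 := by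
  rw [← polar_fst, polar.apply_symm_apply]

lemma norm_polar_symm (p : S2 × ℝ) : ‖(polar.symm p).1‖ = Real.exp p.2 := by
  have hp : ‖p.1.1‖ = 1 := mem_sphere_zero_iff_norm.1 p.1.2
  change ‖Real.exp p.2 • p.1.1‖ = _
  simp [norm_smul, hp]

lemma norm_smul_unitize (x : R3o) : ‖x.1‖ • (unitize x).1 = x.1 := by
  simp [unitize, smul_smul, norm_ne_zero_iff.2 x.2]

lemma coe_mem_ray_iff (u : S2) (x : R3o) : x.1 ∈ ray u.1 ↔ unitize x = u := by
  have hu : ‖u.1‖ = 1 := mem_sphere_zero_iff_norm.1 u.2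
  constructor
  · rintro ⟨t, ht, hx⟩
    ext1
    simp [unitize, hx, norm_smul, abs_of_pos ht, hu, smul_smul, ht.ne']
  · rintro rfl
    exact ⟨‖x.1‖, norm_pos_iff.2 x.2, (norm_smul_unitize x).symm⟩

lemma ne_zero_of_mem_ray {s x : R3} (hs : ‖s‖ = 1) (hx : x ∈ ray s) : x ≠ 0 := by
  obtain ⟨t, ht, rfl⟩ := hx
  exact smul_ne_zero ht.ne' (norm_ne_zero_iff.1 (by rw [hs]; exact one_ne_zero))

/-- The trace on `ℝ³ ∖ {O}` of the neighbourhoods of the origin. -/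
def nearOrigin : Filter R3o := Filter.comap (fun x => ‖x.1‖) (𝓝 0)

/-- The filter of neighbourhoods of infinity on `ℝ³ ∖ {O}`. -/
def nearInfinity : Filter R3o := Filter.comap (fun x => ‖x.1‖) Filter.atTop

lemma eventually_norm_lt_nearOrigin {ε : ℝ} (hε : 0 < ε) :
    ∀ᶠ x : R3o in nearOrigin, ‖x.1‖ < ε :=
  Filter.preimage_mem_comap (Iio_mem_nhds hε)

instance : nearOrigin.NeBot := by
  refine Filter.comap_neBot fun s hs => ?_
  obtain ⟨ε, hε, hball⟩ := Metric.mem_nhds_iff.1 hs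
  obtain ⟨u, hu⟩ : (sphere (0 : R3) 1).Nonempty := NormedSpace.sphere_nonempty.2 zero_le_one
  refine ⟨polar.symm (⟨u, hu⟩, Real.log (ε / 2)), hball ?_⟩
  rw [norm_polar_symm, Real.exp_log (half_pos hε)]
  simp [abs_of_pos hε, hε]

lemma disjoint_nearOrigin_nearInfinity : Disjoint nearOrigin nearInfinity :=
  Filter.disjoint_comap (disjoint_nhds_atTop 0)

lemma not_tendsto_of_nearOrigin {f : R3o → R3o} (hf : Filter.Tendsto f nearOrigin nearOrigin) :
    ¬ Filter.Tendsto f nearOrigin nearInfinity := fun h =>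
  hf.not_tendsto disjoint_nearOrigin_nearInfinity h

lemma isPreconnected_norm_lt (δ : ℝ) : IsPreconnected {x : R3o | ‖x.1‖ < δ} := by
  rcases le_or_gt δ 0 with hδ | hδ
  · have : {x : R3o | ‖x.1‖ < δ} = ∅ :=
      eq_empty_of_forall_notMem fun x hx => (hx.trans_le hδ).not_ge (norm_nonneg _)
    exact this ▸ isPreconnected_empty
  have hsphere : IsPreconnected (univ : Set S2) := by
    have hrank : 1 < Module.rank ℝ R3 := by
      rw [← Module.finrank_eq_rank]
      simp
    have := (isConnected_sphere hrank 0 zero_le_one).isPreconnected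
    exact Subtype.preconnectedSpace this |>.isPreconnected_univ
  have : {x : R3o | ‖x.1‖ < δ} = polar ⁻¹' (univ ×ˢ Iio (Real.log δ)) := by
    ext x
    simp [polar_snd, Real.log_lt_log_iff (norm_pos_iff.2 x.2) hδ]
  rw [this, ← Homeomorph.image_symm]
  exact (hsphere.prod isPreconnected_Iio).image _ polar.symm.continuous.continuousOn

lemma isCompact_annulus {a : ℝ} (ha : 0 < a) (b : ℝ) :
    IsCompact {x : R3o | a ≤ ‖x.1‖ ∧ ‖x.1‖ ≤ b} := by
  rcases lt_or_ge b a with hab | hab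
  · have : {x : R3o | a ≤ ‖x.1‖ ∧ ‖x.1‖ ≤ b} = ∅ :=
      eq_empty_of_forall_notMem fun x hx => (hx.1.trans hx.2).not_gt hab
    exact this ▸ isCompact_empty
  have : {x : R3o | a ≤ ‖x.1‖ ∧ ‖x.1‖ ≤ b} =
      polar ⁻¹' (univ ×ˢ Icc (Real.log a) (Real.log b)) := by
    ext x
    simp [polar_snd, Real.log_le_log_iff ha (norm_pos_iff.2 x.2),
      Real.log_le_log_iff (norm_pos_iff.2 x.2) (ha.trans_le hab)]
  rw [this, ← Homeomorph.image_symm]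
  exact (isCompact_univ.prod isCompact_Icc).image polar.symm.continuous

lemma eventually_lt_or_eventually_gt (K : R3o ≃ₜ R3o) {a : ℝ} (ha : 0 < a) {b : ℝ}
    (hab : a ≤ b) :
    (∀ᶠ x in nearOrigin, ‖(K x).1‖ < a) ∨ ∀ᶠ x in nearOrigin, b < ‖(K x).1‖ := by
  have hcomp : IsCompact (K ⁻¹' {x : R3o | a ≤ ‖x.1‖ ∧ ‖x.1‖ ≤ b}) :=
    K.isCompact_preimage.2 (isCompact_annulus ha b)
  obtain ⟨δ, hδ, hlt⟩ : ∃ δ > 0, ∀ x : R3o, ‖x.1‖ < δ → ‖(K x).1‖ < a ∨ b < ‖(K x).1‖ := by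
    rcases (K ⁻¹' {x : R3o | a ≤ ‖x.1‖ ∧ ‖x.1‖ ≤ b}).eq_empty_or_nonempty with h | h
    · refine ⟨1, one_pos, fun x _ => ?_⟩
      by_contra! hx
      exact (h ▸ hx : x ∈ (∅ : Set R3o))
    · obtain ⟨y, -, hy⟩ := hcomp.exists_isMinOn h continuous_subtype_val.norm.continuousOn
      refine ⟨‖y.1‖, norm_pos_iff.2 y.2, fun x hx => ?_⟩
      by_contra! hx'
      exact (hy hx').not_gt hx
  have hpre : IsPreconnected ((fun x => ‖(K x).1‖) '' {x : R3o | ‖x.1‖ < δ}) :=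
    (isPreconnected_norm_lt δ).image _ (K.continuous.subtype_val.norm).continuousOn
  have hsub : (fun x => ‖(K x).1‖) '' {x : R3o | ‖x.1‖ < δ} ⊆ Iio a ∪ Ioi b := by
    rintro _ ⟨x, hx, rfl⟩
    exact hlt x hx
  have hdisj : Disjoint (Iio a) (Ioi b) :=
    Set.disjoint_left.2 fun x hx hx' => ((mem_Iio.1 hx).trans_le hab).not_gt hx'
  refine (hpre.subset_or_subset isOpen_Iio isOpen_Ioi hdisj hsub).imp ?_ ?_ <;>
  · intro h
    filter_upwards [eventually_norm_lt_nearOrigin hδ] with x hx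
    exact h (mem_image_of_mem _ hx)

/-- A homeomorphism of `ℝ³ ∖ {O}` sends the end at the origin to one of the two ends. -/
lemma tendsto_nearOrigin_or_nearInfinity (K : R3o ≃ₜ R3o) :
    Filter.Tendsto K nearOrigin nearOrigin ∨ Filter.Tendsto K nearOrigin nearInfinity := by
  by_cases h : ∀ a : ℝ, 0 < a → ∀ᶠ x in nearOrigin, ‖(K x).1‖ < a
  · left
    refine Filter.tendsto_comap_iff.2 (tendsto_order.2 ⟨fun a ha => ?_, h⟩)
    exact Filter.Eventually.of_forall fun x => ha.trans_le (norm_nonneg _)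
  · right
    simp only [not_forall] at h
    obtain ⟨a, ha, hnot⟩ := h
    refine Filter.tendsto_comap_iff.2 (Filter.tendsto_atTop.2 fun b => ?_)
    have := (eventually_lt_or_eventually_gt K ha (le_max_left a b)).resolve_left hnot
    filter_upwards [this] with x hx
    exact (le_max_right a b).trans hx.le

/-- Inversion in the unit sphere. -/
def inversionO : R3o ≃ₜ R3o :=
  (polar.trans ((Homeomorph.refl S2).prodCongr (Homeomorph.neg ℝ))).trans polar.symm

lemma inversionO_apply (x : R3o) :
    inversionO x = polar.symm (unitize x, -Real.log ‖x.1‖) := rfl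

lemma unitize_inversionO (x : R3o) : unitize (inversionO x) = unitize x := by
  rw [inversionO_apply, unitize_polar_symm]

lemma norm_inversionO (x : R3o) : ‖(inversionO x).1‖ = ‖x.1‖⁻¹ := by
  rw [inversionO_apply, norm_polar_symm, Real.exp_neg, Real.exp_log (norm_pos_iff.2 x.2)]

lemma inversionO_inversionO (x : R3o) : inversionO (inversionO x) = x :=
  polar.injective (Prod.ext (by simp [polar_fst, unitize_inversionO])
    (by simp [polar_snd, norm_inversionO]))

lemma tendsto_inversionO : Filter.Tendsto inversionO nearInfinity nearOrigin := by
  refine Filter.tendsto_comap_iff.2 ?_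
  simp only [Function.comp_def, norm_inversionO]
  exact tendsto_inv_atTop_zero.comp Filter.tendsto_comap

/-- The extension of a self-map of `ℝ³ ∖ {O}` to `ℝ³` which fixes the origin. -/
def extendZero (f : R3o → R3o) : R3 → R3 :=
  open Classical in fun x => if h : x = 0 then 0 else f ⟨x, h⟩

lemma extendZero_zero (f : R3o → R3o) : extendZero f 0 = 0 := by simp [extendZero]

lemma extendZero_coe (f : R3o → R3o) (x : R3o) : extendZero f x = f x := by
  simp [extendZero, x.2]

lemma continuous_extendZero {f : R3o → R3o} (hf : Continuous f)
    (h0 : Filter.Tendsto f nearOrigin nearOrigin) : Continuous (extendZero f) := by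
  refine continuous_iff_continuousAt.2 fun x => ?_
  rcases eq_or_ne x 0 with rfl | hx
  · rw [Metric.continuousAt_iff]
    intro ε hε
    have hev := h0.eventually (eventually_norm_lt_nearOrigin hε)
    obtain ⟨s, hs, hsub⟩ := Filter.mem_comap.1 hev
    obtain ⟨δ, hδ, hball⟩ := Metric.mem_nhds_iff.1 hs
    refine ⟨δ, hδ, fun {y} hy => ?_⟩
    rw [extendZero_zero, dist_zero_right]
    rcases eq_or_ne y 0 with rfl | hy0
    · simpa [extendZero_zero] using hε
    · rw [extendZero_coe f ⟨y, hy0⟩]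
      exact hsub (a := ⟨y, hy0⟩) (hball (by simpa using hy))
  · have hemb : IsOpenEmbedding (Subtype.val : R3o → R3) :=
      isOpen_ne.isOpenEmbedding_subtypeVal
    refine (hemb.continuousAt_iff (x := ⟨x, hx⟩)).1 (Continuous.continuousAt ?_)
    exact hf.subtype_val.congr fun y => (extendZero_coe f y).symm

lemma extendZero_leftInverse {f g : R3o → R3o} (h : Function.LeftInverse f g) :
    Function.LeftInverse (extendZero f) (extendZero g) := by
  intro x
  rcases eq_or_ne x 0 with rfl | hx
  · rw [extendZero_zero, extendZero_zero]
  · rw [extendZero_coe g ⟨x, hx⟩, extendZero_coe, h]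

lemma exists_extension_of_tendsto (K : R3o ≃ₜ R3o)
    (hK : Filter.Tendsto K nearOrigin nearOrigin) :
    ∃ H : R3 ≃ₜ R3, H 0 = 0 ∧ ∀ x : R3o, H x = K x := by
  have hK' : Filter.Tendsto K.symm nearOrigin nearOrigin := by
    refine (tendsto_nearOrigin_or_nearInfinity K.symm).resolve_right fun h => ?_
    have hcomp := h.comp hK
    rw [K.symm_comp_self] at hcomp
    exact not_tendsto_of_nearOrigin Filter.tendsto_id hcomp
  exact ⟨{ toFun := extendZero K
           invFun := extendZero K.symm
           left_inv := extendZero_leftInverse K.symm_apply_apply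
           right_inv := extendZero_leftInverse K.apply_symm_apply
           continuous_toFun := continuous_extendZero K.continuous hK
           continuous_invFun := continuous_extendZero K.symm.continuous hK' },
    extendZero_zero K, extendZero_coe K⟩

/-- Up to an inversion, a homeomorphism of `ℝ³ ∖ {O}` extends to `ℝ³`. -/
lemma exists_extension (K : R3o ≃ₜ R3o) :
    ∃ H : R3 ≃ₜ R3, H 0 = 0 ∧
      ((∀ x : R3o, H x = K x) ∨ ∀ x : R3o, H x = K (inversionO x)) := by
  rcases tendsto_nearOrigin_or_nearInfinity K with h | h
  · obtain ⟨H, h0, hH⟩ := exists_extension_of_tendsto K h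
    exact ⟨H, h0, Or.inl hH⟩
  rcases tendsto_nearOrigin_or_nearInfinity (inversionO.trans K) with h' | h'
  · obtain ⟨H, h0, hH⟩ := exists_extension_of_tendsto _ h'
    exact ⟨H, h0, Or.inr hH⟩
  exfalso
  have hinf : Filter.Tendsto K nearInfinity nearInfinity :=
    (h'.comp tendsto_inversionO).congr fun x => by
      simp [inversionO_inversionO]
  have hid : Filter.Tendsto (K ∘ K.symm) nearOrigin nearInfinity :=
    (tendsto_nearOrigin_or_nearInfinity K.symm).elim h.comp hinf.comp
  rw [K.self_comp_symm] at hid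
  exact not_tendsto_of_nearOrigin Filter.tendsto_id hid

/-- The homeomorphism of `ℝ³ ∖ {O}` which acts on the sphere of radius `exp s` by `Φ s`. -/
def sphereShear (Φ : ℝ → Equiv.Perm S2) (hΦ : JointlyContinuous Φ) : R3o ≃ₜ R3o :=
  (polar.trans
    { toFun := fun p => (Φ p.2 p.1, p.2)
      invFun := fun p => ((Φ p.2)⁻¹ p.1, p.2)
      left_inv := fun p => by simp
      right_inv := fun p => by simp
      continuous_toFun := (Continuous.comp hΦ continuous_swap).prodMk continuous_snd
      continuous_invFun :=
        (Continuous.comp hΦ.inv continuous_swap).prodMk continuous_snd }).trans polar.symm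

lemma sphereShear_apply (Φ : ℝ → Equiv.Perm S2) (hΦ : JointlyContinuous Φ) (x : R3o) :
    sphereShear Φ hΦ x = polar.symm (Φ (Real.log ‖x.1‖) (unitize x), Real.log ‖x.1‖) := rfl

section Foliation

variable {G : R3o ≃ₜ R3o}

/-- An arc meeting every leaf `G(ℙ_t)` once is the `G`-image of a graph over the
logarithmic radius. -/
lemma exists_section {L : Set R3} (hL : IsInfiniteArc L)
    (hG : ∀ t : ℝ, 0 < t → IsSingletonSet ((Subtype.val '' (⇑G '' {x : R3o | ‖x.1‖ = t})) ∩ L)) :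
    ∃ σ : ℝ → S2, Continuous σ ∧ ∀ p : S2 × ℝ, (G (polar.symm p)).1 ∈ L ↔ p.1 = σ p.2 := by
  obtain ⟨h0, ⟨hchart⟩, -⟩ := hL
  have huniq : ∀ t : ℝ, ∃! x : R3o, ‖x.1‖ = Real.exp t ∧ (G x).1 ∈ L := by
    intro t
    obtain ⟨a, ha⟩ := hG (Real.exp t) (Real.exp_pos t)
    obtain ⟨⟨_, ⟨x, hx, rfl⟩, rfl⟩, haL⟩ : a ∈ _ := ha.symm ▸ mem_singleton a
    refine ⟨x, ⟨hx, haL⟩, fun y hy => G.injective (Subtype.ext ?_)⟩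
    have : (G y).1 ∈ ({(G x).1} : Set R3) := ha ▸ ⟨⟨G y, ⟨y, hy.1, rfl⟩, rfl⟩, hy.2⟩
    exact this
  choose c hc hcuniq using huniq
  have hne : ∀ y : L, y.1 ≠ 0 := fun y hy => h0 (hy ▸ y.2)
  let q : L → S2 × ℝ := fun y => polar (G.symm ⟨y.1, hne y⟩)
  have hq : Continuous q :=
    polar.continuous.comp (G.symm.continuous.comp (continuous_subtype_val.subtype_mk _))
  have hqc : ∀ y : L, G.symm ⟨y.1, hne y⟩ = c (q y).2 := fun y =>
    hcuniq _ _ ⟨by rw [polar_snd, Real.exp_log (norm_pos_iff.2 (G.symm _).2)], by simp⟩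
  let r : ℝ → L := fun t => ⟨(G (c t)).1, (hc t).2⟩
  have hrl : ∀ y, r (q y).2 = y := fun y => by
    ext1
    simp only [r, ← hqc, Homeomorph.apply_symm_apply]
  have hrr : ∀ t, (q (r t)).2 = t := fun t => by
    simp [q, r, polar_snd, (hc t).1]
  let e : L ≃ ℝ := ⟨fun y => (q y).2, r, hrl, hrr⟩
  have hopen : IsOpenMap e :=
    isOpenMap_of_continuous_injective_curve (continuous_snd.comp hq) e.injective
  have hr : Continuous r :=
    (e.toHomeomorphOfContinuousOpen (continuous_snd.comp hq) hopen).symm.continuous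
  refine ⟨fun t => (q (r t)).1, continuous_fst.comp (hq.comp hr), fun p => ?_⟩
  have hqr : ∀ t, (q (r t)).1 = unitize (c t) := fun t => by
    simp [q, r, polar_fst]
  simp only [hqr]
  constructor
  · intro hp
    rw [← hcuniq p.2 (polar.symm p) ⟨norm_polar_symm p, hp⟩, unitize_polar_symm]
  · intro hp
    have : polar.symm p = c p.2 := by
      rw [Homeomorph.symm_apply_eq]
      exact Prod.ext hp (by simp [polar_snd, (hc p.2).1])
    rw [this]
    exact (hc p.2).2

lemma isTameFrame_of_foliation {ν : ℕ} {L : Fin ν → Set R3} (hL : IsArcFrame L)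
    (hG : ∀ t : ℝ, 0 < t → ∀ j : Fin ν,
      IsSingletonSet ((Subtype.val '' (⇑G '' {x : R3o | ‖x.1‖ = t})) ∩ L j)) :
    IsTameFrame ν ((⋃ j, L j) ∪ {0}) := by
  choose σ hσ hσL using fun j => exists_section (hL.1 j) fun t ht => hG t ht j
  have hinj : ∀ t, Function.Injective fun j => σ j t := by
    intro t i j hij
    by_contra hne
    refine (hL.2.1 hne).le_bot ⟨(hσL i (σ i t, t)).2 rfl, (hσL j (σ i t, t)).2 hij⟩
  obtain ⟨Φ, hΦ, hfollow⟩ := exists_follow (EuclideanSpace ℝ (Fin 2)) hσ hinj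
  let K : R3o ≃ₜ R3o := (sphereShear Φ hΦ).trans G
  have hK : ∀ x j, (K x).1 ∈ L j ↔ unitize x = σ j 0 := by
    intro x j
    change (G (sphereShear Φ hΦ x)).1 ∈ L j ↔ _
    rw [sphereShear_apply, hσL, ← hfollow, (Φ _).injective.eq_iff]
  obtain ⟨H, hH0, hHK⟩ := exists_extension K
  have hH : ∀ (x : R3o) j, H x ∈ L j ↔ x.1 ∈ ray (σ j 0).1 := by
    intro x j
    rcases hHK with h | h
    · rw [h, hK, coe_mem_ray_iff]
    · rw [h, hK, unitize_inversionO, coe_mem_ray_iff]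
  refine ⟨fun j => (σ j 0).1, H, fun j => mem_sphere_zero_iff_norm.1 (σ j 0).2,
    Subtype.val_injective.comp (hinj 0), ?_⟩
  refine (H.toEquiv.preimage_eq_iff_eq_image _ _).1 ?_
  change H ⁻¹' _ = _
  ext x
  rcases eq_or_ne x 0 with rfl | hx
  · simp [hH0]
  · have hHx : H x ≠ 0 := fun h => hx (H.injective (h.trans hH0.symm))
    simp [hx, hHx, fun j => hH ⟨x, hx⟩ j]

end Foliation

lemma mem_ray_iff {s : R3} (hs : ‖s‖ = 1) {x : R3} : x ∈ ray s ↔ x ≠ 0 ∧ x = ‖x‖ • s := by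
  constructor
  · intro hx
    refine ⟨ne_zero_of_mem_ray hs hx, ?_⟩
    obtain ⟨t, ht, rfl⟩ := hx
    rw [norm_smul, hs, mul_one, Real.norm_eq_abs, abs_of_pos ht]
  · rintro ⟨h0, hx⟩
    exact ⟨‖x‖, norm_pos_iff.2 h0, hx⟩

lemma exp_smul_mem_ray (s : R3) (t : ℝ) : Real.exp t • s ∈ ray s := ⟨_, Real.exp_pos t, rfl⟩

/-- A standard frame, as a subset of `ℝ³`. -/
def standardFrame {ν : ℕ} (s : Fin ν → R3) : Set R3 := (⋃ j, ray (s j)) ∪ {0}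

section StandardFrame

variable {ν : ℕ} {s : Fin ν → R3}

lemma mem_iUnion_ray_of_ne_zero {x : R3} (hx : x ∈ standardFrame s) (h0 : x ≠ 0) :
    x ∈ ⋃ j, ray (s j) :=
  hx.resolve_right h0

lemma eq_of_mem_ray (hs : ∀ j, ‖s j‖ = 1) (hinj : Function.Injective s) {x : R3} {i j : Fin ν}
    (hi : x ∈ ray (s i)) (hj : x ∈ ray (s j)) : i = j := by
  rw [mem_ray_iff (hs _)] at hi hj
  exact hinj (smul_right_injective R3 (norm_ne_zero_iff.2 hi.1) (hi.2.symm.trans hj.2))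

/-- A connected curve in a finite union of open rays stays on one of them. -/
lemma exists_forall_mem_ray (hs : ∀ j, ‖s j‖ = 1) {I : Set ℝ} (hI : IsPreconnected I)
    (hne : I.Nonempty) {y : ℝ → R3} (hy : ContinuousOn y I)
    (hmem : ∀ u ∈ I, y u ∈ ⋃ j, ray (s j)) : ∃ j, ∀ u ∈ I, y u ∈ ray (s j) := by
  obtain ⟨u₀, hu₀⟩ := hne
  obtain ⟨j, hj⟩ := mem_iUnion.1 (hmem u₀ hu₀)
  have hdir : ∀ u k, y u ∈ ray (s k) → y u ≠ 0 ∧ ‖y u‖⁻¹ • y u = s k := by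
    intro u k hk
    obtain ⟨h0, h⟩ := (mem_ray_iff (hs k)).1 hk
    exact ⟨h0, by rw [inv_smul_eq_iff₀ (norm_ne_zero_iff.2 h0)]; exact h⟩
  have hne0 : ∀ u ∈ I, y u ≠ 0 := fun u hu =>
    let ⟨k, hk⟩ := mem_iUnion.1 (hmem u hu)
    (hdir u k hk).1
  have hcont : ContinuousOn (fun u => ‖y u‖⁻¹ • y u) I :=
    (hy.norm.inv₀ fun u hu => norm_ne_zero_iff.2 (hne0 u hu)).smul hy
  have hsub : (fun u => ‖y u‖⁻¹ • y u) '' I ⊆ range s := by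
    rintro _ ⟨u, hu, rfl⟩
    obtain ⟨k, hk⟩ := mem_iUnion.1 (hmem u hu)
    exact ⟨k, (hdir u k hk).2.symm⟩
  have hsing := (finite_range s).countable.isTotallyDisconnected _ hsub (hI.image _ hcont)
  refine ⟨j, fun u hu => (mem_ray_iff (hs j)).2 ⟨hne0 u hu, ?_⟩⟩
  have := hsing (mem_image_of_mem _ hu) (mem_image_of_mem _ hu₀)
  rw [← (hdir u₀ j hj).2]
  exact (inv_smul_eq_iff₀ (norm_ne_zero_iff.2 (hne0 u hu))).1 this

/-- If the number of rays is not two, a homeomorphism of `ℝ³` preserving a standard frame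
fixes the origin. -/
lemma map_zero_of_preserves_standardFrame (hs : ∀ j, ‖s j‖ = 1) (hinj : Function.Injective s)
    (hν : ν ≠ 2) (B : R3 ≃ₜ R3) (hB : ∀ x, B x ∈ standardFrame s ↔ x ∈ standardFrame s) :
    B 0 = 0 := by
  by_contra hB0
  obtain ⟨i, hi⟩ := mem_iUnion.1
    (mem_iUnion_ray_of_ne_zero ((hB 0).2 (Or.inr rfl)) hB0)
  obtain ⟨r, hr, hBr⟩ := hi
  let y : ℝ → R3 := fun u => B.symm (u • s i)
  have hyc : Continuous y := B.symm.continuous.comp (continuous_id.smul continuous_const)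
  have hyr : y r = 0 := by simp only [y]; rw [← hBr, B.symm_apply_apply]
  have hsi : s i ≠ 0 := norm_ne_zero_iff.1 (by rw [hs]; exact one_ne_zero)
  have hyinj : Function.Injective y :=
    B.symm.injective.comp (smul_left_injective ℝ hsi)
  have hyF : ∀ u, 0 < u → y u ∈ standardFrame s := fun u hu =>
    (hB _).1 (by
      simp only [y, B.apply_symm_apply]
      exact Or.inl (mem_iUnion.2 ⟨i, u, hu, rfl⟩))
  have hyU : ∀ u, 0 < u → u ≠ r → y u ∈ ⋃ j, ray (s j) := fun u hu hur =>
    mem_iUnion_ray_of_ne_zero (hyF u hu) fun h => hur (hyinj (h.trans hyr.symm))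
  obtain ⟨a, ha⟩ := exists_forall_mem_ray hs isPreconnected_Ioi (nonempty_Ioi (a := r))
    hyc.continuousOn fun u hu => hyU u (hr.trans hu) (ne_of_gt hu)
  obtain ⟨b, hb⟩ := exists_forall_mem_ray hs isPreconnected_Ioo (nonempty_Ioo.2 hr)
    hyc.continuousOn fun u hu => hyU u hu.1 (ne_of_lt hu.2)
  by_cases hc : ∃ c, c ≠ a ∧ c ≠ b
  · obtain ⟨c, hca, hcb⟩ := hc
    let Z : Set R3 := {0} ∪ ⋃ k ∈ {k : Fin ν | k ≠ i}, {x | x = ‖x‖ • s k}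
    have hZ : IsClosed Z := by
      refine isClosed_singleton.union (Set.Finite.isClosed_biUnion (toFinite _) fun k _ => ?_)
      exact isClosed_eq continuous_id (continuous_norm.smul continuous_const)
    have hmaps : ∀ v ∈ Ioi (0 : ℝ), B (v • s c) ∈ Z := by
      intro v hv
      have hray : v • s c ∈ ray (s c) := ⟨v, hv, rfl⟩
      rcases (hB _).2 (Or.inl (mem_iUnion.2 ⟨c, hray⟩) : v • s c ∈ standardFrame s) with h | h
      · obtain ⟨k, hk⟩ := mem_iUnion.1 h
        refine Or.inr (mem_iUnion₂.2 ⟨k, ?_, ((mem_ray_iff (hs k)).1 hk).2⟩)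
        rintro rfl
        obtain ⟨u, hu, hBu⟩ := hk
        have hyu : y u = v • s c := by simp only [y]; rw [← hBu, B.symm_apply_apply]
        rcases lt_trichotomy u r with hur | rfl | hur
        · exact hcb (eq_of_mem_ray hs hinj (hyu ▸ hray) (hb u ⟨hu, hur⟩))
        · exact ne_zero_of_mem_ray (hs c) hray (hyu.symm.trans hyr)
        · exact hca (eq_of_mem_ray hs hinj (hyu ▸ hray) (ha u hur))
      · exact Or.inl h
    have hlim : B ((0 : ℝ) • s c) ∈ Z := by
      have hcont : Continuous fun v : ℝ => B (v • s c) :=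
        B.continuous.comp (continuous_id.smul continuous_const)
      refine closure_minimal (image_subset_iff.2 hmaps) hZ
        (image_closure_subset_closure_image hcont ⟨0, ?_, rfl⟩)
      rw [closure_Ioi]
      exact self_mem_Ici
    rw [zero_smul] at hlim
    rcases hlim with h | h
    · exact hB0 h
    · obtain ⟨k, hki, hk⟩ := mem_iUnion₂.1 h
      exact hki (eq_of_mem_ray hs hinj ((mem_ray_iff (hs k)).2 ⟨hB0, hk⟩) ⟨r, hr, hBr⟩)
  · push Not at hc
    have hν1 : ν = 1 := by
      have hcard : Fintype.card (Fin ν) ≤ 2 := by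
        have huniv : (Finset.univ : Finset (Fin ν)) ⊆ {a, b} := by
          intro c _
          by_cases h : c = a
          · simp [h]
          · simp [hc c h]
        exact (Finset.card_le_card huniv).trans Finset.card_le_two
      have := i.pos
      rw [Fintype.card_fin] at hcard
      omega
    subst hν1
    let g : ℝ → ℝ := fun w => ‖y (Real.exp w)‖
    have hyray : ∀ w, y (Real.exp w) = g w • s i := by
      intro w
      rcases hyF _ (Real.exp_pos w) with h | h
      · obtain ⟨k, hk⟩ := mem_iUnion.1 h
        rw [Subsingleton.elim i k]
        exact ((mem_ray_iff (hs k)).1 hk).2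
      · rw [mem_singleton_iff] at h
        simp [g, h]
    have hg : Continuous g := (hyc.comp Real.continuous_exp).norm
    have hginj : Function.Injective g := fun w w' h =>
      Real.exp_injective (hyinj (by rw [hyray, hyray, h]))
    have hg0 : g (Real.log r) = 0 := by simp [g, Real.exp_log hr, hyr]
    have hpos : ∀ w, 0 ≤ g w := fun w => norm_nonneg _
    rcases hg.strictMono_of_inj hginj with h | h
    · exact (h (sub_one_lt (Real.log r))).not_ge (hg0 ▸ hpos _)
    · exact (h (lt_add_one (Real.log r))).not_ge (hg0 ▸ hpos _)

end StandardFrame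

/-- A graph over a line can be translated along itself by a homeomorphism of the ambient
space. -/
lemma exists_homeomorph_translating_graph {E : Type*} [NormedAddCommGroup E]
    [InnerProductSpace ℝ E] {u : E} {c : ℝ → E} (hc : Continuous c) (hc0 : c 0 = 0)
    (hcu : ∀ t, inner ℝ u (c t) = t) (a : ℝ) :
    ∃ T : E ≃ₜ E, T 0 = c a ∧ ∀ x, T x ∈ range c ↔ x ∈ range c := by
  let τ : ℝ → E → E := fun a x => x - c (inner ℝ u x) + c (inner ℝ u x + a)
  have hτu : ∀ a x, inner ℝ u (τ a x) = inner ℝ u x + a := fun a x => by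
    simp [τ, inner_add_right, inner_sub_right, hcu]
  have hτ : ∀ a, Continuous (τ a) := fun a => by fun_prop
  have hinv : ∀ a x, τ (-a) (τ a x) = x := fun a x => by
    have : τ (-a) (τ a x) = τ a x - c (inner ℝ u (τ a x)) + c (inner ℝ u (τ a x) + -a) := rfl
    rw [this, hτu, add_neg_cancel_right]
    simp [τ]
  refine ⟨⟨⟨τ a, τ (-a), hinv a, fun x => by simpa using hinv (-a) x⟩, hτ a, hτ (-a)⟩,
    by simp [τ, hc0], fun x => ?_⟩
  change τ a x ∈ range c ↔ x ∈ range c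
  constructor
  · rintro ⟨b, hb⟩
    have hb' : b = inner ℝ u x + a := by rw [← hτu, ← hb, hcu]
    refine ⟨inner ℝ u x, ?_⟩
    have h : x - c (inner ℝ u x) + c (inner ℝ u x + a) = c (inner ℝ u x + a) := by
      have := hb.symm
      rw [hb'] at this
      exact this
    simpa [sub_eq_zero, eq_comm] using h
  · rintro ⟨b, rfl⟩
    exact ⟨b + a, by simp [τ, hcu]⟩

/-- The union of two rays can be slid along itself so that its vertex goes to any prescribed
point. -/
lemma exists_homeomorph_moving_vertex {s : Fin 2 → R3} (hs : ∀ j, ‖s j‖ = 1)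
    (hinj : Function.Injective s) {p : R3} (hp : p ∈ standardFrame s) :
    ∃ T : R3 ≃ₜ R3, T 0 = p ∧ ∀ x, T x ∈ standardFrame s ↔ x ∈ standardFrame s := by
  set α : ℝ := 1 - inner ℝ (s 0) (s 1) with hα
  have hαpos : 0 < α := by
    have h := (inner_lt_one_iff_real_of_norm_eq_one (hs 0) (hs 1)).2
      (hinj.ne (by decide : (0 : Fin 2) ≠ 1))
    linarith
  let c : ℝ → R3 := fun t => (max t 0 / α) • s 0 + (max (-t) 0 / α) • s 1
  have hc : Continuous c := by fun_prop
  have hc0 : c 0 = 0 := by simp [c]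
  have hcpos : ∀ t, 0 ≤ t → c t = (t / α) • s 0 := fun t ht => by
    simp [c, ht]
  have hcneg : ∀ t, t ≤ 0 → c t = (-t / α) • s 1 := fun t ht => by
    simp [c, ht]
  have hcu : ∀ t, inner ℝ (s 0 - s 1) (c t) = t := by
    intro t
    have h0 : inner ℝ (s 0 - s 1) (s 0) = α := by
      rw [inner_sub_left, real_inner_self_eq_norm_sq, hs, real_inner_comm (s 0) (s 1), hα]
      ring
    have h1 : inner ℝ (s 0 - s 1) (s 1) = -α := by
      rw [inner_sub_left, real_inner_self_eq_norm_sq, hs, hα]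
      ring
    rcases le_total 0 t with ht | ht
    · rw [hcpos t ht, real_inner_smul_right, h0, div_mul_cancel₀ _ hαpos.ne']
    · rw [hcneg t ht, real_inner_smul_right, h1]
      field_simp
  have hrange : standardFrame s = range c := by
    ext x
    constructor
    · rintro (h | h)
      · obtain ⟨j, t, ht, rfl⟩ := mem_iUnion.1 h
        have hαt : 0 ≤ α * t := (mul_pos hαpos ht).le
        fin_cases j
        · exact ⟨α * t, by rw [hcpos _ hαt, mul_div_cancel_left₀ _ hαpos.ne']; rfl⟩
        · exact ⟨-(α * t), by
            rw [hcneg _ (neg_nonpos.2 hαt), neg_neg, mul_div_cancel_left₀ _ hαpos.ne']; rfl⟩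
      · exact ⟨0, hc0.trans h.symm⟩
    · rintro ⟨t, rfl⟩
      rcases lt_trichotomy t 0 with ht | rfl | ht
      · exact Or.inl (mem_iUnion.2 ⟨1, -t / α, div_pos (neg_pos.2 ht) hαpos, hcneg t ht.le⟩)
      · exact Or.inr hc0
      · exact Or.inl (mem_iUnion.2 ⟨0, t / α, div_pos ht hαpos, hcpos t ht.le⟩)
  rw [hrange] at hp ⊢
  obtain ⟨a, rfl⟩ := hp
  exact exists_homeomorph_translating_graph hc hc0 hcu a

/-- A tame frame invariant under `x ↦ 2x` is the image of a standard frame under a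
homeomorphism fixing the origin. -/
lemma exists_homeomorph_fixing_zero {ν : ℕ} {F : Set R3} (hF : IsTameFrame ν F)
    (h0 : (0 : R3) ∈ F) (hA : A3 '' F = F) :
    ∃ (s : Fin ν → R3) (H : R3 ≃ₜ R3), (∀ j, ‖s j‖ = 1) ∧ Function.Injective s ∧
      H 0 = 0 ∧ ∀ x, H x ∈ F ↔ x ∈ standardFrame s := by
  obtain ⟨s, H, hs, hinj, hFH⟩ := hF
  have hH : ∀ x, H x ∈ F ↔ x ∈ standardFrame s := fun x => by
    rw [hFH]
    exact H.injective.mem_set_image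
  by_cases hν : ν = 2
  · subst hν
    obtain ⟨T, hT0, hT⟩ := exists_homeomorph_moving_vertex hs hinj
      ((hH (H.symm 0)).1 (by rwa [H.apply_symm_apply]))
    refine ⟨s, T.trans H, hs, hinj, ?_, fun x => (hH (T x)).trans (hT x)⟩
    simp [hT0]
  · refine ⟨s, H, hs, hinj, ?_, hH⟩
    let A : R3 ≃ₜ R3 := Homeomorph.smulOfNeZero (2 : ℝ) two_ne_zero
    have hAF : ∀ x, A x ∈ F ↔ x ∈ F := fun x => by
      conv_lhs => rw [← hA]
      exact A.injective.mem_set_image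
    have hfix := map_zero_of_preserves_standardFrame hs hinj hν ((H.trans A).trans H.symm)
      fun x => by
        rw [← hH, ← hH]
        simpa using hAF (H x)
    have hAH : A (H 0) = H 0 := by
      have := congrArg H hfix
      simpa using this
    have h2 : (2 : ℝ) • H 0 = H 0 := hAH
    rwa [two_smul, add_eq_left] at h2

/-- The arcs of a frame which is the image of a standard frame, by a homeomorphism fixing the
origin, are the images of its rays. -/
lemma exists_arc_eq_image_ray {ν : ℕ} {L : Fin ν → Set R3} (hL : IsArcFrame L)
    {s : Fin ν → R3} (hs : ∀ j, ‖s j‖ = 1) (hinj : Function.Injective s) {H : R3 ≃ₜ R3}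
    (hH0 : H 0 = 0) (hH : ∀ x, H x ∈ (⋃ j, L j) ∪ {0} ↔ x ∈ standardFrame s) (j : Fin ν) :
    ∃ i, ∀ x, H x ∈ L j ↔ x ∈ ray (s i) := by
  have h0L : ∀ j, (0 : R3) ∉ L j := fun j => (hL.1 j).1
  have hLray : ∀ {j x}, H x ∈ L j → x ∈ ⋃ i, ray (s i) := by
    intro j x hx
    refine mem_iUnion_ray_of_ne_zero ((hH x).1 (Or.inl (mem_iUnion.2 ⟨j, hx⟩))) ?_
    rintro rfl
    exact h0L j (hH0 ▸ hx)
  have hrayL : ∀ {i x}, x ∈ ray (s i) → ∃ j, H x ∈ L j := by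
    intro i x hx
    rcases (hH x).2 (Or.inl (mem_iUnion.2 ⟨i, hx⟩)) with h | h
    · exact mem_iUnion.1 h
    · exact absurd (H.injective (h.trans hH0.symm)) (ne_zero_of_mem_ray (hs i) hx)
  have huniq : ∀ {x j k}, x ∈ L j → x ∈ L k → j = k := by
    intro x j k hj hk
    by_contra hjk
    exact (hL.2.1 hjk).le_bot ⟨hj, hk⟩
  have hopen : ∀ i j, IsOpen {t : ℝ | H (Real.exp t • s i) ∈ L j} := by
    intro i j
    rw [isOpen_iff_mem_nhds]
    intro t ht
    obtain ⟨-, ⟨hchart⟩, -⟩ := hL.1 j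
    obtain ⟨f, hf, hf0⟩ := exists_isOpenEmbedding_real (⟨_, ht⟩ : L j)
    let y : ℝ → R3 := fun w => H.symm (f w).1
    have hyc : Continuous y :=
      H.symm.continuous.comp (continuous_subtype_val.comp hf.continuous)
    have hHy : ∀ w, H (y w) = (f w).1 := fun w => H.apply_symm_apply _
    have hy0 : y 0 = Real.exp t • s i := by simp [y, hf0]
    obtain ⟨k, hk⟩ := exists_forall_mem_ray hs isPreconnected_univ univ_nonempty
      hyc.continuousOn fun w _ => hLray ((hHy w).symm ▸ (f w).2)
    obtain rfl : k = i :=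
      eq_of_mem_ray hs hinj (hk 0 (mem_univ _)) (hy0 ▸ exp_smul_mem_ray (s i) t)
    have hyray : ∀ w, y w ≠ 0 ∧ y w = ‖y w‖ • s k := fun w =>
      (mem_ray_iff (hs k)).1 (hk w (mem_univ _))
    let g : ℝ → ℝ := fun w => Real.log ‖y w‖
    have hyg : ∀ w, y w = Real.exp (g w) • s k := fun w => by
      rw [Real.exp_log (norm_pos_iff.2 (hyray w).1)]
      exact (hyray w).2
    have hg : Continuous g := hyc.norm.log fun w => norm_ne_zero_iff.2 (hyray w).1
    have hyinj : Function.Injective y :=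
      H.symm.injective.comp (Subtype.val_injective.comp hf.injective)
    have hginj : Function.Injective g := fun w w' h => hyinj (by rw [hyg, hyg w', h])
    have hg0 : g 0 = t := by simp [g, hy0, norm_smul, hs]
    refine Filter.mem_of_superset
      ((isOpenMap_of_continuous_injective hg hginj).isOpen_range.mem_nhds ⟨0, hg0⟩) ?_
    rintro _ ⟨w, rfl⟩
    change H (Real.exp (g w) • s k) ∈ L j
    rw [← hyg, hHy]
    exact (f w).2
  have hconst : ∀ i, ∃ j, ∀ x ∈ ray (s i), H x ∈ L j := by
    intro i
    choose J hJ using fun t => hrayL (exp_smul_mem_ray (s i) t)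
    have hloc : IsLocallyConstant J := by
      refine IsLocallyConstant.iff_isOpen_fiber.2 fun j => ?_
      convert hopen i j using 1
      ext t
      exact ⟨fun h => (h : J t = j) ▸ hJ t, fun h => huniq (hJ t) h⟩
    refine ⟨J 0, ?_⟩
    rintro x ⟨t, ht, rfl⟩
    have := hJ (Real.log t)
    rwa [Real.exp_log ht, hloc.apply_eq_of_preconnectedSpace _ 0] at this
  choose J hJ using hconst
  have hsurj : Function.Surjective J := by
    intro k
    obtain ⟨z, hz, -⟩ : (0 : ℝ) ∈ (fun x : R3 => Real.logb 2 ‖x‖) '' L k :=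
      (hL.1 k).2.2 ▸ mem_univ _
    have hz' : H (H.symm z) ∈ L k := by rwa [H.apply_symm_apply]
    obtain ⟨i, hi⟩ := mem_iUnion.1 (hLray hz')
    exact ⟨i, huniq (hJ i _ hi) hz'⟩
  obtain ⟨i, rfl⟩ := hsurj j
  refine ⟨i, fun x => ⟨fun hx => ?_, hJ i x⟩⟩
  obtain ⟨k, hk⟩ := mem_iUnion.1 (hLray hx)
  rwa [← Finite.injective_iff_surjective.2 hsurj (huniq (hJ k x hk) hx)]

lemma exists_foliation_of_isTameFrame {ν : ℕ} {L : Fin ν → Set R3} (hL : IsArcFrame L)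
    (h : IsTameFrame ν ((⋃ j, L j) ∪ {0})) :
    ∃ G : R3o ≃ₜ R3o, ∀ t : ℝ, 0 < t → ∀ j : Fin ν,
      IsSingletonSet ((Subtype.val '' (⇑G '' {x : R3o | ‖x.1‖ = t})) ∩ L j) := by
  have hA : A3 '' ((⋃ j, L j) ∪ {0}) = (⋃ j, L j) ∪ {0} := by
    rw [image_union, image_iUnion, image_singleton]
    simp only [hL.2.2]
    simp [A3]
  obtain ⟨s, H, hs, hinj, hH0, hH⟩ := exists_homeomorph_fixing_zero h (Or.inr rfl) hA
  let G : R3o ≃ₜ R3o := H.subtype fun x => by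
    rw [not_iff_not]
    exact ⟨fun h => h ▸ hH0, fun h => H.injective (h.trans hH0.symm)⟩
  have hG : ∀ x : R3o, (G x).1 = H x.1 := fun _ => rfl
  refine ⟨G, fun t ht j => ?_⟩
  obtain ⟨i, hi⟩ := exists_arc_eq_image_ray hL hs hinj hH0 hH j
  have hray : t • s i ∈ ray (s i) := ⟨t, ht, rfl⟩
  refine ⟨H (t • s i), Subset.antisymm ?_ ?_⟩
  · rintro _ ⟨⟨_, ⟨x, hx, rfl⟩, rfl⟩, hxL⟩
    have hx' : ‖x.1‖ = t := hx
    rw [hG, hi, mem_ray_iff (hs i), hx'] at hxL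
    rw [hG, mem_singleton_iff, ← hxL.2]
  · rintro _ rfl
    refine ⟨⟨_, ⟨⟨t • s i, ne_zero_of_mem_ray (hs i) hray⟩, ?_, rfl⟩, rfl⟩, (hi _).2 hray⟩
    simp [norm_smul, hs, abs_of_pos ht]

/-- **Theorem 1 (tameness criterion).** A frame of `ν` arcs is tame iff there is a
homeomorphism `G` of `ℝ³ ∖ {O}` such that every sphere `G(ℙ_t)`, `t > 0`, meets each arc
`L j` in exactly one point. -/
theorem arcFrame_tame_iff_sphere_foliation {ν : ℕ} (L : Fin ν → Set R3)
    (hL : IsArcFrame L) :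
    IsTameFrame ν ((⋃ j, L j) ∪ {0}) ↔
      ∃ G : R3o ≃ₜ R3o, ∀ t : ℝ, 0 < t → ∀ j : Fin ν,
        IsSingletonSet ((Subtype.val '' (⇑G '' {x : R3o | ‖x.1‖ = t})) ∩ L j) := by
  exact ⟨exists_foliation_of_isTameFrame hL, fun ⟨_, hG⟩ => isTameFrame_of_foliation hL hG⟩
end
end

section
/- For every ν ∈ ℕ, if a frame of ν circles J_ν in S² × S¹ is trivial, then the associated frame of arcs F_{J_ν} = π⁻¹(J_ν) ∪ {O} is tame. -/
noncomputable section

open Metric Set Topology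

/-- The covering `S² × ℝ → S² × S¹`. -/
def toS2xS1 (z : S2 × ℝ) : S2xS1 := (z.1, (z.2 : Circle1))

/-- The point of `ℝ³ ∖ {O}` with polar coordinates `z`; the inverse of `pMap`. -/
def polarPoint (z : S2 × ℝ) : R3 := (2:ℝ) ^ z.2 • z.1.1

theorem isCoveringMap_coe_circle1 : IsCoveringMap ((↑) : ℝ → Circle1) :=
  AddCircle.isCoveringMap_coe 1

theorem coe_circle1_eq_iff {a b : ℝ} : (a : Circle1) = b ↔ ∃ k : ℤ, a = b + k := by
  rw [← sub_eq_zero, ← AddCircle.coe_sub, AddCircle.coe_eq_zero_iff]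
  constructor
  · rintro ⟨k, hk⟩
    exact ⟨k, by simp at hk; linarith⟩
  · rintro ⟨k, hk⟩
    exact ⟨k, by simp [hk]⟩

instance preconnectedSpace_S2 : PreconnectedSpace S2 := by
  have h : 1 < Module.rank ℝ R3 := by
    rw [← Module.finrank_eq_rank, finrank_euclideanSpace_fin]; norm_num
  exact isPreconnected_iff_preconnectedSpace.mp (isPreconnected_sphere h _ _)

/-- Two real functions with the same reduction modulo `1` on a preconnected set, which they
are continuous on, differ by a constant integer. -/
theorem exists_int_shift_of_coe_eq {X : Type*} [TopologicalSpace X] {S : Set X}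
    (hS : IsPreconnected S) {g h : X → ℝ} (hg : ContinuousOn g S) (hh : ContinuousOn h S)
    (e : ∀ z ∈ S, (g z : Circle1) = h z) : ∃ k : ℤ, ∀ z ∈ S, g z = h z + k := by
  rcases S.eq_empty_or_nonempty with rfl | ⟨a, ha⟩
  · exact ⟨0, by simp⟩
  obtain ⟨k, hk⟩ := coe_circle1_eq_iff.mp (e a ha)
  refine ⟨k, fun z hz => ?_⟩
  refine isCoveringMap_coe_circle1.eqOn_of_comp_eqOn hS hg (g₂ := fun z => h z + k)
    (hh.add continuousOn_const) (fun w hw => ?_) ha hk hz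
  obtain ⟨l, hl⟩ := coe_circle1_eq_iff.mp (e w hw)
  exact coe_circle1_eq_iff.mpr ⟨l - k, by simp [hl]⟩

theorem exists_int_shift_of_continuous_of_coe_eq {X : Type*} [TopologicalSpace X] [PreconnectedSpace X]
    {g h : X → ℝ} (hg : Continuous g) (hh : Continuous h)
    (e : ∀ z, (g z : Circle1) = h z) : ∃ k : ℤ, ∀ z, g z = h z + k := by
  simpa using exists_int_shift_of_coe_eq isPreconnected_univ hg.continuousOn hh.continuousOn
    (fun z _ => e z)

/-- A circle valued map on a real topological vector space lifts to the line. -/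
theorem exists_real_lift_of_vectorSpace {E : Type*} [NormedAddCommGroup E] [NormedSpace ℝ E]
    {f : E → Circle1} (hf : Continuous f) :
    ∃ g : E → ℝ, Continuous g ∧ ∀ z, (g z : Circle1) = f z := by
  obtain ⟨r, hr⟩ := QuotientAddGroup.mk_surjective (f 0)
  obtain ⟨F, ⟨-, hF⟩, -⟩ := isCoveringMap_coe_circle1.existsUnique_continuousMap_lifts
    ⟨f, hf⟩ 0 r hr
  exact ⟨F, F.continuous, fun z => congrFun hF z⟩

/-- A circle valued map on the complement of `{v} × ℝ` in `S² × ℝ` lifts to the line. -/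
theorem exists_real_lift_on_compl (v : S2) {f : S2 × ℝ → Circle1} (hf : Continuous f) :
    ∃ g : S2 × ℝ → ℝ, ContinuousOn g {z | z.1 ≠ v} ∧
      ∀ z : S2 × ℝ, z.1 ≠ v → (g z : Circle1) = f z := by
  have hv : ‖v.1‖ = 1 := by simp
  set σ := stereographic hv
  have hσ : σ.source = {v}ᶜ := stereographic_source hv
  have hσt : σ.target = univ := stereographic_target hv
  have hs : Continuous σ.symm := by
    rw [← continuousOn_univ, ← hσt]; exact σ.continuousOn_symm
  obtain ⟨g, hg, hgf⟩ := exists_real_lift_of_vectorSpace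
    (f := fun w : (ℝ ∙ v.1)ᗮ × ℝ => f (σ.symm w.1, w.2))
    (hf.comp ((hs.comp continuous_fst).prodMk continuous_snd))
  refine ⟨fun z => g (σ z.1, z.2), ?_, fun z hz => ?_⟩
  · refine hg.comp_continuousOn (ContinuousOn.prodMk ?_ continuousOn_snd)
    refine σ.continuousOn.comp continuousOn_fst (fun z hz => ?_)
    rw [hσ]; exact hz
  · rw [hgf]
    have : z.1 ∈ σ.source := by rw [hσ]; exact hz
    simp [σ.left_inv this]

theorem isPreconnected_sphere_compl_pair (v : S2) :
    IsPreconnected ({x : S2 | x ≠ v ∧ x ≠ -v}) := by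
  have hv : ‖v.1‖ = 1 := by simp
  set σ := stereographic hv
  have hσ : σ.source = {v}ᶜ := stereographic_source hv
  have hσt : σ.target = univ := stereographic_target hv
  have hs : Continuous σ.symm := by
    rw [← continuousOn_univ, ← hσt]; exact σ.continuousOn_symm
  have hrank : 1 < Module.rank ℝ (ℝ ∙ v.1)ᗮ := by
    have : Fact (Module.finrank ℝ R3 = 2 + 1) := ⟨by simp⟩
    have h0 : v.1 ≠ 0 := by intro h; simp [h] at hv
    have h2 := Submodule.finrank_orthogonal_span_singleton (𝕜 := ℝ) (n := 2) h0
    rw [← Module.finrank_eq_rank, h2]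
    norm_num
  have hpre := (isConnected_compl_singleton_of_one_lt_rank hrank (σ (-v))).isPreconnected
  convert hpre.image σ.symm hs.continuousOn using 1
  have hne : -v ∈ σ.source := by
    rw [hσ]; intro h; exact (ne_neg_of_mem_unit_sphere ℝ v) h.symm
  ext x
  constructor
  · rintro ⟨h1, h2⟩
    have hx : x ∈ σ.source := by rw [hσ]; exact h1
    exact ⟨σ x, fun h => h2 (σ.injOn hx hne h), σ.left_inv hx⟩
  · rintro ⟨w, hw, rfl⟩
    have hwt : w ∈ σ.target := by rw [hσt]; trivial
    refine ⟨?_, fun h => hw ?_⟩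
    · have := σ.map_target hwt
      rw [hσ] at this; exact this
    · rw [mem_singleton_iff, ← h, σ.right_inv hwt]

/-- A circle valued map on `S² × ℝ` lifts to the line. -/
theorem exists_real_lift {f : S2 × ℝ → Circle1} (hf : Continuous f) :
    ∃ g : S2 × ℝ → ℝ, Continuous g ∧ ∀ z, (g z : Circle1) = f z := by
  obtain ⟨v⟩ : Nonempty S2 := (NormedSpace.sphere_nonempty.mpr zero_le_one).to_subtype
  obtain ⟨g₁, hg₁, e₁⟩ := exists_real_lift_on_compl v hf
  obtain ⟨g₂, hg₂, e₂⟩ := exists_real_lift_on_compl (-v) hf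
  have hvv : v ≠ -v := ne_neg_of_mem_unit_sphere ℝ v
  have hS : IsPreconnected {z : S2 × ℝ | z.1 ≠ v ∧ z.1 ≠ -v} := by
    convert (isPreconnected_sphere_compl_pair v).prod (isPreconnected_univ (α := ℝ)) using 1
    ext z; simp
  obtain ⟨k, hk⟩ := exists_int_shift_of_coe_eq hS (hg₁.mono fun z hz => hz.1)
    (hg₂.mono fun z hz => hz.2) (fun z hz => (e₁ z hz.1).trans (e₂ z hz.2).symm)
  classical
  have hopen : ∀ u : S2, IsOpen {z : S2 × ℝ | z.1 ≠ u} := fun u =>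
    isOpen_ne.preimage continuous_fst
  have h₁ : EqOn (fun z => if z.1 = v then g₂ z + k else g₁ z) g₁ {z | z.1 ≠ v} :=
    fun z hz => if_neg hz
  have h₂ : EqOn (fun z => if z.1 = v then g₂ z + k else g₁ z) (fun z => g₂ z + k)
      {z | z.1 ≠ -v} := by
    intro z hz
    by_cases h : z.1 = v
    · exact if_pos h
    · exact (if_neg h).trans (hk z ⟨h, hz⟩)
  refine ⟨fun z => if z.1 = v then g₂ z + k else g₁ z, ?_, fun z => ?_⟩
  · rw [continuous_iff_continuousAt]
    intro z
    by_cases h : z.1 = v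
    · exact ((hg₂.add continuousOn_const).congr h₂).continuousAt
        ((hopen (-v)).mem_nhds (show z.1 ≠ -v from h ▸ hvv))
    · exact (hg₁.congr h₁).continuousAt ((hopen v).mem_nhds h)
  · dsimp only
    by_cases h : z.1 = v
    · rw [if_pos h, ← e₂ z (h ▸ hvv)]
      exact coe_circle1_eq_iff.mpr ⟨k, rfl⟩
    · rw [if_neg h, e₁ z h]

/-- The translation by `a` in the second factor of `S² × ℝ`. -/
def shift (a : ℝ) (z : S2 × ℝ) : S2 × ℝ := (z.1, z.2 + a)

theorem continuous_shift (a : ℝ) : Continuous (shift a) := by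
  unfold shift; fun_prop

theorem continuous_toS2xS1 : Continuous toS2xS1 :=
  continuous_fst.prodMk ((AddCircle.continuous_mk' 1).comp continuous_snd)

theorem toS2xS1_shift (k : ℤ) (z : S2 × ℝ) : toS2xS1 (shift k z) = toS2xS1 z :=
  Prod.ext rfl (coe_circle1_eq_iff.mpr ⟨k, rfl⟩)

theorem exists_shift_of_toS2xS1_eq {F G : S2 × ℝ → S2 × ℝ} (hF : Continuous F)
    (hG : Continuous G) (e : ∀ z, toS2xS1 (F z) = toS2xS1 (G z)) :
    ∃ k : ℤ, ∀ z, F z = shift k (G z) := by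
  obtain ⟨k, hk⟩ := exists_int_shift_of_continuous_of_coe_eq (continuous_snd.comp hF) (continuous_snd.comp hG)
    (fun z => congrArg Prod.snd (e z))
  exact ⟨k, fun z => Prod.ext (congrArg (fun w : S2xS1 => w.1) (e z)) (hk z)⟩

/-- A self-map of `S² × S¹` lifts to a self-map of `S² × ℝ`. -/
theorem exists_lift_toS2xS1 {Φ : S2xS1 → S2xS1} (hΦ : Continuous Φ) :
    ∃ F : S2 × ℝ → S2 × ℝ, Continuous F ∧ ∀ z, toS2xS1 (F z) = Φ (toS2xS1 z) := by
  have hc := hΦ.comp continuous_toS2xS1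
  obtain ⟨g, hg, e⟩ := exists_real_lift (continuous_snd.comp hc)
  exact ⟨fun z => ((Φ (toS2xS1 z)).1, g z), (continuous_fst.comp hc).prodMk hg,
    fun z => Prod.ext rfl (e z)⟩

/-- A lift of a self-map of `S² × S¹` has a degree `n` in the second factor. -/
theorem exists_degree {Φ : S2xS1 → S2xS1} {F : S2 × ℝ → S2 × ℝ} (hF : Continuous F)
    (e : ∀ z, toS2xS1 (F z) = Φ (toS2xS1 z)) :
    ∃ n : ℤ, ∀ (k : ℤ) z, F (shift k z) = shift (n * k : ℤ) (F z) := by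
  obtain ⟨n, hn⟩ := exists_shift_of_toS2xS1_eq (hF.comp (continuous_shift (1 : ℤ))) hF
    (fun z => by simp only [Function.comp_apply, e, toS2xS1_shift])
  refine ⟨n, fun k z => Prod.ext ?_ ?_⟩
  · have := (e (shift k z)).trans (by rw [toS2xS1_shift, ← e])
    exact congrArg (fun w : S2xS1 => w.1) this
  · have hp : Function.Periodic (fun t : ℝ => (F (z.1, t)).2 - n * t) 1 := by
      intro t
      have := congrArg Prod.snd (hn (z.1, t))
      simp only [shift, Function.comp_apply, Int.cast_one] at this
      simp only [this]
      ring
    have := hp.int_mul k z.2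
    simp only [mul_one] at this
    simp only [shift]
    push_cast
    linarith

/-- A homeomorphism of `S² × S¹` is covered, up to a reflection of the second factor, by a
homeomorphism of `S² × ℝ` at bounded distance from the identity in the second factor. -/
theorem exists_bounded_lift (Φ : S2xS1 ≃ₜ S2xS1) :
    ∃ F : (S2 × ℝ) ≃ₜ (S2 × ℝ), (∀ z, (Φ.symm (toS2xS1 (F z))).1 = z.1) ∧
      ∃ K : ℝ, ∀ z, |(F z).2 - z.2| ≤ K := by
  obtain ⟨F, hF, eF⟩ := exists_lift_toS2xS1 Φ.continuous
  obtain ⟨G₀, hG₀, eG₀⟩ := exists_lift_toS2xS1 Φ.symm.continuous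
  obtain ⟨n, hn⟩ := exists_degree hF eF
  obtain ⟨k, hk⟩ := exists_shift_of_toS2xS1_eq (hG₀.comp hF) continuous_id
    (fun z => by simp [eG₀, eF])
  obtain ⟨G, hG, eG, hGF⟩ : ∃ G : S2 × ℝ → S2 × ℝ, Continuous G ∧
      (∀ z, toS2xS1 (G z) = Φ.symm (toS2xS1 z)) ∧ ∀ z, G (F z) = z := by
    refine ⟨fun z => shift (-k : ℤ) (G₀ z), (continuous_shift _).comp hG₀,
      fun z => by rw [toS2xS1_shift, eG₀], fun z => ?_⟩
    have := hk z
    simp only [Function.comp_apply, id] at this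
    simp only [this]
    simp [shift]
  obtain ⟨m, hm⟩ := exists_degree hG eG
  obtain ⟨l, hl⟩ := exists_shift_of_toS2xS1_eq (hF.comp hG) continuous_id
    (fun z => by simp [eG, eF])
  obtain ⟨v⟩ : Nonempty S2 := (NormedSpace.sphere_nonempty.mpr zero_le_one).to_subtype
  have hmn : m * n = 1 := by
    have h := hGF (shift (1 : ℤ) (v, 0))
    rw [hn, hm, hGF] at h
    have := congrArg Prod.snd h
    simp only [shift, zero_add, mul_one] at this
    exact_mod_cast this
  have hml : m * l = 0 := by
    have h := congrArg G (hl (v, 0))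
    simp only [Function.comp_apply, id, hm, hGF] at h
    have := congrArg Prod.snd h
    simp only [shift] at this
    have h' : ((m * l : ℤ) : ℝ) = 0 := by linarith
    exact_mod_cast h'
  have hl0 : l = 0 := by
    rcases mul_eq_zero.mp hml with h | h
    · simp [h] at hmn
    · exact h
  have hFG : ∀ z, F (G z) = z := fun z => by
    have := hl z
    simpa [hl0, shift] using this
  have hbound : ∀ {d : S2 × ℝ → ℝ}, Continuous d → (∀ x, Function.Periodic (fun t => d (x, t)) 1) →
      ∃ K : ℝ, ∀ z, |d z| ≤ K := by
    intro d hd hp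
    obtain ⟨K, hK⟩ := ((isCompact_univ (X := S2)).prod
      (isCompact_Icc (a := (0:ℝ)) (b := 1))).exists_bound_of_continuousOn hd.continuousOn
    refine ⟨K, fun z => ?_⟩
    have h1 := (hp z.1).sub_int_mul_eq ⌊z.2⌋ (x := z.2)
    simp only [mul_one] at h1
    have h2 := hK (z.1, z.2 - ⌊z.2⌋)
      ⟨trivial, by simp,
        by have := Int.lt_floor_add_one z.2; simp only; linarith⟩
    rw [h1] at h2
    exact h2
  have hper : ∀ x t, (F (x, t + 1)).2 = (F (x, t)).2 + n := fun x t => by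
    have := congrArg Prod.snd (hn 1 (x, t))
    simpa [shift] using this
  let e : (S2 × ℝ) ≃ₜ (S2 × ℝ) := ⟨⟨F, G, hGF, hFG⟩, hF, hG⟩
  rcases Int.eq_one_or_neg_one_of_mul_eq_one (by rwa [mul_comm] at hmn) with h1 | h1
  · refine ⟨e, fun z => ?_, hbound (hF.snd.sub continuous_snd) fun x t => ?_⟩
    · change (Φ.symm (toS2xS1 (F z))).1 = z.1
      rw [eF, Φ.symm_apply_apply]; rfl
    · change (F (x, t + 1)).2 - (t + 1) = (F (x, t)).2 - t
      rw [hper, h1]; push_cast; ring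
  · refine ⟨((Homeomorph.refl S2).prodCongr (Homeomorph.neg ℝ)).trans e, fun z => ?_,
      hbound (d := fun z => (F (z.1, -z.2)).2 - z.2) (by fun_prop) fun x t => ?_⟩
    · change (Φ.symm (toS2xS1 (F (z.1, -z.2)))).1 = z.1
      rw [eF, Φ.symm_apply_apply]; rfl
    · have := hper x (-(t + 1))
      rw [show -(t + 1) + 1 = -t by ring, h1] at this
      push_cast at this
      simp only; linarith

theorem norm_polarPoint (z : S2 × ℝ) : ‖polarPoint z‖ = (2:ℝ) ^ z.2 := by
  have : ‖z.1.1‖ = 1 := by simp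
  rw [polarPoint, norm_smul, this, mul_one, Real.norm_of_nonneg (by positivity)]

theorem polarPoint_ne_zero (z : S2 × ℝ) : polarPoint z ≠ 0 := by
  rw [← norm_ne_zero_iff, norm_polarPoint]; positivity

theorem polarPoint_pMap (x : R3o) : polarPoint (pMap x) = x.1 := by
  have hx : 0 < ‖x.1‖ := norm_pos_iff.mpr x.2
  simp only [polarPoint, pMap, unitize]
  rw [Real.rpow_logb (by norm_num) (by norm_num) hx, smul_smul, mul_inv_cancel₀ hx.ne', one_smul]

theorem pMap_polarPoint (z : S2 × ℝ) : pMap ⟨polarPoint z, polarPoint_ne_zero z⟩ = z := by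
  have h2 : (0:ℝ) < 2 ^ z.2 := by positivity
  refine Prod.ext (Subtype.ext ?_) ?_
  · simp only [pMap, unitize, norm_polarPoint]
    rw [polarPoint, smul_smul, inv_mul_cancel₀ h2.ne', one_smul]
  · simp only [pMap, norm_polarPoint]
    exact Real.logb_rpow (by norm_num) (by norm_num)

theorem continuous_polarPoint : Continuous polarPoint := by
  unfold polarPoint
  exact ((Real.continuous_const_rpow (by norm_num)).comp continuous_snd).smul
    (continuous_subtype_val.comp continuous_fst)

theorem continuous_pMap : Continuous pMap := by
  have hn : Continuous fun x : R3o => ‖x.1‖ := continuous_subtype_val.norm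
  have h0 : ∀ x : R3o, ‖x.1‖ ≠ 0 := fun x => norm_ne_zero_iff.mpr x.2
  refine Continuous.prodMk (Continuous.subtype_mk ((hn.inv₀ h0).smul continuous_subtype_val) _) ?_
  simp only [Real.logb]
  exact (hn.log h0).div_const _

open Classical in
/-- The self-map of `ℝ³` fixing `O` and given by `F` in polar coordinates elsewhere. -/
def polarExtend (F : S2 × ℝ → S2 × ℝ) (x : R3) : R3 :=
  if h : x ≠ 0 then polarPoint (F (pMap ⟨x, h⟩)) else 0

theorem polarExtend_zero (F : S2 × ℝ → S2 × ℝ) : polarExtend F 0 = 0 := by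
  simp [polarExtend]

theorem polarExtend_of_ne (F : S2 × ℝ → S2 × ℝ) (x : R3o) :
    polarExtend F x.1 = polarPoint (F (pMap x)) := dif_pos x.2

theorem polarExtend_polarPoint (F : S2 × ℝ → S2 × ℝ) (z : S2 × ℝ) :
    polarExtend F (polarPoint z) = polarPoint (F z) := by
  rw [polarExtend_of_ne F ⟨_, polarPoint_ne_zero z⟩, pMap_polarPoint]

theorem eq_zero_or_eq_polarPoint (x : R3) : x = 0 ∨ ∃ z, x = polarPoint z := by
  by_cases h : x = 0
  · exact Or.inl h
  · exact Or.inr ⟨pMap ⟨x, h⟩, (polarPoint_pMap ⟨x, h⟩).symm⟩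

theorem polarExtend_leftInverse {F G : S2 × ℝ → S2 × ℝ} (h : Function.LeftInverse G F) :
    Function.LeftInverse (polarExtend G) (polarExtend F) := by
  intro x
  rcases eq_zero_or_eq_polarPoint x with rfl | ⟨z, rfl⟩
  · simp [polarExtend_zero]
  · simp [polarExtend_polarPoint, h z]

theorem continuous_polarExtend {F : S2 × ℝ → S2 × ℝ} (hF : Continuous F) {K : ℝ}
    (hK : ∀ z, |(F z).2 - z.2| ≤ K) : Continuous (polarExtend F) := by
  rw [continuous_iff_continuousAt]
  intro x
  by_cases hx : x = 0
  · subst hx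
    have hb : ∀ y, ‖polarExtend F y‖ ≤ 2 ^ K * ‖y‖ := by
      intro y
      rcases eq_zero_or_eq_polarPoint y with rfl | ⟨z, rfl⟩
      · simp [polarExtend_zero]
      · rw [polarExtend_polarPoint, norm_polarPoint, norm_polarPoint, ← Real.rpow_add (by norm_num)]
        exact Real.rpow_le_rpow_of_exponent_le (by norm_num)
          (by linarith [le_abs_self ((F z).2 - z.2), hK z])
    rw [ContinuousAt, polarExtend_zero]
    refine squeeze_zero_norm hb ?_
    have : Continuous fun y : R3 => 2 ^ K * ‖y‖ := by fun_prop
    simpa using this.tendsto 0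
  · have hc : ContinuousOn (polarExtend F) {y | y ≠ 0} := by
      rw [continuousOn_iff_continuous_domRestrict]
      have : Set.domRestrict {y : R3 | y ≠ 0} (polarExtend F) =
          fun y : R3o => polarPoint (F (pMap y)) := funext fun y => polarExtend_of_ne F y
      rw [this]
      exact continuous_polarPoint.comp (hF.comp continuous_pMap)
    exact hc.continuousAt (isOpen_ne.mem_nhds hx)

/-- The extension to `ℝ³` of a homeomorphism in polar coordinates which moves the radial
coordinate by a bounded amount. -/
def polarHomeomorph (F : (S2 × ℝ) ≃ₜ (S2 × ℝ)) {K : ℝ} (hK : ∀ z, |(F z).2 - z.2| ≤ K) :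
    R3 ≃ₜ R3 where
  toFun := polarExtend F
  invFun := polarExtend F.symm
  left_inv := polarExtend_leftInverse F.symm_apply_apply
  right_inv := polarExtend_leftInverse F.apply_symm_apply
  continuous_toFun := continuous_polarExtend F.continuous hK
  continuous_invFun := continuous_polarExtend F.symm.continuous fun z => by
    have := hK (F.symm z)
    rwa [F.apply_symm_apply, abs_sub_comm] at this

theorem polarPoint_mem_ray_iff (z : S2 × ℝ) (q : S2) : polarPoint z ∈ ray q.1 ↔ z.1 = q := by
  constructor
  · rintro ⟨t, ht, h⟩
    have hn := congrArg norm h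
    have hq : ‖q.1‖ = 1 := by simp
    rw [norm_polarPoint, norm_smul, hq, mul_one, Real.norm_of_nonneg ht.le] at hn
    rw [polarPoint, hn] at h
    exact Subtype.ext (smul_right_injective R3 ht.ne' h)
  · rintro rfl
    exact ⟨2 ^ z.2, by positivity, rfl⟩

theorem polarPoint_mem_arcLift_iff (z : S2 × ℝ) (J : Set S2xS1) :
    polarPoint z ∈ arcLift J ↔ toS2xS1 z ∈ J := by
  have hpi : ∀ x : R3o, piMap x = toS2xS1 (pMap x) := fun x => rfl
  constructor
  · rintro ⟨x, hx, h⟩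
    have hx' : x = ⟨polarPoint z, polarPoint_ne_zero z⟩ := Subtype.ext h
    rwa [mem_preimage, hpi, hx', pMap_polarPoint] at hx
  · intro h
    exact ⟨⟨polarPoint z, polarPoint_ne_zero z⟩, by rwa [mem_preimage, hpi, pMap_polarPoint], rfl⟩

/-- If a frame of `ν` circles in `S² × S¹` is trivial, then the associated frame of arcs
`F_{J_ν} = π⁻¹(J_ν) ∪ {O}` is tame. -/
theorem trivialCircleFrame_assoc_tame {ν : ℕ} (C : Fin ν → Set S2xS1)
    (hC : IsCircleFrame C)
    (htriv : IsTrivialCircleFrame ν (⋃ j, C j)) :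
    IsTameFrame ν (assocFrameSet (⋃ j, C j)) := by
  obtain ⟨q, Φ, hq, hJ⟩ := htriv
  obtain ⟨F, hF, K, hK⟩ := exists_bounded_lift Φ
  refine ⟨fun j => (q j).1, polarHomeomorph F hK, fun j => by simp,
    Subtype.val_injective.comp hq, ?_⟩
  rw [hJ, ← (polarHomeomorph F hK).surjective.preimage_injective.eq_iff,
    preimage_image_eq _ (polarHomeomorph F hK).injective]
  ext x
  rw [mem_preimage]
  change polarExtend F x ∈ assocFrameSet _ ↔ _
  rcases eq_zero_or_eq_polarPoint x with rfl | ⟨z, rfl⟩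
  · simp [polarExtend_zero, assocFrameSet]
  · simp only [polarExtend_polarPoint, assocFrameSet, mem_union, mem_singleton_iff,
      polarPoint_ne_zero, or_false, polarPoint_mem_arcLift_iff, mem_iUnion,
      polarPoint_mem_ray_iff, ← hF z]
    rw [Homeomorph.image_eq_preimage_symm, mem_preimage]
    simp [stdCircle]
end
end

section
/- There exist an integer ν > 1 and a frame of ν arcs F_ν = L₁ ∪ … ∪ L_ν ∪ {O} such that F_ν is wild, each sub-frame L_j ∪ {O} (j ∈ {1,…,ν}) is a tame frame of one arc, and the unit sphere S² intersects each L_j in exactly one point. -/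
noncomputable section

open Metric Set Topology

/-! ### Loops that commute, and monodromy of coverings -/

/-- Any two loops of `X` with the same base point bound a torus in `X`. -/
def LoopsCommute (X : Type*) [TopologicalSpace X] : Prop :=
  ∀ α β : C(unitInterval, X), α 0 = α 1 → β 0 = β 1 → α 0 = β 0 →
    ∃ Γ : C(unitInterval × unitInterval, X),
      (∀ s, Γ (s, 0) = α s) ∧ (∀ s, Γ (s, 1) = α s) ∧
      (∀ t, Γ (0, t) = β t) ∧ ∀ t, Γ (1, t) = β t

lemma LoopsCommute.of_homeomorph {X Y : Type*} [TopologicalSpace X] [TopologicalSpace Y]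
    (h : LoopsCommute X) (e : X ≃ₜ Y) : LoopsCommute Y := by
  intro α β hα hβ hαβ
  obtain ⟨Γ, h0, h1, h2, h3⟩ := h ((e.symm : C(Y, X)).comp α) ((e.symm : C(Y, X)).comp β)
    (by simp [hα]) (by simp [hβ]) (by simp [hαβ])
  exact ⟨(e : C(X, Y)).comp Γ, by simp [h0], by simp [h1], by simp [h2], by simp [h3]⟩

lemma loopsCommute_of_topologicalGroup (G : Type*) [TopologicalSpace G] [Group G]
    [IsTopologicalGroup G] : LoopsCommute G := by
  intro α β hα hβ hαβ
  refine ⟨⟨fun p => α p.1 * (α 0)⁻¹ * β p.2, by fun_prop⟩, ?_, ?_, ?_, ?_⟩ <;>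
    intro s <;> simp [← hα, ← hβ, hαβ]

/-- If loops commute in the base, then the monodromies of a covering along two loops
with the same base point commute. -/
lemma LoopsCommute.monodromy {X E : Type*} [TopologicalSpace X] [TopologicalSpace E]
    (h : LoopsCommute X) {p : E → X} (hp : IsCoveringMap p)
    {a₁ b₁ a₀ b₀ : C(unitInterval, E)}
    (ha : ∀ s, p (a₁ s) = p (a₀ s)) (hb : ∀ s, p (b₁ s) = p (b₀ s))
    (hα : p (a₀ 0) = p (a₀ 1)) (hβ : p (b₀ 0) = p (b₀ 1))
    (h₀ : b₀ 0 = a₁ 0) (h₁ : b₁ 0 = a₁ 1) (h₂ : a₀ 0 = b₀ 1) : b₁ 1 = a₀ 1 := by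
  have hpc := hp.continuous
  obtain ⟨Γ, g0, g1, g2, g3⟩ := h ((⟨p, hpc⟩ : C(E, X)).comp a₀) ((⟨p, hpc⟩ : C(E, X)).comp b₀)
    (by simpa using hα) (by simpa using hβ) (by simp [h₂, hβ])
  simp only [ContinuousMap.comp_apply, ContinuousMap.coe_mk] at g0 g1 g2 g3
  set Γ' := hp.liftHomotopy Γ b₀ g2 with hΓ'
  have l : ∀ q, p (Γ' q) = Γ q := fun q => congrFun (hp.liftHomotopy_lifts Γ b₀ g2) q
  have z : ∀ t, Γ' (0, t) = b₀ t := fun t => hp.liftHomotopy_zero Γ b₀ g2 t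
  have e1 : (fun s => Γ' (s, 0)) = a₁ :=
    hp.eq_of_comp_eq (by fun_prop) (by fun_prop)
      (funext fun s => by simp [l, g0, ha]) 0 (by simp [z, h₀])
  have e2 : (fun t => Γ' (1, t)) = b₁ :=
    hp.eq_of_comp_eq (by fun_prop) (by fun_prop)
      (funext fun s => by simp [l, g3, hb]) 0 (by rw [h₁]; exact congrFun e1 1)
  have e3 : (fun s => Γ' (s, 1)) = a₀ :=
    hp.eq_of_comp_eq (by fun_prop) (by fun_prop)
      (funext fun s => by simp [l, g1]) 0 (by simp [z, h₂])
  exact (congrFun e2 1).symm.trans (congrFun e3 1)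

/-! ### Coverings glued along the four half-planes of a cross -/

/-- Gluing permutations of a fibre `F` along the four walls of the decomposition of `X`
by the signs of two functions `y` and `z`. -/
structure CrossGluing (X F : Type*) [TopologicalSpace X] where
  y : X → ℝ
  z : X → ℝ
  up : X → Equiv.Perm F
  low : X → Equiv.Perm F
  c : X → Equiv.Perm F
  s : X → Equiv.Perm F
  continuous_y : Continuous y
  continuous_z : Continuous z
  up_eventually : ∀ x, z x = 0 → 0 ≤ y x → ∀ᶠ w in 𝓝 x, z w = 0 → 0 ≤ y w → up w = up x
  low_eventually : ∀ x, z x = 0 → y x ≤ 0 → ∀ᶠ w in 𝓝 x, z w = 0 → y w ≤ 0 → low w = low x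
  c_eventually : ∀ x, y x = 0 → 0 ≤ z x → ∀ᶠ w in 𝓝 x, y w = 0 → 0 ≤ z w → c w = c x
  s_eventually : ∀ x, y x = 0 → z x ≤ 0 → ∀ᶠ w in 𝓝 x, y w = 0 → z w ≤ 0 → s w = s x
  relation : ∀ x, y x = 0 → z x = 0 → low x * c x = s x * up x

namespace CrossGluing

variable {X F : Type*} [TopologicalSpace X] (D : CrossGluing X F)

/-- The chart of the covering near `x`, in terms of the labels of the four chambers. -/
def chart (x w : X) : Equiv.Perm F :=
  if 0 ≤ D.z w then (if 0 ≤ D.y w then 1 else (D.c x)⁻¹)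
  else (if 0 ≤ D.y w then (D.up x)⁻¹
    else if D.y x < 0 then (D.c x)⁻¹ * (D.low x)⁻¹ else (D.up x)⁻¹ * (D.s x)⁻¹)

lemma chart_transition (x : X) :
    ∀ᶠ w in 𝓝 x, ∃ k : Equiv.Perm F, ∀ᶠ w' in 𝓝 w, D.chart x w' = k * D.chart w w' := by
  have evneg : ∀ (f : X → ℝ), Continuous f → ∀ w, ∀ᶠ w' in 𝓝 w, f w < 0 → f w' < 0 := by
    intro f hf w
    by_cases h : f w < 0
    · filter_upwards [hf.continuousAt.eventually_lt continuousAt_const h] with w' h' _ using h'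
    · simp [h]
  have evpos : ∀ (f : X → ℝ), Continuous f → ∀ w, ∀ᶠ w' in 𝓝 w, 0 < f w → 0 < f w' := by
    intro f hf w
    by_cases h : 0 < f w
    · filter_upwards [continuousAt_const.eventually_lt hf.continuousAt h] with w' h' _ using h'
    · simp [h]
  have e1 : ∀ᶠ w in 𝓝 x, D.z x = 0 → 0 ≤ D.y x → D.z w = 0 → 0 ≤ D.y w → D.up w = D.up x := by
    by_cases h : D.z x = 0 ∧ 0 ≤ D.y x
    · filter_upwards [D.up_eventually x h.1 h.2] with w hw _ _ using hw
    · exact Filter.Eventually.of_forall fun w h1 h2 => absurd ⟨h1, h2⟩ h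
  have e2 : ∀ᶠ w in 𝓝 x, D.z x = 0 → D.y x ≤ 0 → D.z w = 0 → D.y w ≤ 0 → D.low w = D.low x := by
    by_cases h : D.z x = 0 ∧ D.y x ≤ 0
    · filter_upwards [D.low_eventually x h.1 h.2] with w hw _ _ using hw
    · exact Filter.Eventually.of_forall fun w h1 h2 => absurd ⟨h1, h2⟩ h
  have e3 : ∀ᶠ w in 𝓝 x, D.y x = 0 → 0 ≤ D.z x → D.y w = 0 → 0 ≤ D.z w → D.c w = D.c x := by
    by_cases h : D.y x = 0 ∧ 0 ≤ D.z x
    · filter_upwards [D.c_eventually x h.1 h.2] with w hw _ _ using hw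
    · exact Filter.Eventually.of_forall fun w h1 h2 => absurd ⟨h1, h2⟩ h
  have e4 : ∀ᶠ w in 𝓝 x, D.y x = 0 → D.z x ≤ 0 → D.y w = 0 → D.z w ≤ 0 → D.s w = D.s x := by
    by_cases h : D.y x = 0 ∧ D.z x ≤ 0
    · filter_upwards [D.s_eventually x h.1 h.2] with w hw _ _ using hw
    · exact Filter.Eventually.of_forall fun w h1 h2 => absurd ⟨h1, h2⟩ h
  filter_upwards [e1, e2, e3, e4, evneg _ D.continuous_y x, evpos _ D.continuous_y x,
    evneg _ D.continuous_z x, evpos _ D.continuous_z x] with w e1 e2 e3 e4 yn yp zn zp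
  have yn' := evneg _ D.continuous_y w
  have yp' := evpos _ D.continuous_y w
  have zn' := evneg _ D.continuous_z w
  have zp' := evpos _ D.continuous_z w
  rcases lt_trichotomy (D.y w) 0 with hy | hy | hy <;>
  rcases lt_trichotomy (D.z w) 0 with hz | hz | hz
  · refine ⟨D.chart x w * (D.chart w w)⁻¹, ?_⟩
    filter_upwards [yn', zn'] with w' h1 h2
    simp only [chart, not_le.2 (h1 hy), not_le.2 (h2 hz), not_le.2 hy, not_le.2 hz, if_false]
    group
  · have hzx : D.z x = 0 := by
      rcases lt_trichotomy (D.z x) 0 with h | h | h <;> grind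
    have hyx : D.y x ≤ 0 := by by_contra! h; grind
    have e2 := e2 hzx hyx hz hy.le
    refine ⟨(D.c x)⁻¹ * D.c w, ?_⟩
    filter_upwards [yn'] with w' h1
    have h1 := h1 hy
    simp only [chart, not_le.2 h1, if_false, hy, if_true]
    split_ifs with h3 h4
    · simp
    · rw [e2]; group
    · have hyx : D.y x = 0 := le_antisymm hyx (not_lt.1 h4)
      have := D.relation x hyx hzx
      rw [← mul_inv_rev, ← this, e2]
      group
  · refine ⟨D.chart x w * (D.chart w w)⁻¹, ?_⟩
    filter_upwards [yn', zp'] with w' h1 h2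
    simp [chart, not_le.2 (h1 hy), (h2 hz).le, not_le.2 hy, hz.le]
  · have hyx : D.y x = 0 := by
      rcases lt_trichotomy (D.y x) 0 with h | h | h <;> grind
    have hzx : D.z x ≤ 0 := by by_contra! h; grind
    have e4 := e4 hyx hzx hy hz.le
    refine ⟨(D.up x)⁻¹ * D.up w, ?_⟩
    filter_upwards [zn'] with w' h1
    have h1 := h1 hz
    simp only [chart, not_le.2 h1, if_false, hy, hyx, lt_irrefl]
    split_ifs with h3
    · simp
    · rw [e4]; group
  · have hyx : D.y x = 0 := by
      rcases lt_trichotomy (D.y x) 0 with h | h | h <;> grind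
    have hzx : D.z x = 0 := by
      rcases lt_trichotomy (D.z x) 0 with h | h | h <;> grind
    refine ⟨1, Filter.Eventually.of_forall fun w' => ?_⟩
    simp [chart, hyx, hy, e1 hzx hyx.ge hz hy.ge, e3 hyx hzx.ge hy hz.ge, e4 hyx hzx.le hy hz.le]
  · have hyx : D.y x = 0 := by
      rcases lt_trichotomy (D.y x) 0 with h | h | h <;> grind
    have hzx : 0 ≤ D.z x := by by_contra! h; grind
    have e3 := e3 hyx hzx hy hz.le
    refine ⟨1, ?_⟩
    filter_upwards [zp'] with w' h1
    simp [chart, (h1 hz).le, e3]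
  · refine ⟨D.chart x w * (D.chart w w)⁻¹, ?_⟩
    filter_upwards [yp', zn'] with w' h1 h2
    simp [chart, (h1 hy).le, not_le.2 (h2 hz), hy.le, not_le.2 hz]
  · have hzx : D.z x = 0 := by
      rcases lt_trichotomy (D.z x) 0 with h | h | h <;> grind
    have hyx : 0 ≤ D.y x := by by_contra! h; grind
    have e1 := e1 hzx hyx hz hy.le
    refine ⟨1, ?_⟩
    filter_upwards [yp'] with w' h1
    simp [chart, (h1 hy).le, e1]
  · refine ⟨D.chart x w * (D.chart w w)⁻¹, ?_⟩
    filter_upwards [yp', zp'] with w' h1 h2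
    simp [chart, (h1 hy).le, (h2 hz).le, hy.le, hz.le]

variable [TopologicalSpace F] [DiscreteTopology F]

/-- The covering space with fibre `F` obtained from the gluing permutations. -/
def core : FiberBundleCore X X F where
  baseSet x := interior {w | ∃ k : Equiv.Perm F, ∀ᶠ w' in 𝓝 w, D.chart x w' = k * D.chart w w'}
  isOpen_baseSet _ := isOpen_interior
  indexAt := id
  mem_baseSet_at x := mem_interior_iff_mem_nhds.2 (D.chart_transition x)
  coordChange i j b f := D.chart j b ((D.chart i b)⁻¹ f)
  coordChange_self i x _ v := by simp
  continuousOn_coordChange i j := by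
    rintro ⟨b, f⟩ ⟨⟨hi, hj⟩, -⟩
    obtain ⟨k, hk⟩ := interior_subset hi
    obtain ⟨l, hl⟩ := interior_subset hj
    refine ContinuousAt.continuousWithinAt ?_
    have : ∀ᶠ q : X × F in 𝓝 (b, f), D.chart j q.1 ((D.chart i q.1)⁻¹ q.2) = (l * k⁻¹) q.2 := by
      filter_upwards [(continuous_fst.tendsto (b, f)).eventually hk,
        (continuous_fst.tendsto (b, f)).eventually hl] with q h1 h2
      rw [h1, h2]
      simp
    refine ContinuousAt.congr ?_ (Filter.EventuallyEq.symm this)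
    exact ((continuous_of_discreteTopology (f := fun f : F => (l * k⁻¹) f)).comp
      continuous_snd).continuousAt
  coordChange_comp i j k x _ v := by simp

lemma isCoveringMap : IsCoveringMap (Bundle.TotalSpace.proj (F := F) (E := D.core.Fiber)) :=
  FiberBundle.isCoveringMap

/-- The point over `x` with the given label in the chamber containing `x`. -/
def pt (x : X) (l : F) : D.core.TotalSpace := ⟨x, D.chart x x l⟩

lemma pt_injective (x : X) : Function.Injective (D.pt x) := by
  intro l l' h
  have : D.chart x x l = D.chart x x l' := by
    exact Bundle.TotalSpace.mk_injective x h
  exact (D.chart x x).injective this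

lemma continuous_pt {S : Type*} [TopologicalSpace S] {α : S → X} (hα : Continuous α) {l : S → F}
    (h : ∀ s₀, ∀ᶠ s in 𝓝 s₀, D.chart (α s₀) (α s) (l s) = D.chart (α s₀) (α s₀) (l s₀)) :
    Continuous fun s => D.pt (α s) (l s) := by
  refine continuous_iff_continuousAt.2 fun s₀ => ?_
  rw [FiberBundle.continuousAt_totalSpace F]
  refine ⟨hα.continuousAt, ?_⟩
  refine ContinuousAt.congr (f := fun _ => D.chart (α s₀) (α s₀) (l s₀)) continuousAt_const ?_
  filter_upwards [h s₀] with s hs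
  rw [← hs]
  change _ = D.chart (α s₀) (α s) ((D.chart (α s) (α s))⁻¹ (D.chart (α s) (α s) (l s)))
  simp

end CrossGluing

/-! ### The complement of a standard frame of two arcs -/

lemma LoopsCommute.of_retract {X G : Type*} [TopologicalSpace X] [TopologicalSpace G]
    (h : LoopsCommute G) (i : X → G) (r : G → X) (hi : Continuous i) (hr : Continuous r)
    (hri : ∀ x, r (i x) = x) : LoopsCommute X := by
  intro α β hα hβ hαβ
  obtain ⟨Γ, h0, h1, h2, h3⟩ := h ((⟨i, hi⟩ : C(X, G)).comp α) ((⟨i, hi⟩ : C(X, G)).comp β)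
    (by simp [hα]) (by simp [hβ]) (by simp [hαβ])
  exact ⟨(⟨r, hr⟩ : C(G, X)).comp Γ, by simp [h0, hri], by simp [h1, hri], by simp [h2, hri],
    by simp [h3, hri]⟩

lemma mem_ray_iff_of_norm_eq_one {s x : R3} (hs : ‖s‖ = 1) (hx : x ≠ 0) :
    x ∈ ray s ↔ ‖x‖⁻¹ • x = s := by
  have hx' := norm_ne_zero_iff.2 hx
  constructor
  · rintro ⟨t, ht, rfl⟩
    rw [norm_smul, hs, mul_one, Real.norm_of_nonneg ht.le, smul_smul, inv_mul_cancel₀ ht.ne',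
      one_smul]
  · rintro rfl
    exact ⟨‖x‖, norm_pos_iff.2 hx, by rw [smul_smul, mul_inv_cancel₀ hx', one_smul]⟩

lemma loopsCommute_compl_rays (s : Fin 2 → R3) (hs : ∀ j, ‖s j‖ = 1)
    (hinj : Function.Injective s) :
    LoopsCommute ↥(((⋃ j, ray (s j)) ∪ {0})ᶜ : Set R3) := by
  have : Fact (Module.finrank ℝ R3 = 2 + 1) := ⟨by simp⟩
  let p (j : Fin 2) : S2 := ⟨s j, by simp [hs]⟩
  have hp : p 1 ≠ p 0 := fun h => by
    have := hinj (Subtype.ext_iff.1 h)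
    simp at this
  let σ := stereographic' 2 (p 0)
  let ψ : ℂ ≃ₗᵢ[ℝ] EuclideanSpace ℝ (Fin 2) := Complex.orthonormalBasisOneI.repr
  have hσs : σ.source = {p 0}ᶜ := stereographic'_source _
  have hσt : σ.target = Set.univ := stereographic'_target _
  have h0 (x : ↥(((⋃ j, ray (s j)) ∪ {0})ᶜ : Set R3)) : x.1 ≠ 0 := fun h => x.2 (Or.inr h)
  let u (x : ↥(((⋃ j, ray (s j)) ∪ {0})ᶜ : Set R3)) : S2 := unitize ⟨x.1, h0 x⟩
  have hu (x j) : u x ≠ p j := fun h => by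
    have : x.1 ∈ ray (s j) := (mem_ray_iff_of_norm_eq_one (hs j) (h0 x)).2 (Subtype.ext_iff.1 h)
    exact x.2 (Or.inl (Set.mem_iUnion.2 ⟨j, this⟩))
  have huc : Continuous u := by
    refine Continuous.subtype_mk ?_ _
    have : ∀ x : ↥(((⋃ j, ray (s j)) ∪ {0})ᶜ : Set R3), ‖x.1‖ ≠ 0 := fun x =>
      norm_ne_zero_iff.2 (h0 x)
    fun_prop (disch := assumption)
  have hσu : Continuous fun x => σ (u x) :=
    σ.continuousOn.comp_continuous huc fun x => by rw [hσs]; exact hu x 0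
  have hne (x) : ψ.symm (σ (u x)) - ψ.symm (σ (p 1)) ≠ 0 := by
    rw [sub_ne_zero, ψ.symm.injective.ne_iff, σ.injOn.ne_iff]
    · exact hu x 1
    · rw [hσs]; exact hu x 0
    · rw [hσs]; exact hp
  have hσsymm : Continuous σ.symm := by
    rw [← continuousOn_univ, ← hσt]; exact σ.continuousOn_symm
  have hmem (z : EuclideanSpace ℝ (Fin 2)) : σ.symm z ≠ p 0 := by
    have := σ.map_target (x := z) (by rw [hσt]; trivial)
    rwa [hσs] at this
  have hnorm (q : S2) (t : ℝ) : Real.exp t • q.1 ≠ 0 ∧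
      ‖Real.exp t • q.1‖⁻¹ • (Real.exp t • q.1) = q.1 := by
    have hq : ‖q.1‖ = 1 := norm_eq_of_mem_sphere q
    have h2 : ‖Real.exp t • q.1‖ = Real.exp t := by
      rw [norm_smul, hq, mul_one, Real.norm_of_nonneg (Real.exp_pos t).le]
    refine ⟨norm_ne_zero_iff.1 (by rw [h2]; exact (Real.exp_pos t).ne'), ?_⟩
    rw [h2, smul_smul, inv_mul_cancel₀ (Real.exp_pos t).ne', one_smul]
  refine (loopsCommute_of_topologicalGroup (ℂˣ × Multiplicative ℝ)).of_retract
    (fun x => (Units.mk0 _ (hne x), Multiplicative.ofAdd (Real.log ‖x.1‖)))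
    (fun g => ⟨Real.exp g.2.toAdd • (σ.symm (ψ (g.1 + ψ.symm (σ (p 1))))).1, ?_⟩) ?_ ?_ ?_
  · obtain ⟨hn, hn'⟩ := hnorm (σ.symm (ψ (g.1 + ψ.symm (σ (p 1))))) g.2.toAdd
    rintro (h | h)
    · obtain ⟨j, hj⟩ := Set.mem_iUnion.1 h
      rw [mem_ray_iff_of_norm_eq_one (hs j) hn, hn'] at hj
      have hj : σ.symm (ψ (g.1 + ψ.symm (σ (p 1)))) = p j := Subtype.ext hj
      fin_cases j
      · exact hmem _ hj
      · have h3 := congrArg σ hj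
        rw [σ.right_inv (by rw [hσt]; trivial)] at h3
        have h4 := congrArg ψ.symm h3
        simp at h4
    · exact hn h
  · refine Continuous.prodMk ?_ ?_
    · rw [Units.isEmbedding_val₀.continuous_iff]
      exact (ψ.symm.continuous.comp hσu).sub continuous_const
    · exact continuous_ofAdd.comp ((continuous_norm.comp continuous_subtype_val).log fun x =>
        norm_ne_zero_iff.2 (h0 x))
  · refine Continuous.subtype_mk ?_ _
    exact (Real.continuous_exp.comp (continuous_toAdd.comp continuous_snd)).smul
      (continuous_subtype_val.comp (hσsymm.comp (ψ.continuous.comp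
        ((Units.continuous_val.comp continuous_fst).add continuous_const))))
  · intro x
    apply Subtype.ext
    have hx : 0 < ‖x.1‖ := norm_pos_iff.2 (h0 x)
    simp only [Units.val_mk0, sub_add_cancel, LinearIsometryEquiv.apply_symm_apply, toAdd_ofAdd]
    rw [σ.left_inv (by rw [hσs]; exact hu x 0), Real.exp_log hx]
    change ‖x.1‖ • ‖x.1‖⁻¹ • x.1 = x.1
    rw [smul_smul, mul_inv_cancel₀ hx.ne', one_smul]

lemma IsTameFrame.loopsCommute_compl {F : Set R3} (h : IsTameFrame 2 F) :
    LoopsCommute ↥(Fᶜ : Set R3) := by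
  obtain ⟨s, H, hs, hinj, rfl⟩ := h
  refine (loopsCommute_compl_rays s hs hinj).of_homeomorph ?_
  exact (H.image _).trans (Homeomorph.setCongr (Set.image_compl_eq H.bijective))

open scoped Real

/-! ### Homeomorphisms fixing the origin, and the arcs they produce -/

lemma norm_sq_R3 (x : R3) : ‖x‖ ^ 2 = x 0 ^ 2 + x 1 ^ 2 + x 2 ^ 2 := by
  rw [EuclideanSpace.norm_sq_eq, Fin.sum_univ_three]
  simp

lemma continuous_of_continuousOn_compl_zero {f : R3 → R3} (hf : ContinuousOn f {0}ᶜ) {C : ℝ}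
    (hC : ∀ x, ‖f x‖ ≤ C * ‖x‖) : Continuous f := by
  refine continuous_iff_continuousAt.2 fun x => ?_
  by_cases hx : x = 0
  · subst hx
    have h0 : f 0 = 0 := norm_le_zero_iff.1 (by simpa using hC 0)
    rw [ContinuousAt, h0]
    refine squeeze_zero_norm hC ?_
    have : Continuous fun x : R3 => C * ‖x‖ := by fun_prop
    simpa using this.tendsto 0
  · exact hf.continuousAt (isOpen_compl_singleton.mem_nhds hx)

/-- Mutually inverse maps of linear growth, continuous off the origin, give a homeomorphism. -/
def homeomorphOfLinearGrowth (f g : R3 → R3) (hf : ContinuousOn f {0}ᶜ)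
    (hg : ContinuousOn g {0}ᶜ) (C : ℝ) (hfC : ∀ x, ‖f x‖ ≤ C * ‖x‖) (hgC : ∀ x, ‖g x‖ ≤ C * ‖x‖)
    (hgf : ∀ x, g (f x) = x) (hfg : ∀ x, f (g x) = x) : R3 ≃ₜ R3 where
  toFun := f
  invFun := g
  left_inv := hgf
  right_inv := hfg
  continuous_toFun := continuous_of_continuousOn_compl_zero hf hfC
  continuous_invFun := continuous_of_continuousOn_compl_zero hg hgC

/-- Rotate each sphere around the origin by an angle depending continuously on its radius. -/
def twist (R : ℝ → R3 → R3) (hR : Continuous fun p : ℝ × R3 => R p.1 p.2)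
    (hn : ∀ a x, ‖R a x‖ = ‖x‖) (hinv : ∀ a x, R (-a) (R a x) = x) (φ : ℝ → ℝ)
    (hφ : Continuous φ) : R3 ≃ₜ R3 :=
  homeomorphOfLinearGrowth (fun x => R (φ (Real.logb 2 ‖x‖)) x)
    (fun x => R (-φ (Real.logb 2 ‖x‖)) x)
    (by
      have h : ContinuousOn (fun x : R3 => φ (Real.logb 2 ‖x‖)) {0}ᶜ :=
        hφ.comp_continuousOn (continuous_norm.continuousOn.logb fun x hx => norm_ne_zero_iff.2 hx)
      exact hR.comp_continuousOn (h.prodMk continuousOn_id))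
    (by
      have h : ContinuousOn (fun x : R3 => φ (Real.logb 2 ‖x‖)) {0}ᶜ :=
        hφ.comp_continuousOn (continuous_norm.continuousOn.logb fun x hx => norm_ne_zero_iff.2 hx)
      exact hR.comp_continuousOn (h.neg.prodMk continuousOn_id))
    1 (by simp [hn]) (by simp [hn]) (by simp [hn, hinv])
    (fun x => by
      have := hinv (-φ (Real.logb 2 ‖x‖)) x
      rw [neg_neg] at this
      simpa [hn] using this)

/-- The rotation by the angle `a` about the last coordinate axis. -/
def rotZ (a : ℝ) (x : R3) : R3 :=
  !₂[Real.cos a * x 0 - Real.sin a * x 1, Real.sin a * x 0 + Real.cos a * x 1, x 2]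

/-- The rotation by the angle `a` about the middle coordinate axis. -/
def rotY (a : ℝ) (x : R3) : R3 :=
  !₂[Real.cos a * x 0 + Real.sin a * x 2, x 1, -Real.sin a * x 0 + Real.cos a * x 2]

lemma continuous_vec3 {X : Type*} [TopologicalSpace X] {f g h : X → ℝ} (hf : Continuous f)
    (hg : Continuous g) (hh : Continuous h) : Continuous fun x => (!₂[f x, g x, h x] : R3) := by
  refine (PiLp.continuous_toLp 2 _).comp (continuous_pi fun i => ?_)
  fin_cases i <;> simpa

lemma continuous_rotZ : Continuous fun p : ℝ × R3 => rotZ p.1 p.2 :=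
  continuous_vec3 (by fun_prop) (by fun_prop) (by fun_prop)

lemma continuous_rotY : Continuous fun p : ℝ × R3 => rotY p.1 p.2 :=
  continuous_vec3 (by fun_prop) (by fun_prop) (by fun_prop)

lemma norm_rotZ (a : ℝ) (x : R3) : ‖rotZ a x‖ = ‖x‖ := by
  rw [← sq_eq_sq₀ (norm_nonneg _) (norm_nonneg _), norm_sq_R3, norm_sq_R3]
  simp only [rotZ, PiLp.toLp_apply, Matrix.cons_val]
  linear_combination (x 0 ^ 2 + x 1 ^ 2) * Real.sin_sq_add_cos_sq a

lemma norm_rotY (a : ℝ) (x : R3) : ‖rotY a x‖ = ‖x‖ := by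
  rw [← sq_eq_sq₀ (norm_nonneg _) (norm_nonneg _), norm_sq_R3, norm_sq_R3]
  simp only [rotY, PiLp.toLp_apply, Matrix.cons_val]
  linear_combination (x 0 ^ 2 + x 2 ^ 2) * Real.sin_sq_add_cos_sq a

lemma R3_ext {x y : R3} (h0 : x 0 = y 0) (h1 : x 1 = y 1) (h2 : x 2 = y 2) : x = y := by
  ext i
  fin_cases i <;> assumption

lemma rotZ_neg_rotZ (a : ℝ) (x : R3) : rotZ (-a) (rotZ a x) = x := by
  apply R3_ext <;> simp only [rotZ, PiLp.toLp_apply, Matrix.cons_val, Real.cos_neg, Real.sin_neg]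
  · linear_combination x 0 * Real.sin_sq_add_cos_sq a
  · linear_combination x 1 * Real.sin_sq_add_cos_sq a

lemma rotY_neg_rotY (a : ℝ) (x : R3) : rotY (-a) (rotY a x) = x := by
  apply R3_ext <;> simp only [rotY, PiLp.toLp_apply, Matrix.cons_val, Real.cos_neg, Real.sin_neg]
  · linear_combination x 0 * Real.sin_sq_add_cos_sq a
  · linear_combination x 2 * Real.sin_sq_add_cos_sq a

/-- The exponent of the radial stretching `shear`. -/
def shearExp (x : R3) : ℝ := x 0 * x 1 / ‖x‖ ^ 2

lemma abs_shearExp_le (x : R3) : |shearExp x| ≤ 1 := by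
  rw [shearExp, abs_div, abs_of_nonneg (sq_nonneg ‖x‖)]
  refine div_le_one_of_le₀ ?_ (sq_nonneg _)
  rw [norm_sq_R3, abs_le]
  constructor <;> nlinarith [sq_nonneg (x 0 + x 1), sq_nonneg (x 0 - x 1), sq_nonneg (x 2),
    sq_nonneg (x 0), sq_nonneg (x 1)]

lemma shearExp_smul {r : ℝ} (hr : r ≠ 0) (x : R3) : shearExp (r • x) = shearExp x := by
  simp only [shearExp, PiLp.smul_apply, smul_eq_mul, norm_smul, mul_pow, Real.norm_eq_abs, sq_abs]
  rw [show r * x 0 * (r * x 1) = r ^ 2 * (x 0 * x 1) by ring,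
    mul_div_mul_left _ _ (pow_ne_zero 2 hr)]

lemma continuousOn_shearExp : ContinuousOn shearExp {0}ᶜ := by
  have h : ∀ x ∈ ({0}ᶜ : Set R3), ‖x‖ ^ 2 ≠ 0 := fun x hx =>
    pow_ne_zero 2 (norm_ne_zero_iff.2 hx)
  unfold shearExp
  fun_prop (disch := assumption)

/-- The homeomorphism stretching the ray through `x` by the factor `2 ^ (x₀ x₁ / ‖x‖²)`. -/
def shear : R3 ≃ₜ R3 :=
  have key (ε : ℝ) (hε : |ε| = 1) : ContinuousOn (fun x => (2:ℝ) ^ (ε * shearExp x) • x) {0}ᶜ ∧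
      ∀ x, ‖(2:ℝ) ^ (ε * shearExp x) • x‖ ≤ 2 * ‖x‖ := by
    refine ⟨?_, fun x => ?_⟩
    · exact ((Real.continuous_const_rpow two_ne_zero).comp_continuousOn
        (continuousOn_const.mul continuousOn_shearExp)).smul continuousOn_id
    · rw [norm_smul, Real.norm_of_nonneg (by positivity)]
      refine mul_le_mul_of_nonneg_right ?_ (norm_nonneg x)
      calc (2:ℝ) ^ (ε * shearExp x) ≤ 2 ^ (1:ℝ) := by
            refine Real.rpow_le_rpow_of_exponent_le one_le_two ((le_abs_self _).trans ?_)
            rw [abs_mul, hε, one_mul]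
            exact abs_shearExp_le x
        _ = 2 := Real.rpow_one 2
  have inv (ε : ℝ) (x : R3) : (2:ℝ) ^ (-ε * shearExp ((2:ℝ) ^ (ε * shearExp x) • x)) •
      (2:ℝ) ^ (ε * shearExp x) • x = x := by
    rw [shearExp_smul (by positivity), smul_smul, ← Real.rpow_add two_pos]
    simp
  homeomorphOfLinearGrowth (fun x => (2:ℝ) ^ (1 * shearExp x) • x)
    (fun x => (2:ℝ) ^ (-1 * shearExp x) • x) (key 1 (by simp)).1 (key (-1) (by simp)).1 2
    (key 1 (by simp)).2 (key (-1) (by simp)).2 (inv 1) (fun x => by simpa using inv (-1) x)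

lemma shear_apply (x : R3) : shear x = (2:ℝ) ^ shearExp x • x := by
  change (2:ℝ) ^ (1 * shearExp x) • x = _
  rw [one_mul]

lemma ray_eq_range (s : R3) : ray s = Set.range fun v : ℝ => (2:ℝ) ^ v • s := by
  ext x
  constructor
  · rintro ⟨t, ht, rfl⟩
    exact ⟨Real.logb 2 t, by simp only [Real.rpow_logb two_pos (by norm_num) ht]⟩
  · rintro ⟨v, rfl⟩
    exact ⟨2 ^ v, by positivity, rfl⟩

lemma norm_two_rpow_smul (v : ℝ) {s : R3} (hs : ‖s‖ = 1) : ‖(2:ℝ) ^ v • s‖ = 2 ^ v := by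
  rw [norm_smul, hs, mul_one, Real.norm_of_nonneg (by positivity)]

lemma logb_two_rpow (v : ℝ) : Real.logb 2 ((2:ℝ) ^ v) = v :=
  Real.logb_rpow two_pos (by norm_num)

lemma isTameFrame_one_image_ray (H : R3 ≃ₜ R3) (hH : H 0 = 0) {e : R3} (he : ‖e‖ = 1) :
    IsTameFrame 1 (H '' ray e ∪ {0}) := by
  refine ⟨fun _ => e, H, fun _ => he, Function.injective_of_subsingleton _, ?_⟩
  rw [Set.image_union, Set.image_singleton, hH, Set.iUnion_const]

lemma zero_notMem_image_ray (H : R3 ≃ₜ R3) (hH : H 0 = 0) {e : R3} (he : ‖e‖ = 1) :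
    (0 : R3) ∉ H '' ray e := by
  rintro ⟨x, ⟨t, ht, rfl⟩, h⟩
  rw [← hH, H.injective.eq_iff, smul_eq_zero] at h
  rcases h with h | h
  · exact ht.ne' h
  · simp [h] at he

lemma chartedSpace_image_ray (H : R3 ≃ₜ R3) {e : R3} (he : ‖e‖ = 1) :
    Nonempty (ChartedSpace (EuclideanSpace ℝ (Fin 1)) (H '' ray e)) := by
  have h0 : ∀ y : H '' ray e, ‖H.symm y.1‖ ≠ 0 := by
    rintro ⟨_, x, ⟨t, ht, rfl⟩, rfl⟩
    simp [norm_smul, he, ht.ne']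
  let φ : (H '' ray e) ≃ₜ ℝ :=
    { toFun := fun y => Real.logb 2 ‖H.symm y.1‖
      invFun := fun v => ⟨H ((2:ℝ) ^ v • e), _, ⟨2 ^ v, by positivity, rfl⟩, rfl⟩
      left_inv := by
        rintro ⟨_, x, hx, rfl⟩
        rw [ray_eq_range] at hx
        obtain ⟨v, rfl⟩ := hx
        simp [norm_two_rpow_smul v he]
      right_inv := fun v => by
        simp [norm_two_rpow_smul v he]
      continuous_toFun := by
        refine Continuous.logb ?_ h0
        exact continuous_norm.comp (H.symm.continuous.comp continuous_subtype_val)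
      continuous_invFun := by
        refine Continuous.subtype_mk (H.continuous.comp ?_) _
        exact (Real.continuous_const_rpow two_ne_zero).smul continuous_const }
  let ψ : ℝ ≃ₜ EuclideanSpace ℝ (Fin 1) :=
    (Homeomorph.funUnique (Fin 1) ℝ).symm.trans (EuclideanSpace.equiv (Fin 1) ℝ).symm.toHomeomorph
  exact ⟨(φ.trans ψ).toOpenPartialHomeomorph.singletonChartedSpace rfl⟩

/-! ### The two arcs -/

/-- The binary logarithm of the distance to the origin along the first arc. -/
def arcLog (v : ℝ) : ℝ := v + Real.sin (2 * π * v) / 2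

/-- The first arc, lying in the plane of the first two coordinates. -/
def arc₁ (v : ℝ) : R3 :=
  (2:ℝ) ^ arcLog v • !₂[Real.cos (π * (v + arcLog v)), Real.sin (π * (v + arcLog v)), 0]

/-- The height profile of the second arc. -/
def profile (t : ℝ) : ℝ := -(2 * Real.cos (2 * π * t) + 1) / 4

/-- The second arc, lying in the plane of the outer two coordinates. -/
def arc₂ (t : ℝ) : R3 := (2:ℝ) ^ t • !₂[-Real.sqrt (1 - profile t ^ 2), 0, profile t]

lemma profile_mem (t : ℝ) : -1 < profile t ∧ profile t < 1 := by
  have h1 := Real.neg_one_le_cos (2 * π * t)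
  have h2 := Real.cos_le_one (2 * π * t)
  unfold profile
  constructor <;> linarith

lemma continuous_profile : Continuous profile := by
  unfold profile
  fun_prop

lemma continuous_arcLog : Continuous arcLog := by
  unfold arcLog
  fun_prop

lemma exists_homeomorph_arc₁ : ∃ (H : R3 ≃ₜ R3) (e : R3), H 0 = 0 ∧ ‖e‖ = 1 ∧
    Set.range arc₁ = H '' ray e := by
  let G := twist rotZ continuous_rotZ norm_rotZ rotZ_neg_rotZ (fun t => π * t) (by fun_prop)
  have hG (x : R3) : G x = rotZ (π * Real.logb 2 ‖x‖) x := rfl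
  have hn (a : ℝ) : ‖(!₂[Real.cos a, Real.sin a, 0] : R3)‖ = 1 := by
    rw [← sq_eq_sq₀ (norm_nonneg _) zero_le_one, norm_sq_R3]
    simp
  have hrot (r a b : ℝ) : rotZ b (r • !₂[Real.cos a, Real.sin a, 0]) =
      r • !₂[Real.cos (a + b), Real.sin (a + b), 0] := by
    apply R3_ext <;>
      simp only [rotZ, PiLp.toLp_apply, Matrix.cons_val, PiLp.smul_apply, smul_eq_mul,
        Real.cos_add, Real.sin_add] <;> ring
  refine ⟨(G.trans shear).trans G, !₂[Real.cos 0, Real.sin 0, 0], ?_, hn 0, ?_⟩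
  · have : rotZ 0 0 = 0 := by apply R3_ext <;> simp [rotZ]
    simp [hG, shear_apply, this]
  · rw [ray_eq_range, ← Set.range_comp]
    congr 1
    ext1 v
    have h1 : G ((2:ℝ) ^ v • !₂[Real.cos 0, Real.sin 0, 0]) =
        (2:ℝ) ^ v • !₂[Real.cos (π * v), Real.sin (π * v), 0] := by
      rw [hG, hrot, norm_two_rpow_smul _ (hn 0), logb_two_rpow, zero_add]
    have h2 : shear ((2:ℝ) ^ v • !₂[Real.cos (π * v), Real.sin (π * v), 0]) =
        (2:ℝ) ^ arcLog v • !₂[Real.cos (π * v), Real.sin (π * v), 0] := by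
      rw [shear_apply, shearExp_smul (by positivity), smul_smul, ← Real.rpow_add two_pos]
      congr 2
      rw [shearExp, hn, arcLog, mul_assoc 2 π v, Real.sin_two_mul]
      simp only [Matrix.cons_val]
      ring
    simp only [Function.comp_apply, Homeomorph.trans_apply]
    rw [h1, h2, hG, hrot, norm_two_rpow_smul _ (hn _), logb_two_rpow, arc₁, mul_add]

lemma exists_homeomorph_arc₂ : ∃ (H : R3 ≃ₜ R3) (e : R3), H 0 = 0 ∧ ‖e‖ = 1 ∧
    Set.range arc₂ = H '' ray e := by
  have hn : ‖(!₂[-1, 0, 0] : R3)‖ = 1 := by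
    rw [← sq_eq_sq₀ (norm_nonneg _) zero_le_one, norm_sq_R3]
    simp
  let G := twist rotY continuous_rotY norm_rotY rotY_neg_rotY
    (fun t => Real.arcsin (profile t)) (Real.continuous_arcsin.comp continuous_profile)
  have hG (x : R3) : G x = rotY (Real.arcsin (profile (Real.logb 2 ‖x‖))) x := rfl
  refine ⟨G, !₂[-1, 0, 0], ?_, hn, ?_⟩
  · rw [hG]
    apply R3_ext <;> simp [rotY]
  · rw [ray_eq_range, ← Set.range_comp]
    congr 1
    ext1 t
    rw [Function.comp_apply, hG, norm_two_rpow_smul _ hn, logb_two_rpow]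
    apply R3_ext <;>
      simp [rotY, arc₂, Real.cos_arcsin, Real.sin_arcsin (profile_mem t).1.le (profile_mem t).2.le]
    all_goals ring

lemma norm_arc₁ (v : ℝ) : ‖arc₁ v‖ = 2 ^ arcLog v := by
  refine norm_two_rpow_smul _ ?_
  rw [← sq_eq_sq₀ (norm_nonneg _) zero_le_one, norm_sq_R3]
  simp

lemma norm_arc₂ (t : ℝ) : ‖arc₂ t‖ = 2 ^ t := by
  refine norm_two_rpow_smul _ ?_
  rw [← sq_eq_sq₀ (norm_nonneg _) zero_le_one, norm_sq_R3]
  have : 0 ≤ 1 - profile t ^ 2 := by nlinarith [profile_mem t]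
  simp [Real.sq_sqrt this]

lemma arcLog_add_one (v : ℝ) : arcLog (v + 1) = arcLog v + 1 := by
  rw [arcLog, arcLog, mul_add, mul_one, Real.sin_add_two_pi]
  ring

lemma arc₁_add_one (v : ℝ) : arc₁ (v + 1) = (2:ℝ) • arc₁ v := by
  rw [arc₁, arc₁, arcLog_add_one, Real.rpow_add_one two_ne_zero, mul_comm, mul_smul,
    show π * (v + 1 + (arcLog v + 1)) = π * (v + arcLog v) + 2 * π by ring,
    Real.cos_add_two_pi, Real.sin_add_two_pi]

lemma profile_add_one (t : ℝ) : profile (t + 1) = profile t := by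
  rw [profile, profile, mul_add, mul_one, Real.cos_add_two_pi]

lemma arc₂_add_one (t : ℝ) : arc₂ (t + 1) = (2:ℝ) • arc₂ t := by
  rw [arc₂, arc₂, profile_add_one, Real.rpow_add_one two_ne_zero, mul_comm, mul_smul]

lemma image_A3_range {f : ℝ → R3} (h : ∀ v, f (v + 1) = (2:ℝ) • f v) :
    A3 '' Set.range f = Set.range f := by
  ext x
  constructor
  · rintro ⟨_, ⟨v, rfl⟩, rfl⟩
    exact ⟨v + 1, h v⟩
  · rintro ⟨v, rfl⟩
    refine ⟨f (v - 1), ⟨v - 1, rfl⟩, ?_⟩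
    rw [A3, ← h, sub_add_cancel]

lemma arcLog_surjective : Function.Surjective arcLog := by
  intro t
  have h (v : ℝ) : v - 1 ≤ arcLog v ∧ arcLog v ≤ v + 1 := by
    have h1 := Real.neg_one_le_sin (2 * π * v)
    have h2 := Real.sin_le_one (2 * π * v)
    unfold arcLog
    constructor <;> linarith
  have := intermediate_value_Icc (show t - 1 ≤ t + 1 by linarith) continuous_arcLog.continuousOn
  obtain ⟨v, -, hv⟩ := this (show t ∈ Set.Icc _ _ from
    ⟨by linarith [(h (t - 1)).2], by linarith [(h (t + 1)).1]⟩)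
  exact ⟨v, hv⟩

lemma arcLog_eq_zero {v : ℝ} (h : arcLog v = 0) : v = 0 := by
  unfold arcLog at h
  have h1 := Real.neg_one_le_sin (2 * π * v)
  have h2 := Real.sin_le_one (2 * π * v)
  have hπ := Real.pi_pos
  by_contra hv
  rcases lt_or_gt_of_ne hv with hv | hv
  · have := Real.sin_nonpos_of_nonpos_of_neg_pi_le (x := 2 * π * v) (by nlinarith) (by nlinarith)
    linarith
  · have := Real.sin_nonneg_of_nonneg_of_le_pi (x := 2 * π * v) (by nlinarith) (by nlinarith)
    linarith

lemma disjoint_arcs : Disjoint (Set.range arc₁) (Set.range arc₂) := by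
  rw [Set.disjoint_left]
  rintro _ ⟨v, rfl⟩ ⟨t, h⟩
  have ht : t = arcLog v := by
    have := congrArg (fun x : R3 => Real.logb 2 ‖x‖) h
    simpa only [norm_arc₁, norm_arc₂, logb_two_rpow] using this
  rw [arc₁, arc₂, ← ht] at h
  have h := (smul_right_injective R3 (show (2:ℝ) ^ t ≠ 0 by positivity)) h
  have h0 : -Real.sqrt (1 - profile t ^ 2) = Real.cos (π * (v + t)) := by
    simpa using congrArg (fun x : R3 => x 0) h
  have h2 : profile t = 0 := by simpa using congrArg (fun x : R3 => x 2) h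
  rw [h2] at h0
  obtain ⟨k, hk⟩ := Real.cos_eq_neg_one_iff.1 (show Real.cos (π * (v + t)) = -1 by simp [← h0])
  have hv : v = 1 + 2 * k - t := by
    have := Real.pi_pos
    have : π * (v + t) = π * (1 + 2 * k) := by linarith
    have := mul_left_cancel₀ Real.pi_ne_zero this
    linarith
  set S := Real.sin (2 * π * t) with hS
  have hs : Real.sin (2 * π * v) = -S := by
    rw [hv, show 2 * π * (1 + 2 * k - t) = -(2 * π * t) + ((1 + 2 * k : ℤ) : ℝ) * (2 * π) by
      push_cast; ring, Real.sin_add_int_mul_two_pi, Real.sin_neg]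
  have ht' : 2 * π * t = -(π * S / 2) + π + k * (2 * π) := by
    have : 2 * t = 1 + 2 * k - S / 2 := by
      rw [arcLog, hs] at ht
      linarith
    rw [show 2 * π * t = π * (2 * t) by ring, this]
    ring
  have hc : Real.cos (2 * π * t) = -1 / 2 := by
    unfold profile at h2
    linarith
  have hc' : Real.cos |π * S / 2| = Real.cos (π / 3) := by
    rw [ht', Real.cos_add_int_mul_two_pi, Real.cos_add_pi, Real.cos_neg] at hc
    rw [Real.cos_abs, Real.cos_pi_div_three]
    linarith
  have hS1 : |S| ≤ 1 := Real.abs_sin_le_one _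
  have hπ := Real.pi_pos
  have habs : |π * S / 2| = π / 2 * |S| := by
    rw [mul_div_right_comm, abs_mul, abs_of_pos (by positivity)]
  have := Real.injOn_cos ⟨abs_nonneg _, by rw [habs]; nlinarith⟩
    ⟨by positivity, by linarith⟩ hc'
  rw [habs] at this
  have h3 : |S| = 2 / 3 := by
    have h4 : π * |S| = π * (2 / 3) := by linarith
    exact mul_left_cancel₀ hπ.ne' h4
  have h5 := Real.sin_sq_add_cos_sq (2 * π * t)
  rw [hc, ← hS, ← sq_abs, h3] at h5
  norm_num at h5

/-- The two arcs of the wild frame. -/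
def arcs : Fin 2 → Set R3 := ![Set.range arc₁, Set.range arc₂]

lemma exists_homeomorph_arcs (j : Fin 2) : ∃ (H : R3 ≃ₜ R3) (e : R3), H 0 = 0 ∧ ‖e‖ = 1 ∧
    arcs j = H '' ray e := by
  fin_cases j
  exacts [exists_homeomorph_arc₁, exists_homeomorph_arc₂]

lemma isInfiniteArc_arcs (j : Fin 2) : IsInfiniteArc (arcs j) := by
  obtain ⟨H, e, hH, he, h⟩ := exists_homeomorph_arcs j
  refine ⟨h ▸ zero_notMem_image_ray H hH he, h ▸ chartedSpace_image_ray H he, ?_⟩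
  rw [Set.eq_univ_iff_forall]
  intro t
  fin_cases j
  · obtain ⟨v, rfl⟩ := arcLog_surjective t
    exact ⟨arc₁ v, ⟨v, rfl⟩, by simp only [norm_arc₁, logb_two_rpow]⟩
  · exact ⟨arc₂ t, ⟨t, rfl⟩, by simp only [norm_arc₂, logb_two_rpow]⟩

lemma isTameFrame_arcs (j : Fin 2) : IsTameFrame 1 (arcs j ∪ {0}) := by
  obtain ⟨H, e, hH, he, h⟩ := exists_homeomorph_arcs j
  exact h ▸ isTameFrame_one_image_ray H hH he

lemma isArcFrame_arcs : IsArcFrame arcs := by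
  refine ⟨isInfiniteArc_arcs, ?_, fun j => ?_⟩
  · intro i j hij
    fin_cases i <;> fin_cases j
    · exact absurd rfl hij
    · exact disjoint_arcs
    · exact disjoint_arcs.symm
    · exact absurd rfl hij
  · fin_cases j
    exacts [image_A3_range arc₁_add_one, image_A3_range arc₂_add_one]

lemma isSingletonSet_sphere_inter_arcs (j : Fin 2) :
    IsSingletonSet (Metric.sphere (0:R3) 1 ∩ arcs j) := by
  have key (f : ℝ → R3) (g : ℝ → ℝ) (hf : ∀ v, ‖f v‖ = 2 ^ g v) (h0 : g 0 = 0)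
      (hg : ∀ v, g v = 0 → v = 0) : IsSingletonSet (Metric.sphere (0:R3) 1 ∩ Set.range f) := by
    refine ⟨f 0, Set.Subset.antisymm ?_ ?_⟩
    · rintro _ ⟨hx, v, rfl⟩
      rw [mem_sphere_zero_iff_norm, hf] at hx
      have := congrArg (Real.logb 2) hx
      rw [logb_two_rpow, Real.logb_one] at this
      rw [hg v this]
      rfl
    · rintro _ rfl
      exact ⟨by simp [hf, h0], 0, rfl⟩
  fin_cases j
  · exact key arc₁ arcLog norm_arc₁ (by simp [arcLog]) fun v => arcLog_eq_zero
  · exact key arc₂ id norm_arc₂ rfl fun v => id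

/-! ### Labels attached to the regions cut out by the first arc in its plane -/

/-- The permutation `x ↦ u x + b` of `ℤ/3`. -/
def affPerm (u : ℤˣ) (b : ZMod 3) : Equiv.Perm (ZMod 3) where
  toFun x := ((u : ℤ) : ZMod 3) * x + b
  invFun x := ((u : ℤ) : ZMod 3) * (x - b)
  left_inv := by
    revert b
    rcases Int.units_eq_one_or u with rfl | rfl <;> simp [Function.LeftInverse]
  right_inv := by
    revert b
    rcases Int.units_eq_one_or u with rfl | rfl <;>
      simp [Function.LeftInverse, Function.RightInverse]

/-- A function which is even exactly along the first arc, in polar coordinates. -/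
def phase (θ t : ℝ) : ℝ := 2 * t - θ / π - Real.sin (2 * θ - 2 * π * t) / 2

/-- The index of the level strip of `phase` containing the given point. -/
def strip (θ t : ℝ) : ℤ := ⌊phase θ t / 2⌋

/-- The correction distinguishing the parts of a strip at the ends of the angular range. -/
def stripOffset (θ t : ℝ) : ZMod 3 :=
  if 1 / 2 < θ / π - t + strip θ t then 1 else if θ / π - t + strip θ t < -3 / 2 then 2 else 0

/-- The permutation attached to crossing the plane of the first arc. -/
def label (θ t : ℝ) : Equiv.Perm (ZMod 3) :=
  affPerm (strip θ t).negOnePow (strip θ t - 1 + stripOffset θ t)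

lemma phase_sub (θ t : ℝ) (m : ℤ) :
    phase θ t - 2 * m = (t - m) - (θ / π - t + m) -
      Real.sin (2 * π * (θ / π - t + m)) / 2 := by
  have : 2 * π * (θ / π - t + m) = 2 * θ - 2 * π * t + m * (2 * π) := by
    have := Real.pi_ne_zero
    field_simp
  rw [this, Real.sin_add_int_mul_two_pi, phase]
  ring

lemma continuous_phase : Continuous fun p : ℝ × ℝ => phase p.1 p.2 := by
  unfold phase
  fun_prop

lemma label_eventually_eq {θ t : ℝ} (hθ : |θ| ≤ π) (h : ∀ k : ℤ, phase θ t ≠ 2 * k) :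
    ∀ᶠ p : ℝ × ℝ in 𝓝 (θ, t), label p.1 p.2 = label θ t := by
  set m := strip θ t with hm
  have hπ := Real.pi_pos
  have hlo : 2 * (m : ℝ) < phase θ t :=
    lt_of_le_of_ne (by have := Int.floor_le (phase θ t / 2); rw [hm, strip]; linarith)
      (Ne.symm (h m))
  have hhi : phase θ t < 2 * (m + 1) := by
    have := Int.lt_floor_add_one (phase θ t / 2)
    rw [hm, strip]
    linarith
  have hc : Continuous fun p : ℝ × ℝ => p.1 / π - p.2 + (m : ℝ) := by fun_prop
  have hs : ∀ᶠ p : ℝ × ℝ in 𝓝 (θ, t), strip p.1 p.2 = m := by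
    filter_upwards [continuousAt_const.eventually_lt continuous_phase.continuousAt hlo,
      continuous_phase.continuousAt.eventually_lt continuousAt_const hhi] with p h1 h2
    rw [strip, Int.floor_eq_iff]
    constructor <;> linarith
  have hθ' : -1 ≤ θ / π ∧ θ / π ≤ 1 := by
    rw [abs_le] at hθ
    rw [le_div_iff₀ hπ, div_le_iff₀ hπ]
    constructor <;> linarith
  have hsub := phase_sub θ t m
  have h1 : θ / π - t + m ≠ 1 / 2 := by
    intro h1
    rw [h1, show 2 * π * (1 / 2) = π by ring, Real.sin_pi] at hsub
    linarith
  have h2 : θ / π - t + m ≠ -3 / 2 := by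
    intro h1
    rw [h1, show 2 * π * (-3 / 2) = -π + (-1 : ℤ) * (2 * π) by push_cast; ring,
      Real.sin_add_int_mul_two_pi, Real.sin_neg, Real.sin_pi] at hsub
    linarith
  have hsign (a : ℝ) (ha : θ / π - t + m ≠ a) : ∀ᶠ p : ℝ × ℝ in 𝓝 (θ, t),
      (p.1 / π - p.2 + m < a ↔ θ / π - t + m < a) ∧
      (a < p.1 / π - p.2 + m ↔ a < θ / π - t + m) := by
    rcases lt_or_gt_of_ne ha with ha | ha
    · filter_upwards [hc.continuousAt.eventually_lt continuousAt_const ha] with p hp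
      exact ⟨iff_of_true hp ha, iff_of_false hp.le.not_gt ha.le.not_gt⟩
    · filter_upwards [continuousAt_const.eventually_lt hc.continuousAt ha] with p hp
      exact ⟨iff_of_false hp.le.not_gt ha.le.not_gt, iff_of_true hp ha⟩
  filter_upwards [hs, hsign _ h1, hsign _ h2] with p hp h1 h2
  simp only [label, stripOffset, hp, ← hm, h1.2, h2.1]

lemma label_zero_add_half (n : ℤ) : label 0 (n + 1 / 2) = affPerm n.negOnePow (n - 1) := by
  have hph : phase 0 (n + 1 / 2) = 2 * n + 1 := by
    rw [phase, show 2 * (0:ℝ) - 2 * π * (n + 1 / 2) = -π + (-n : ℤ) * (2 * π) by push_cast; ring,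
      Real.sin_add_int_mul_two_pi, Real.sin_neg, Real.sin_pi]
    ring
  have hs : strip 0 (n + 1 / 2) = n := by
    rw [strip, hph, Int.floor_eq_iff]
    constructor <;> linarith
  rw [label, stripOffset, hs, if_neg (by norm_num), if_neg (by norm_num), add_zero]

/-- The permutation attached to crossing the half-plane of the second arc above the arc's
crossing with the plane of the first arc. -/
def upperTwist : Equiv.Perm (ZMod 3) := affPerm (-1) 0

/-- The permutation attached to crossing the half-plane of the second arc below the arc's
crossing with the plane of the first arc. -/
def lowerTwist (t : ℝ) : Equiv.Perm (ZMod 3) := affPerm (-1) (2 * (⌊t + 1 / 2⌋ : ℤ))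

lemma lowerTwist_eventually_eq {t : ℝ} (h : profile t < 0) :
    ∀ᶠ t' in 𝓝 t, lowerTwist t' = lowerTwist t := by
  have hπ := Real.pi_pos
  set n := ⌊t + 1 / 2⌋ with hn
  have h1 : (n : ℝ) ≤ t + 1 / 2 := Int.floor_le _
  have h2 : t + 1 / 2 < n + 1 := Int.lt_floor_add_one _
  have hne : t + 1 / 2 ≠ n := by
    intro h3
    rw [profile, show 2 * π * t = -π + n * (2 * π) by rw [← h3]; ring,
      Real.cos_add_int_mul_two_pi, Real.cos_neg, Real.cos_pi] at h
    norm_num at h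
  have h1 := lt_of_le_of_ne h1 (Ne.symm hne)
  filter_upwards [eventually_gt_nhds (show (n : ℝ) - 1 / 2 < t by linarith),
    eventually_lt_nhds (show t < (n : ℝ) + 1 / 2 by linarith)] with t' h3 h4
  have : ⌊t' + 1 / 2⌋ = n := by
    rw [Int.floor_eq_iff]
    constructor <;> linarith
  rw [lowerTwist, lowerTwist, this]

lemma label_relation {t : ℝ} (hq : profile t ≠ 0) (hp : ∀ k : ℤ, phase π t ≠ 2 * k) :
    label (-π) t * (if 0 < profile t then upperTwist else 1) =
      (if profile t < 0 then lowerTwist t else 1) * label π t := by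
  have hπ := Real.pi_pos
  set n := ⌊t + 1 / 2⌋ with hn
  obtain ⟨τ, hτ⟩ : ∃ τ, t = n + τ := ⟨t - n, by ring⟩
  have hlo : -1 / 2 ≤ τ := by
    have := Int.floor_le (t + 1 / 2)
    rw [← hn] at this
    linarith
  have hhi : τ < 1 / 2 := by
    have := Int.lt_floor_add_one (t + 1 / 2)
    rw [← hn] at this
    linarith
  have hup : phase π t = 2 * n + (2 * τ - 1 + Real.sin (2 * π * τ) / 2) := by
    rw [phase, hτ, show 2 * π - 2 * π * (n + τ) = -(2 * π * τ) + ((1 - n : ℤ) : ℝ) * (2 * π) by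
      push_cast; ring, Real.sin_add_int_mul_two_pi, Real.sin_neg, div_self hπ.ne']
    ring
  have hlow : phase (-π) t = phase π t + 2 := by
    rw [phase, phase, show 2 * -π - 2 * π * t = 2 * π - 2 * π * t + (-2 : ℤ) * (2 * π) by
      push_cast; ring, Real.sin_add_int_mul_two_pi, neg_div, div_self hπ.ne']
    ring
  have hstrip : strip (-π) t = strip π t + 1 := by
    rw [strip, strip, hlow, ← Int.floor_add_one]
    congr 1
    ring
  have hone : -π / π = -1 := by rw [neg_div, div_self hπ.ne']
  have hsin1 := Real.neg_one_le_sin (2 * π * τ)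
  have hsin2 := Real.sin_le_one (2 * π * τ)
  rcases lt_or_ge τ (-1 / 4) with h1 | h1
  · have hne : τ ≠ -1 / 2 := by
      intro h
      refine hp (n - 1) ?_
      rw [hup, h, show 2 * π * (-1 / 2) = -π by ring, Real.sin_neg, Real.sin_pi]
      push_cast
      ring
    have hlo := lt_of_le_of_ne hlo (Ne.symm hne)
    have hj := Real.mul_lt_sin (x := 2 * π * (τ + 1 / 2)) (by nlinarith) (by nlinarith)
    rw [show 2 / π * (2 * π * (τ + 1 / 2)) = 4 * (τ + 1 / 2) by field_simp; ring,
      show 2 * π * (τ + 1 / 2) = 2 * π * τ + π by ring, Real.sin_add_pi] at hj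
    have hm : strip π t = n - 2 := by
      rw [strip, hup, Int.floor_eq_iff]
      push_cast
      constructor <;> linarith
    have l1 : label π t = affPerm (n - 2).negOnePow (n - 3) := by
      rw [label, stripOffset, hm, div_self hπ.ne', hτ, if_neg (by push_cast; linarith),
        if_neg (by push_cast; linarith)]
      congr 1; push_cast; ring
    have l2 : label (-π) t = affPerm (n - 1).negOnePow n := by
      rw [label, stripOffset, hstrip, hm, hone, hτ, if_neg (by push_cast; linarith),
        if_pos (by push_cast; linarith)]
      congr 1
      · congr 1; ring
      · push_cast; ring
    rw [l1, l2, Int.negOnePow_sub, Int.negOnePow_sub]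
    rcases lt_or_gt_of_ne hq with hq | hq
    · rw [if_neg hq.not_gt, if_pos hq, lowerTwist, ← hn]
      generalize ((n : ℤ) : ZMod 3) = a
      generalize n.negOnePow = u
      ext x
      rcases Int.units_eq_one_or u with rfl | rfl <;> revert a x <;> decide
    · rw [if_pos hq, if_neg hq.not_gt, upperTwist]
      generalize ((n : ℤ) : ZMod 3) = a
      generalize n.negOnePow = u
      ext x
      rcases Int.units_eq_one_or u with rfl | rfl <;> revert a x <;> decide
  rcases lt_or_ge τ (1 / 4) with h2 | h2
  · have hq : profile t < 0 := by
      have : 0 ≤ Real.cos (2 * π * t) := by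
        rw [hτ, show 2 * π * (n + τ) = 2 * π * τ + n * (2 * π) by ring,
          Real.cos_add_int_mul_two_pi]
        exact Real.cos_nonneg_of_neg_pi_div_two_le_of_le (by nlinarith) (by nlinarith)
      unfold profile
      linarith
    have hm : strip π t = n - 1 := by
      rw [strip, hup, Int.floor_eq_iff]
      push_cast
      constructor
      · rcases le_or_gt 0 τ with h | h
        · linarith
        · linarith
      · linarith
    have l1 : label π t = affPerm (n - 1).negOnePow (n - 2) := by
      rw [label, stripOffset, hm, div_self hπ.ne', hτ, if_neg (by push_cast; linarith),
        if_neg (by push_cast; linarith)]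
      congr 1; push_cast; ring
    have l2 : label (-π) t = affPerm n.negOnePow (n - 1) := by
      rw [label, stripOffset, hstrip, hm, hone, hτ, if_neg (by push_cast; linarith),
        if_neg (by push_cast; linarith)]
      congr 1
      · congr 1; ring
      · push_cast; ring
    rw [l1, l2, Int.negOnePow_sub, if_neg hq.not_gt, if_pos hq, lowerTwist, ← hn]
    generalize ((n : ℤ) : ZMod 3) = a
    generalize n.negOnePow = u
    ext x
    rcases Int.units_eq_one_or u with rfl | rfl <;> revert a x <;> decide
  · have hj := Real.mul_le_sin (x := 2 * π * (1 / 2 - τ)) (by nlinarith) (by nlinarith)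
    rw [show 2 / π * (2 * π * (1 / 2 - τ)) = 4 * (1 / 2 - τ) by field_simp; ring,
      show 2 * π * (1 / 2 - τ) = π - 2 * π * τ by ring, Real.sin_pi_sub] at hj
    have hm : strip π t = n := by
      rw [strip, hup, Int.floor_eq_iff]
      constructor <;> linarith
    have l1 : label π t = affPerm n.negOnePow n := by
      rw [label, stripOffset, hm, div_self hπ.ne', hτ, if_pos (by linarith)]
      congr 1; ring
    have l2 : label (-π) t = affPerm (n + 1).negOnePow n := by
      rw [label, stripOffset, hstrip, hm, hone, hτ, if_neg (by push_cast; linarith),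
        if_neg (by push_cast; linarith)]
      congr 1
      push_cast; ring
    rw [l1, l2, Int.negOnePow_succ]
    rcases lt_or_gt_of_ne hq with hq | hq
    · rw [if_neg hq.not_gt, if_pos hq, lowerTwist, ← hn]
      generalize ((n : ℤ) : ZMod 3) = a
      generalize n.negOnePow = u
      ext x
      rcases Int.units_eq_one_or u with rfl | rfl <;> revert a x <;> decide
    · rw [if_pos hq, if_neg hq.not_gt, upperTwist]
      generalize ((n : ℤ) : ZMod 3) = a
      generalize n.negOnePow = u
      ext x
      rcases Int.units_eq_one_or u with rfl | rfl <;> revert a x <;> decide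

/-! ### A covering of the complement of the two arcs -/

/-- The complement of the frame consisting of the two arcs. -/
abbrev ArcsCompl : Type := ↥(((⋃ j, arcs j) ∪ {0})ᶜ : Set R3)

/-- The angle between `x` and the first coordinate axis. -/
def axisAngle (x : R3) : ℝ := Real.arccos (x 0 / ‖x‖)

/-- The binary logarithm of the distance to the origin. -/
def logNorm (x : R3) : ℝ := Real.logb 2 ‖x‖

lemma eq_rpow_logNorm_smul {x : R3} (hx : x ≠ 0) {a b c : ℝ} (ha : x 0 / ‖x‖ = a)
    (hb : x 1 / ‖x‖ = b) (hc : x 2 / ‖x‖ = c) : x = (2:ℝ) ^ logNorm x • !₂[a, b, c] := by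
  have hx' := norm_pos_iff.2 hx
  rw [logNorm, Real.rpow_logb two_pos (by norm_num) hx']
  subst ha hb hc
  apply R3_ext <;> simp [mul_div_cancel₀ _ hx'.ne']

lemma arc₁_eq_of_phase {θ t : ℝ} {k : ℤ} (h : phase θ t = 2 * k) :
    arc₁ (θ / π - t + 2 * k) = (2:ℝ) ^ t • !₂[Real.cos θ, Real.sin θ, 0] := by
  have hs := phase_sub θ t k
  have hlog : arcLog (θ / π - t + 2 * k) = t := by
    rw [arcLog, show 2 * π * (θ / π - t + 2 * k) = 2 * π * (θ / π - t + k) + k * (2 * π) by ring,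
      Real.sin_add_int_mul_two_pi]
    linarith
  have hang : π * (θ / π - t + 2 * k + t) = θ + k * (2 * π) := by
    have := Real.pi_ne_zero
    field_simp
    ring
  rw [arc₁, hlog, hang, Real.cos_add_int_mul_two_pi, Real.sin_add_int_mul_two_pi]

lemma div_norm_sq_add {x : R3} (hx : x ≠ 0) :
    (x 0 / ‖x‖) ^ 2 + (x 1 / ‖x‖) ^ 2 + (x 2 / ‖x‖) ^ 2 = 1 := by
  have hx' := norm_pos_iff.2 hx
  rw [div_pow, div_pow, div_pow, ← add_div, ← add_div, ← norm_sq_R3]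
  exact div_self (by positivity)

lemma cos_axisAngle {x : R3} (hx : x ≠ 0) : Real.cos (axisAngle x) = x 0 / ‖x‖ := by
  have h := div_norm_sq_add hx
  refine Real.cos_arccos ?_ ?_ <;> nlinarith [sq_nonneg (x 1 / ‖x‖), sq_nonneg (x 2 / ‖x‖)]

lemma sin_axisAngle {x : R3} (hx : x ≠ 0) (hz : x 2 = 0) :
    Real.sin (axisAngle x) = |x 1 / ‖x‖| := by
  have h := div_norm_sq_add hx
  rw [hz, zero_div] at h
  rw [axisAngle, Real.sin_arccos, ← Real.sqrt_sq_eq_abs]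
  congr 1
  linarith

lemma abs_axisAngle_le (x : R3) : |axisAngle x| ≤ π := by
  rw [axisAngle, abs_of_nonneg (Real.arccos_nonneg _)]
  exact Real.arccos_le_pi _

namespace ArcsCompl

variable (x : ArcsCompl)

lemma ne_zero : x.1 ≠ 0 := fun h => x.2 (Or.inr h)

lemma norm_pos : 0 < ‖x.1‖ := norm_pos_iff.2 x.ne_zero

lemma notMem_arc₁ : x.1 ∉ Set.range arc₁ := fun h => x.2 (Or.inl (Set.mem_iUnion.2 ⟨0, h⟩))

lemma notMem_arc₂ : x.1 ∉ Set.range arc₂ := fun h => x.2 (Or.inl (Set.mem_iUnion.2 ⟨1, h⟩))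

lemma continuous_axisAngle : Continuous fun x : ArcsCompl => axisAngle x.1 := by
  have h (x : ArcsCompl) : ‖x.1‖ ≠ 0 := x.norm_pos.ne'
  unfold axisAngle
  fun_prop (disch := assumption)

lemma continuous_logNorm : Continuous fun x : ArcsCompl => logNorm x.1 :=
  (continuous_norm.comp continuous_subtype_val).logb fun x : ArcsCompl => x.norm_pos.ne'

lemma continuous_height : Continuous fun x : ArcsCompl => x.1 2 / ‖x.1‖ := by
  have h (x : ArcsCompl) : ‖x.1‖ ≠ 0 := x.norm_pos.ne'
  fun_prop (disch := assumption)

lemma continuous_profile_logNorm : Continuous fun x : ArcsCompl => profile (logNorm x.1) :=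
  continuous_profile.comp continuous_logNorm

lemma phase_axisAngle_ne (hz : x.1 2 = 0) (hy : 0 ≤ x.1 1) (k : ℤ) :
    phase (axisAngle x.1) (logNorm x.1) ≠ 2 * k := fun h => by
  refine x.notMem_arc₁ ⟨_, (arc₁_eq_of_phase h).trans (Eq.symm ?_)⟩
  refine eq_rpow_logNorm_smul x.ne_zero (cos_axisAngle x.ne_zero).symm ?_ (by rw [hz, zero_div])
  rw [sin_axisAngle x.ne_zero hz, abs_of_nonneg (div_nonneg hy (norm_nonneg _))]

lemma phase_neg_axisAngle_ne (hz : x.1 2 = 0) (hy : x.1 1 ≤ 0) (k : ℤ) :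
    phase (-axisAngle x.1) (logNorm x.1) ≠ 2 * k := fun h => by
  refine x.notMem_arc₁ ⟨_, (arc₁_eq_of_phase h).trans (Eq.symm ?_)⟩
  rw [Real.cos_neg, Real.sin_neg]
  refine eq_rpow_logNorm_smul x.ne_zero (cos_axisAngle x.ne_zero).symm ?_ (by rw [hz, zero_div])
  rw [sin_axisAngle x.ne_zero hz, abs_of_nonpos (div_nonpos_of_nonpos_of_nonneg hy (norm_nonneg _)),
    neg_neg]

lemma height_ne_profile (hy : x.1 1 = 0) (hx : x.1 0 ≤ 0) :
    x.1 2 / ‖x.1‖ ≠ profile (logNorm x.1) := fun h => by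
  refine x.notMem_arc₂ ⟨logNorm x.1, (eq_rpow_logNorm_smul x.ne_zero ?_ ?_ h).symm⟩
  · have h1 := div_norm_sq_add x.ne_zero
    rw [hy, zero_div, h] at h1
    rw [show 1 - profile (logNorm x.1) ^ 2 = (x.1 0 / ‖x.1‖) ^ 2 by linarith,
      Real.sqrt_sq_eq_abs, abs_of_nonpos (div_nonpos_of_nonpos_of_nonneg hx (norm_nonneg _)),
      neg_neg]
  · rw [hy, zero_div]

/-- On the plane of the second arc, off its half-plane, the height is extremal. -/
lemma sq_height_eq_one (hy : x.1 1 = 0) (hx : x.1 0 = 0) : (x.1 2 / ‖x.1‖) ^ 2 = 1 := by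
  have h1 := div_norm_sq_add x.ne_zero
  rw [hy, hx, zero_div] at h1
  linarith

end ArcsCompl

open Classical in
/-- The gluing permutations of a covering of `ArcsCompl` with fibre `ℤ/3`. -/
def arcsGluing : CrossGluing ArcsCompl (ZMod 3) where
  y x := x.1 1
  z x := x.1 2
  up x := label (axisAngle x.1) (logNorm x.1)
  low x := label (-axisAngle x.1) (logNorm x.1)
  c x := if x.1 0 < 0 ∧ x.1 2 / ‖x.1‖ < profile (logNorm x.1) then upperTwist else 1
  s x := if x.1 0 < 0 ∧ profile (logNorm x.1) < x.1 2 / ‖x.1‖ then lowerTwist (logNorm x.1) else 1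
  continuous_y := by fun_prop
  continuous_z := by fun_prop
  up_eventually x hz hy := by
    have h := ArcsCompl.continuous_axisAngle.prodMk ArcsCompl.continuous_logNorm
    filter_upwards [(h.tendsto x).eventually
      (label_eventually_eq (abs_axisAngle_le x.1) (x.phase_axisAngle_ne hz hy))] with w hw _ _
    exact hw
  low_eventually x hz hy := by
    have h : Continuous fun w : ArcsCompl => (-axisAngle w.1, logNorm w.1) :=
      ArcsCompl.continuous_axisAngle.neg.prodMk ArcsCompl.continuous_logNorm
    filter_upwards [(h.tendsto x).eventually
      (label_eventually_eq (by rw [abs_neg]; exact abs_axisAngle_le x.1)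
        (x.phase_neg_axisAngle_ne hz hy))] with w hw _ _
    exact hw
  c_eventually x hy hz := by
    have hx0 : Continuous fun w : ArcsCompl => w.1 0 := by fun_prop
    have hh := ArcsCompl.continuous_height
    have hp := ArcsCompl.continuous_profile_logNorm
    by_cases hx : 0 < x.1 0
    · filter_upwards [continuousAt_const.eventually_lt hx0.continuousAt hx] with w hw _ _
      rw [if_neg fun h => hw.not_gt h.1, if_neg fun h => hx.not_gt h.1]
    rcases lt_or_gt_of_ne (x.height_ne_profile hy (not_lt.1 hx)) with h | h
    · have hx' : x.1 0 < 0 := by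
        refine lt_of_le_of_ne (not_lt.1 hx) fun h0 => ?_
        have h1 := x.sq_height_eq_one hy h0
        have h2 : 0 ≤ x.1 2 / ‖x.1‖ := div_nonneg hz (norm_nonneg _)
        nlinarith [(profile_mem (logNorm x.1)).2]
      filter_upwards [hx0.continuousAt.eventually_lt continuousAt_const hx',
        hh.continuousAt.eventually_lt hp.continuousAt h] with w h1 h2 _ _
      rw [if_pos ⟨h1, h2⟩, if_pos ⟨hx', h⟩]
    · filter_upwards [hp.continuousAt.eventually_lt hh.continuousAt h] with w h2 _ _
      rw [if_neg fun h' => h2.not_gt h'.2, if_neg fun h' => h.not_gt h'.2]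
  s_eventually x hy hz := by
    have hx0 : Continuous fun w : ArcsCompl => w.1 0 := by fun_prop
    have hh := ArcsCompl.continuous_height
    have hp := ArcsCompl.continuous_profile_logNorm
    by_cases hx : 0 < x.1 0
    · filter_upwards [continuousAt_const.eventually_lt hx0.continuousAt hx] with w hw _ _
      rw [if_neg fun h => hw.not_gt h.1, if_neg fun h => hx.not_gt h.1]
    have hz' : x.1 2 / ‖x.1‖ ≤ 0 := div_nonpos_of_nonpos_of_nonneg hz (norm_nonneg _)
    rcases lt_or_gt_of_ne (x.height_ne_profile hy (not_lt.1 hx)) with h | h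
    · filter_upwards [hh.continuousAt.eventually_lt hp.continuousAt h] with w h2 _ _
      rw [if_neg fun h' => h2.not_gt h'.2, if_neg fun h' => h.not_gt h'.2]
    · have hx' : x.1 0 < 0 := by
        refine lt_of_le_of_ne (not_lt.1 hx) fun h0 => ?_
        have h1 := x.sq_height_eq_one hy h0
        nlinarith [(profile_mem (logNorm x.1)).1]
      filter_upwards [hx0.continuousAt.eventually_lt continuousAt_const hx',
        hp.continuousAt.eventually_lt hh.continuousAt h,
        (ArcsCompl.continuous_logNorm.tendsto x).eventually
          (lowerTwist_eventually_eq (h.trans_le hz'))] with w h1 h2 h3 _ _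
      rw [if_pos ⟨h1, h2⟩, if_pos ⟨hx', h⟩, h3]
  relation x hy hz := by
    rcases lt_or_ge (x.1 0) 0 with hx | hx
    · have hang : axisAngle x.1 = π := by
        have h1 := div_norm_sq_add x.ne_zero
        rw [hy, hz, zero_div] at h1
        have h2 : x.1 0 / ‖x.1‖ < 0 := div_neg_of_neg_of_pos hx x.norm_pos
        rw [axisAngle, show x.1 0 / ‖x.1‖ = -1 by nlinarith, Real.arccos_neg_one]
      have h1 := x.height_ne_profile hy hx.le
      have h2 := x.phase_axisAngle_ne hz hy.ge
      rw [hz, zero_div] at h1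
      rw [hang] at h2 ⊢
      simp only [hx, hz, zero_div, true_and]
      exact label_relation h1.symm h2
    · have hang : axisAngle x.1 = 0 := by
        have h1 := div_norm_sq_add x.ne_zero
        rw [hy, hz, zero_div] at h1
        have h2 : 0 ≤ x.1 0 / ‖x.1‖ := div_nonneg hx (norm_nonneg _)
        rw [axisAngle, show x.1 0 / ‖x.1‖ = 1 by nlinarith, Real.arccos_one]
      rw [hang, neg_zero, if_neg fun h => hx.not_gt h.1, if_neg fun h => hx.not_gt h.1, mul_one,
        one_mul]

/-! ### Two loops with non-commuting monodromies -/

lemma norm_vec3_zero_zero {a : ℝ} (ha : 0 ≤ a) : ‖(!₂[a, 0, 0] : R3)‖ = a := by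
  rw [← sq_eq_sq₀ (norm_nonneg _) ha, norm_sq_R3]
  simp

/-- The first coordinate of the point of the first coordinate axis over `n`. -/
def axisRadius (n : ℤ) : ℝ := 2 ^ ((n : ℝ) + 1 / 2)

lemma axisRadius_pos (n : ℤ) : 0 < axisRadius n := by
  unfold axisRadius
  positivity

lemma vec3_notMem_range_arc₂ {a b : ℝ} (ha : 0 < a) : (!₂[a, 0, b] : R3) ∉ Set.range arc₂ := by
  rintro ⟨t, h⟩
  have h0 := congrArg (fun x : R3 => x 0) h
  simp only [arc₂, PiLp.smul_apply, Matrix.cons_val, smul_eq_mul] at h0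
  have h1 : 0 ≤ (2:ℝ) ^ t * Real.sqrt (1 - profile t ^ 2) := by positivity
  linarith

lemma axis_notMem_range_arc₁ (n : ℤ) : (!₂[axisRadius n, 0, 0] : R3) ∉ Set.range arc₁ := by
  rintro ⟨v, h⟩
  have hlog : arcLog v = n + 1 / 2 := by
    have := congrArg (fun x : R3 => Real.logb 2 ‖x‖) h
    simp only [norm_arc₁, logb_two_rpow, norm_vec3_zero_zero (axisRadius_pos n).le] at this
    rw [this, axisRadius, logb_two_rpow]
  have h0 := congrArg (fun x : R3 => x 0) h
  simp only [arc₁, PiLp.smul_apply, Matrix.cons_val, smul_eq_mul, hlog] at h0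
  rw [axisRadius, mul_eq_left₀ (by positivity)] at h0
  obtain ⟨k, hk⟩ := (Real.cos_eq_one_iff _).1 h0
  have hv : v = 2 * k - n - 1 / 2 := by
    have : π * (2 * k) = π * (v + (n + 1 / 2)) := by linarith
    have := mul_left_cancel₀ Real.pi_ne_zero this
    linarith
  rw [arcLog, hv, show 2 * π * (2 * k - n - 1 / 2) = -π + ((2 * k - n : ℤ) : ℝ) * (2 * π) by
    push_cast; ring, Real.sin_add_int_mul_two_pi, Real.sin_neg, Real.sin_pi] at hlog
  have : ((2 * k : ℤ) : ℝ) = ((2 * n + 1 : ℤ) : ℝ) := by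
    push_cast
    linarith
  have : 2 * k = 2 * n + 1 := by exact_mod_cast this
  omega

lemma vec3_mem_compl {a b : ℝ} (ha : 0 < a) (h : b = 0 → ∃ n, a = axisRadius n) :
    (!₂[a, 0, b] : R3) ∈ (((⋃ j, arcs j) ∪ {0})ᶜ : Set R3) := by
  rintro (hm | hm)
  · obtain ⟨j, hj⟩ := Set.mem_iUnion.1 hm
    fin_cases j
    · by_cases hb : b = 0
      · obtain ⟨n, rfl⟩ := h hb
        subst hb
        exact axis_notMem_range_arc₁ n hj
      · obtain ⟨v, hv⟩ := hj
        have := congrArg (fun x : R3 => x 2) hv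
        simp [arc₁] at this
        exact hb this.symm
    · exact vec3_notMem_range_arc₂ ha hj
  · have := congrArg (fun x : R3 => x 0) (show (!₂[a, 0, b] : R3) = 0 from hm)
    simp at this
    exact ha.ne' this

/-- The first coordinate along `gapLoop n`. -/
def gapLoopFst (n : ℤ) (s : ℝ) : ℝ :=
  (1 - 4 * s * (1 - s)) * axisRadius 0 + 4 * s * (1 - s) * axisRadius n

/-- The last coordinate along `gapLoop n`. -/
def gapLoopLast (s : ℝ) : ℝ := s * (1 / 2 - s) * (1 - s)

lemma gapLoop_mem (n : ℤ) (s : unitInterval) :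
    (!₂[gapLoopFst n s, 0, gapLoopLast s] : R3) ∈ (((⋃ j, arcs j) ∪ {0})ᶜ : Set R3) := by
  obtain ⟨s, hs0, hs1⟩ := s
  have h0 := axisRadius_pos 0
  have hn := axisRadius_pos n
  refine vec3_mem_compl ?_ fun h => ?_
  · have h1 : 0 ≤ 4 * s * (1 - s) := by nlinarith
    have h2 : 0 ≤ 1 - 4 * s * (1 - s) := by nlinarith [sq_nonneg (1 - 2 * s)]
    rcases h1.eq_or_lt with h1 | h1
    · simp only [gapLoopFst, ← h1]
      linarith
    · simp only [gapLoopFst]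
      have := mul_pos h1 hn
      have := mul_nonneg h2 h0.le
      linarith
  · simp only [gapLoopLast, mul_eq_zero] at h
    rcases h with (h | h) | h
    · exact ⟨0, by simp [gapLoopFst, h]⟩
    · have : s = 1 / 2 := by linarith
      exact ⟨n, by simp only [gapLoopFst, this]; ring⟩
    · have : s = 1 := by linarith
      exact ⟨0, by simp [gapLoopFst, this]⟩

/-- The loop going over the plane of the first arc from the gap number `0` to the gap number `n`
of the first coordinate axis, and back under the plane. -/
def gapLoop (n : ℤ) : C(unitInterval, ArcsCompl) where
  toFun s := ⟨!₂[gapLoopFst n s, 0, gapLoopLast s], gapLoop_mem n s⟩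
  continuous_toFun := by
    refine Continuous.subtype_mk (continuous_vec3 ?_ continuous_const ?_) _
    · unfold gapLoopFst
      fun_prop
    · unfold gapLoopLast
      fun_prop

/-- The point of the first coordinate axis in the gap number `n`. -/
def gapPoint (n : ℤ) : ArcsCompl :=
  ⟨!₂[axisRadius n, 0, 0], vec3_mem_compl (axisRadius_pos n) fun _ => ⟨n, rfl⟩⟩

lemma up_gapPoint (n : ℤ) : arcsGluing.up (gapPoint n) = affPerm n.negOnePow (n - 1) := by
  have h := axisRadius_pos n
  have h1 : axisAngle (gapPoint n).1 = 0 := by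
    simp only [axisAngle, gapPoint, norm_vec3_zero_zero h.le, Matrix.cons_val]
    rw [div_self h.ne', Real.arccos_one]
  have h2 : logNorm (gapPoint n).1 = n + 1 / 2 := by
    simp only [logNorm, gapPoint, norm_vec3_zero_zero h.le]
    rw [axisRadius, logb_two_rpow]
  change label (axisAngle (gapPoint n).1) (logNorm (gapPoint n).1) = _
  rw [h1, h2, label_zero_add_half]

lemma gapLoop_zero (n : ℤ) : gapLoop n 0 = gapPoint 0 := by
  apply Subtype.ext
  simp [gapLoop, gapPoint, gapLoopFst, gapLoopLast]

lemma gapLoop_one (n : ℤ) : gapLoop n 1 = gapPoint 0 := by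
  apply Subtype.ext
  simp [gapLoop, gapPoint, gapLoopFst, gapLoopLast]

lemma gapLoop_half (n : ℤ) {s : unitInterval} (h : (s : ℝ) = 1 / 2) : gapLoop n s = gapPoint n := by
  apply Subtype.ext
  have h1 : gapLoopFst n s = axisRadius n := by rw [gapLoopFst, h]; ring
  have h2 : gapLoopLast s = 0 := by rw [gapLoopLast, h]; ring
  simp [gapLoop, gapPoint, h1, h2]

lemma chart_gapLoop_of_nonneg (n : ℤ) (x : ArcsCompl) {s : unitInterval}
    (h : 0 ≤ gapLoopLast s) : arcsGluing.chart x (gapLoop n s) = 1 := by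
  have hy : arcsGluing.y (gapLoop n s) = 0 := rfl
  have hz : 0 ≤ arcsGluing.z (gapLoop n s) := h
  rw [CrossGluing.chart, if_pos hz, if_pos hy.ge]

lemma chart_gapLoop_of_neg (n : ℤ) (x : ArcsCompl) {s : unitInterval}
    (h : gapLoopLast s < 0) : arcsGluing.chart x (gapLoop n s) = (arcsGluing.up x)⁻¹ := by
  have hy : arcsGluing.y (gapLoop n s) = 0 := rfl
  have hz : arcsGluing.z (gapLoop n s) < 0 := h
  rw [CrossGluing.chart, if_neg hz.not_ge, if_pos hy.ge]

/-- The monodromy along `gapLoop n`. -/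
def gapMonodromy (n : ℤ) : Equiv.Perm (ZMod 3) :=
  (affPerm 1 (-1))⁻¹ * affPerm n.negOnePow (n - 1)

open Classical in
/-- The labels along the lift of `gapLoop n` starting at `l`. -/
def gapLabel (n : ℤ) (l : ZMod 3) (s : ℝ) : ZMod 3 :=
  if s ≤ 1 / 2 then l else if s < 1 then affPerm n.negOnePow (n - 1) l else gapMonodromy n l

lemma exists_lift_gapLoop (n : ℤ) (l : ZMod 3) :
    ∃ a : C(unitInterval, arcsGluing.core.TotalSpace), (∀ s, (a s).proj = gapLoop n s) ∧
      a 0 = arcsGluing.pt (gapPoint 0) l ∧ a 1 = arcsGluing.pt (gapPoint 0) (gapMonodromy n l) := by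
  have hneg {s : ℝ} (h1 : 1 / 2 < s) (h2 : s < 1) : gapLoopLast s < 0 := by
    unfold gapLoopLast
    have := mul_pos (mul_pos (show 0 < s by linarith) (sub_pos.2 h1)) (sub_pos.2 h2)
    linarith
  have hpos {s : ℝ} (h0 : 0 ≤ s) (h1 : s ≤ 1 / 2) : 0 ≤ gapLoopLast s := by
    unfold gapLoopLast
    have := mul_nonneg (mul_nonneg h0 (sub_nonneg.2 h1)) (show 0 ≤ 1 - s by linarith)
    linarith
  have hcont : Continuous fun s : unitInterval => arcsGluing.pt (gapLoop n s) (gapLabel n l s) := by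
    refine arcsGluing.continuous_pt (gapLoop n).continuous fun s₀ => ?_
    have hval := (continuous_subtype_val (p := fun s : ℝ => s ∈ unitInterval)).tendsto s₀
    rcases lt_trichotomy (s₀ : ℝ) (1 / 2) with h | h | h
    · filter_upwards [hval.eventually (eventually_lt_nhds h)] with s hs
      rw [chart_gapLoop_of_nonneg n _ (hpos s.2.1 hs.le),
        chart_gapLoop_of_nonneg n _ (hpos s₀.2.1 h.le), gapLabel, gapLabel, if_pos hs.le,
        if_pos h.le]
    · filter_upwards [hval.eventually (eventually_lt_nhds (show (s₀ : ℝ) < 1 by linarith))]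
        with s hs
      rw [chart_gapLoop_of_nonneg n _ (hpos s₀.2.1 h.le), gapLabel, gapLabel, if_pos h.le]
      rcases le_or_gt (s : ℝ) (1 / 2) with h' | h'
      · rw [chart_gapLoop_of_nonneg n _ (hpos s.2.1 h'), if_pos h']
      · rw [chart_gapLoop_of_neg n _ (hneg h' hs), if_neg h'.not_ge, if_pos hs,
          gapLoop_half n h, up_gapPoint]
        simp
    · rcases s₀.2.2.lt_or_eq with h1 | h1
      · filter_upwards [hval.eventually (eventually_lt_nhds h1),
          hval.eventually (eventually_gt_nhds h)] with s hs hs'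
        rw [chart_gapLoop_of_neg n _ (hneg hs' hs), chart_gapLoop_of_neg n _ (hneg h h1), gapLabel,
          gapLabel, if_neg hs'.not_ge, if_neg h.not_ge, if_pos hs, if_pos h1]
      · obtain rfl : s₀ = 1 := Subtype.ext h1
        filter_upwards [hval.eventually (eventually_gt_nhds h)] with s hs
        rcases s.2.2.lt_or_eq with h2 | h2
        · rw [chart_gapLoop_of_neg n _ (hneg hs h2),
            chart_gapLoop_of_nonneg n (gapLoop n 1) (s := 1) (by simp [gapLoopLast]), gapLabel,
            gapLabel, if_neg hs.not_ge, if_pos h2, if_neg h.not_ge, if_neg h1.not_lt, gapLoop_one,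
            up_gapPoint, gapMonodromy]
          simp
        · obtain rfl : s = 1 := Subtype.ext h2
          rfl
  refine ⟨⟨_, hcont⟩, fun s => rfl, ?_, ?_⟩
  · change arcsGluing.pt (gapLoop n 0) (gapLabel n l (0 : ℝ)) = _
    rw [gapLoop_zero, gapLabel, if_pos (by norm_num)]
  · change arcsGluing.pt (gapLoop n 1) (gapLabel n l (1 : ℝ)) = _
    rw [gapLoop_one, gapLabel, if_neg (by norm_num), if_neg (by norm_num)]

lemma not_loopsCommute_arcsCompl : ¬ LoopsCommute ArcsCompl := by
  intro h
  obtain ⟨a₁, ha₁, ha₁0, ha₁1⟩ := exists_lift_gapLoop 1 0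
  obtain ⟨b₁, hb₁, hb₁0, hb₁1⟩ := exists_lift_gapLoop 2 (gapMonodromy 1 0)
  obtain ⟨b₀, hb₀, hb₀0, hb₀1⟩ := exists_lift_gapLoop 2 0
  obtain ⟨a₀, ha₀, ha₀0, ha₀1⟩ := exists_lift_gapLoop 1 (gapMonodromy 2 0)
  have key := h.monodromy arcsGluing.isCoveringMap (a₁ := a₁) (b₁ := b₁) (a₀ := a₀) (b₀ := b₀)
    (fun s => (ha₁ s).trans (ha₀ s).symm) (fun s => (hb₁ s).trans (hb₀ s).symm)
    (by rw [ha₀, ha₀, gapLoop_zero, gapLoop_one]) (by rw [hb₀, hb₀, gapLoop_zero, gapLoop_one])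
    (by rw [hb₀0, ha₁0]) (by rw [hb₁0, ha₁1]) (by rw [ha₀0, hb₀1])
  rw [hb₁1, ha₀1] at key
  exact absurd (arcsGluing.pt_injective _ key) (by decide)

/-- **Debrunner–Fox.** There is a wild frame of `ν > 1` arcs each of which is tame and
each of which meets the unit sphere `S²` in exactly one point. -/
theorem exists_wild_frame_of_tame_arcs :
    ∃ (ν : ℕ) (L : Fin ν → Set R3), 1 < ν ∧ IsArcFrame L ∧
      ¬ IsTameFrame ν ((⋃ j, L j) ∪ {0}) ∧
      (∀ j, IsTameFrame 1 (L j ∪ {0})) ∧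
      (∀ j, IsSingletonSet (Metric.sphere (0:R3) 1 ∩ L j)) := by
  exact ⟨2, arcs, one_lt_two, isArcFrame_arcs,
    fun h => not_loopsCommute_arcsCompl h.loopsCommute_compl, isTameFrame_arcs,
    isSingletonSet_sphere_inter_arcs⟩
end
end
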